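/- Let $n_c = 10^{7}$, $\epsilon = 10/n_c$, $N_c = 10^{8}$. For every $D > 0$ there exists $K_0$ with the following property. Let $f$ be a classical solution of the relativistic Vlasov–Poisson system on $[0,T)$ that is axially symmetric, i.e. $f(t, R_\theta x, R_\theta v) = f(t,x,v)$ for every rotation $R_\theta$ about the $x_3$-axis, with $\|f(s,\cdot,\cdot)\|_{L^\infty} \le D$ and $\iint (1+|v|) f(s,x,v)\,dx\,dv \le D$ for all $s$, whose initial datum $f_0 := f(0,\cdot,\cdot)$ satisfies $\iint (1+|x|+|v|)^{N_c} f_0(x,v)\,dx\,dv \le D$ and $\iint |\slashed x \times \slashed v|^{-13} f_0(x,v)\,dx\,dv \le D$. Fix $t \in [0,T)$; define $\tilde M(t) := (1+t)^{n_c^2} + \sup_{s \in [0,t]} \iint (1+|v|)^{n_c} f(s,x,v)\,dx\,dv$ (assumed finite) and let $M_t$ be the least nonnegative integer $k$ with $2^k \ge \tilde M(t)^{1/(n_c-1)}$. Assume that through every $(x,v)$ there is a $C^1$ characteristic $(X(s;t,x,v), V(s;t,x,v))$ on $[0,t]$, i.e. $\partial_s X = V/\sqrt{1+|V|^2}$,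 $\partial_s V = E(s,X)$, $X(t;t,x,v) = x$, $V(t;t,x,v) = v$. Define $\beta_t := \sup \{\, \beta_t(x,v) : (x,v) \text{ with } |X(0;t,x,v)| + |V(0;t,x,v)| \le 2^{M_t/2} \,\}$, where $\beta_t(x,v) := \sup_{s \in [0,t]} \inf\{ k \in \mathbb{R}_{\ge 0} : |V(s;t,x,v)| \le 2^{k M_t} \}$. If $M_t \ge K_0$, then $\beta_t \le 1 - \epsilon/2$. -/

import Mathlib

open MeasureTheory Real Set
noncomputable section

abbrev E3 := EuclideanSpace ℝ (Fin 3)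

/-- The relativistic velocity `v̂ = v / √(1+|v|²)`. -/
def vhat (v : E3) : E3 := (Real.sqrt (1 + ‖v‖ ^ 2))⁻¹ • v

/-- The spatial density `ρ(t,x) = ∫ f(t,x,v) dv`. -/
def rvpRho (f : ℝ → E3 → E3 → ℝ) (t : ℝ) (x : E3) : ℝ := ∫ v, f t x v

/-- The electric field `E(t,x) = (4π)⁻¹ ∫ (x-y) ρ(t,y)/|x-y|³ dy`. -/
def rvpField (f : ℝ → E3 → E3 → ℝ) (t : ℝ) (x : E3) : E3 :=
  (4 * Real.pi)⁻¹ • ∫ y, (rvpRho f t y / ‖x - y‖ ^ 3) • (x - y)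

/-- `f` is a classical solution of the relativistic Vlasov–Poisson system on the
time interval `I`: it is nonnegative, `C¹`, and satisfies the transport equation
`∂ₜ f + v̂ ⋅ ∇ₓ f + E ⋅ ∇ᵥ f = 0` pointwise (phrased as the vanishing of the
derivative of `f` in the direction `(1, v̂, E(t,x))`). -/
def IsRVPSolution (I : Set ℝ) (f : ℝ → E3 → E3 → ℝ) : Prop :=
  (∀ t ∈ I, ∀ x v, 0 ≤ f t x v) ∧
  ContDiffOn ℝ 1 (fun p : ℝ × E3 × E3 => f p.1 p.2.1 p.2.2) (I ×ˢ (Set.univ : Set (E3 × E3))) ∧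
  ∀ t ∈ I, ∀ x v,
    fderivWithin ℝ (fun p : ℝ × E3 × E3 => f p.1 p.2.1 p.2.2)
      (I ×ˢ (Set.univ : Set (E3 × E3))) (t, x, v) (1, vhat v, rvpField f t x) = 0

/-- Rotation by angle `θ` about the `x₃`-axis. -/
def rotZ (θ : ℝ) (x : E3) : E3 :=
  !₂[x 0 * Real.cos θ - x 1 * Real.sin θ, x 0 * Real.sin θ + x 1 * Real.cos θ, x 2]

/-- The norm `|x̸|` of the horizontal projection `x̸ = (x₁, x₂)`. -/
def slashN (x : E3) : ℝ := Real.sqrt (x 0 ^ 2 + x 1 ^ 2)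

/-- The constant `n_c = 10⁷`, as a real number. -/
def ncR : ℝ := 10 ^ 7

/-- The constant `ε = 10 / n_c`. -/
def epsC : ℝ := 10 / 10 ^ 7

/-- The constant `ε⋆ = ε / 100`. -/
def epsStar : ℝ := epsC / 100

/-- The `n_c`-th velocity moment `M_{n_c}(s)`, with `n_c = 10⁷`. -/
def momentNc (f : ℝ → E3 → E3 → ℝ) (s : ℝ) : ℝ :=
  ∫ p : E3 × E3, (1 + ‖p.2‖) ^ (10 ^ 7 : ℕ) * f s p.1 p.2

/-- The enlarged moment `\tilde M^c(t) = (1+t)^{n_c²} + sup_{s ∈ [0,t]} M_{n_c}(s)`. -/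
def tildeMc (f : ℝ → E3 → E3 → ℝ) (t : ℝ) : ℝ :=
  (1 + t) ^ (10 ^ 14 : ℕ) + sSup (momentNc f '' Set.Icc 0 t)

open Filter Topology
open scoped ENNReal

/-! ### Coordinates and rotations -/

lemma norm_sq_coord (x : E3) : ‖x‖ ^ 2 = x 0 ^ 2 + x 1 ^ 2 + x 2 ^ 2 := by
  rw [EuclideanSpace.real_norm_sq_eq, Fin.sum_univ_three]

lemma slashN_nonneg (x : E3) : 0 ≤ slashN x := Real.sqrt_nonneg _

lemma slashN_sq (x : E3) : slashN x ^ 2 = x 0 ^ 2 + x 1 ^ 2 :=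
  Real.sq_sqrt (by positivity)

lemma slashN_le_norm (x : E3) : slashN x ≤ ‖x‖ := by
  refine abs_le_of_sq_le_sq' ?_ (norm_nonneg x) |>.2
  rw [slashN_sq, norm_sq_coord]; nlinarith [sq_nonneg (x 2)]

lemma abs_coord_le_norm (x : E3) (i : Fin 3) : |x i| ≤ ‖x‖ := by
  simpa using PiLp.norm_apply_le x i

lemma continuous_slashN : Continuous slashN := by
  unfold slashN; fun_prop

@[simp] lemma rotZ_zero_coord (θ : ℝ) (x : E3) :
    rotZ θ x 0 = x 0 * Real.cos θ - x 1 * Real.sin θ := by simp [rotZ]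

@[simp] lemma rotZ_one_coord (θ : ℝ) (x : E3) :
    rotZ θ x 1 = x 0 * Real.sin θ + x 1 * Real.cos θ := by simp [rotZ]

@[simp] lemma rotZ_two_coord (θ : ℝ) (x : E3) : rotZ θ x 2 = x 2 := by simp [rotZ]

lemma rotZ_neg_rotZ (θ : ℝ) (x : E3) : rotZ (-θ) (rotZ θ x) = x := by
  ext i
  fin_cases i
  · simp; linear_combination x 0 * Real.sin_sq_add_cos_sq θ
  · simp; linear_combination x 1 * Real.sin_sq_add_cos_sq θ
  · simp

lemma norm_rotZ (θ : ℝ) (x : E3) : ‖rotZ θ x‖ = ‖x‖ := by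
  have : ‖rotZ θ x‖ ^ 2 = ‖x‖ ^ 2 := by
    simp only [norm_sq_coord, rotZ_zero_coord, rotZ_one_coord, rotZ_two_coord]
    linear_combination (x 0 ^ 2 + x 1 ^ 2) * Real.sin_sq_add_cos_sq θ
  exact (pow_left_inj₀ (norm_nonneg _) (norm_nonneg _) two_ne_zero).1 this

lemma slashN_rotZ (θ : ℝ) (x : E3) : slashN (rotZ θ x) = slashN x := by
  have : slashN (rotZ θ x) ^ 2 = slashN x ^ 2 := by
    simp only [slashN_sq, rotZ_zero_coord, rotZ_one_coord]
    linear_combination (x 0 ^ 2 + x 1 ^ 2) * Real.sin_sq_add_cos_sq θ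
  exact (pow_left_inj₀ (slashN_nonneg _) (slashN_nonneg _) two_ne_zero).1 this

/-- Rotations about the vertical axis as linear isometries. -/
def rotIso (θ : ℝ) : E3 ≃ₗᵢ[ℝ] E3 where
  toFun := rotZ θ
  invFun := rotZ (-θ)
  map_add' x y := by
    ext i; fin_cases i <;> simp <;> ring
  map_smul' c x := by
    ext i; fin_cases i <;> simp <;> ring
  left_inv := rotZ_neg_rotZ θ
  right_inv x := by simpa using rotZ_neg_rotZ (-θ) x
  norm_map' := norm_rotZ θ

lemma measurePreserving_rotZ (θ : ℝ) : MeasurePreserving (rotZ θ) := by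
  have := (rotIso θ).measurePreserving
  exact this

lemma continuous_rotZ_uncurry : Continuous (fun p : ℝ × E3 => rotZ p.1 p.2) := by
  unfold rotZ
  refine (PiLp.continuous_toLp 2 _).comp ?_
  refine continuous_pi fun i => ?_
  fin_cases i <;> simp <;> fun_prop

/-- The diagonal rotation of phase space. -/
def rotP (θ : ℝ) (p : E3 × E3) : E3 × E3 := (rotZ θ p.1, rotZ θ p.2)

lemma measurePreserving_rotP (θ : ℝ) : MeasurePreserving (rotP θ) :=
  (measurePreserving_rotZ θ).prod (measurePreserving_rotZ θ)

lemma continuous_rotP_uncurry : Continuous (fun p : ℝ × (E3 × E3) => rotP p.1 p.2) := by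
  unfold rotP
  exact (continuous_rotZ_uncurry.comp (by fun_prop : Continuous fun p : ℝ × (E3 × E3) =>
    (p.1, p.2.1))).prodMk (continuous_rotZ_uncurry.comp
      (by fun_prop : Continuous fun p : ℝ × (E3 × E3) => (p.1, p.2.2)))

/-- Averaging an integral over a measurable family of measure preserving maps indexed by an angle. -/
lemma lintegral_average {α : Type*} [MeasureSpace α] [SFinite (volume : Measure α)]
    (T : ℝ → α → α) (hT : Measurable (fun p : ℝ × α => T p.1 p.2))
    (hp : ∀ θ, MeasurePreserving (T θ)) {H : α → ℝ≥0∞} (hH : Measurable H) :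
    ENNReal.ofReal (2 * π) * ∫⁻ a, H a = ∫⁻ a, ∫⁻ θ in Ioc (-π) π, H (T θ a) := by
  rw [lintegral_lintegral_swap]
  · have : ∀ θ, ∫⁻ a, H (T θ a) = ∫⁻ a, H a := fun θ => (hp θ).lintegral_comp hH
    simp only [this, lintegral_const, Measure.restrict_apply MeasurableSet.univ, univ_inter,
      Real.volume_Ioc]
    rw [mul_comm]; congr 2; ring
  · exact (hH.comp (hT.comp measurable_swap)).aemeasurable

/-! ### The Coulomb kernel -/

/-- The kernel `|y|⁻²`. -/
def invSq (y : E3) : ℝ≥0∞ := ENNReal.ofReal ((‖y‖ ^ 2)⁻¹)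

lemma measurable_invSq : Measurable invSq := by
  unfold invSq
  exact ENNReal.measurable_ofReal.comp ((measurable_norm.pow_const 2).inv)

lemma lintegral_invSq_ball {δ : ℝ} (hδ : 0 < δ) :
    ∫⁻ y in {y : E3 | ‖y‖ ≤ δ}, invSq y = ENNReal.ofReal (4 * π * δ) := by
  set k : ℝ → ℝ := (Iic δ).indicator (fun r => (r ^ 2)⁻¹) with hk
  have hm : MeasurableSet {y : E3 | ‖y‖ ≤ δ} := measurableSet_le measurable_norm measurable_const
  have e1 : ∀ y : E3, ({y : E3 | ‖y‖ ≤ δ}).indicator invSq y = ENNReal.ofReal (k ‖y‖) := by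
    intro y
    by_cases h : ‖y‖ ≤ δ
    · rw [indicator_of_mem (by exact h), hk, indicator_of_mem (by exact h), invSq]
    · rw [indicator_of_notMem (by exact h), hk, indicator_of_notMem (by exact h)]; simp
  have hpt : ∀ y ∈ Ioi (0 : ℝ), y ^ (Module.finrank ℝ E3 - 1) • k y = (Iic δ).indicator 1 y := by
    intro y hy
    have hy' : y ≠ 0 := ne_of_gt hy
    simp only [finrank_euclideanSpace, Fintype.card_fin, hk]
    by_cases h : y ≤ δ
    · rw [indicator_of_mem (by exact h), indicator_of_mem (by exact h)]; simp; field_simp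
    · rw [indicator_of_notMem (by exact h), indicator_of_notMem (by exact h)]; simp
  have hint : Integrable (fun y : E3 => k ‖y‖) := by
    refine (integrable_fun_norm_addHaar (volume : Measure E3) (f := k)).2 ?_
    rw [integrableOn_congr_fun hpt measurableSet_Ioi]
    change IntegrableOn (indicator _ (fun _ => (1 : ℝ))) _ (volume : Measure ℝ)
    rw [IntegrableOn, integrable_indicator_iff measurableSet_Iic, IntegrableOn,
      Measure.restrict_restrict measurableSet_Iic, Iic_inter_Ioi]
    exact integrable_const _
  have hval : ∫ y : E3, k ‖y‖ = 4 * π * δ := by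
    rw [integral_fun_norm_addHaar, setIntegral_congr_fun measurableSet_Ioi hpt]
    change _ • _ • ∫ y in Ioi (0 : ℝ), indicator _ (fun _ => (1 : ℝ)) y = _
    rw [setIntegral_indicator measurableSet_Iic, inter_comm, Iic_inter_Ioi]
    simp only [finrank_euclideanSpace, Fintype.card_fin, Measure.real,
      EuclideanSpace.volume_ball_fin_three]
    simp [hδ.le]
    rw [ENNReal.toReal_ofReal (by positivity)]
    ring
  rw [← lintegral_indicator hm, lintegral_congr e1, ← hval,
    ofReal_integral_eq_lintegral_ofReal hint]
  refine Filter.Eventually.of_forall fun y => ?_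
  rw [hk]
  exact indicator_nonneg (fun r _ => by positivity) _

/-- The regularised kernel dominating `|y|⁻²` away from the ball of radius `δ`. -/
def softK (δ : ℝ) (y : E3) : ℝ≥0∞ := ENNReal.ofReal (2 / (δ ^ 2 + ‖y‖ ^ 2))

lemma measurable_softK {α : Type*} [MeasurableSpace α] {a : α → ℝ} {b : α → E3}
    (ha : Measurable a) (hb : Measurable b) : Measurable fun p => softK (a p) (b p) := by
  unfold softK
  exact ENNReal.measurable_ofReal.comp
    (measurable_const.div ((ha.pow_const 2).add (hb.norm.pow_const 2)))

lemma invSq_le_softK {δ : ℝ} {y : E3} (hδ : 0 < δ) (h : δ ≤ ‖y‖) : invSq y ≤ softK δ y := by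
  unfold invSq softK
  apply ENNReal.ofReal_le_ofReal
  have hy : 0 < ‖y‖ := hδ.trans_le h
  rw [inv_eq_one_div, div_le_div_iff₀ (by positivity) (by positivity)]
  nlinarith

lemma softK_le {δ : ℝ} (hδ : 0 < δ) (y : E3) : softK δ y ≤ ENNReal.ofReal (2 / δ ^ 2) := by
  unfold softK
  apply ENNReal.ofReal_le_ofReal
  gcongr
  nlinarith [sq_nonneg ‖y‖]

/-- Splitting the field integral over a set `B` of phase space at a velocity dependent radius. -/
lemma near_far {g : E3 × E3 → ℝ≥0∞} {D : ℝ≥0∞} (hgD : ∀ p, g p ≤ D)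
    {B : Set (E3 × E3)} (hB : MeasurableSet B) {A : Set E3} (hA : MeasurableSet A)
    {δ : E3 → ℝ} (hδ : Measurable δ) (hδ0 : ∀ v, 0 < δ v) (b : ℝ≥0∞) (x : E3)
    (hBA : ∀ y, ∫⁻ v, B.indicator 1 (y, v) * {v | ‖x - y‖ ≤ δ v}.indicator 1 v ≤
      b * ∫⁻ v, A.indicator 1 v * {v | ‖x - y‖ ≤ δ v}.indicator 1 v) :
    ∫⁻ p in B, g p * invSq (x - p.1) ≤
      D * b * ENNReal.ofReal (4 * π) * (∫⁻ v in A, ENNReal.ofReal (δ v)) +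
        ∫⁻ p in B, g p * softK (δ p.2) (x - p.1) := by
  obtain ⟨N, hN⟩ : ∃ N : Set (E3 × E3), N = {p | ‖x - p.1‖ ≤ δ p.2} := ⟨_, rfl⟩
  have hNm : MeasurableSet N := by
    rw [hN]; exact measurableSet_le (by fun_prop) (hδ.comp measurable_snd)
  have hkm : Measurable fun p : E3 × E3 => invSq (x - p.1) := measurable_invSq.comp (by fun_prop)
  have hsm : Measurable fun p : E3 × E3 => softK (δ p.2) (x - p.1) :=
    measurable_softK (hδ.comp measurable_snd) (by fun_prop)
  have h1 : ∀ p, B.indicator (fun p => g p * invSq (x - p.1)) p ≤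
      D * (invSq (x - p.1) * (B.indicator 1 p * N.indicator 1 p)) +
        B.indicator (fun p => g p * softK (δ p.2) (x - p.1)) p := by
    intro p
    by_cases hp : p ∈ B
    · by_cases hn : p ∈ N
      · simp only [indicator_of_mem hp, indicator_of_mem hn, Pi.one_apply, mul_one]
        exact le_add_right (mul_le_mul' (hgD p) le_rfl)
      · simp only [indicator_of_mem hp]
        refine le_add_left (mul_le_mul' le_rfl (invSq_le_softK (hδ0 _) ?_))
        rw [hN] at hn
        exact (not_le.1 hn).le
    · simp [indicator_of_notMem hp]
  rw [← lintegral_indicator hB, ← lintegral_indicator hB]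
  refine (lintegral_mono h1).trans ?_
  have hBN : Measurable fun p : E3 × E3 => (B.indicator 1 p * N.indicator 1 p : ℝ≥0∞) :=
    (measurable_one.indicator hB).mul (measurable_one.indicator hNm)
  have hkBN : Measurable fun p : E3 × E3 =>
      invSq (x - p.1) * (B.indicator 1 p * N.indicator 1 p) := hkm.mul hBN
  rw [lintegral_add_left (hkBN.const_mul D), lintegral_const_mul _ hkBN]
  refine add_le_add ?_ le_rfl
  have hsplit : ∫⁻ p : E3 × E3, invSq (x - p.1) * (B.indicator 1 p * N.indicator 1 p) =
      ∫⁻ y, ∫⁻ v, invSq (x - y) * (B.indicator 1 (y, v) * N.indicator 1 (y, v)) :=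
    lintegral_prod _ hkBN.aemeasurable
  rw [hsplit, mul_assoc, mul_assoc]
  refine mul_le_mul' le_rfl ?_
  have hAN : Measurable fun p : E3 × E3 => (A.indicator 1 p.2 * N.indicator 1 p : ℝ≥0∞) :=
    ((measurable_one.indicator hA).comp measurable_snd).mul (measurable_one.indicator hNm)
  have hkAN : Measurable fun p : E3 × E3 =>
      invSq (x - p.1) * (A.indicator 1 p.2 * N.indicator 1 p) := hkm.mul hAN
  have hNi : ∀ y v, (N.indicator 1 (y, v) : ℝ≥0∞) = {v | ‖x - y‖ ≤ δ v}.indicator 1 v :=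
    fun y v => by simp [hN, indicator]
  have hBNy : ∀ y, Measurable fun v => (B.indicator 1 (y, v) * N.indicator 1 (y, v) : ℝ≥0∞) :=
    fun y => hBN.comp measurable_prodMk_left
  have hANy : ∀ y, Measurable fun v => (A.indicator 1 v * N.indicator 1 (y, v) : ℝ≥0∞) :=
    fun y => (measurable_one.indicator hA).mul
      ((measurable_one.indicator hNm).comp measurable_prodMk_left)
  have hkANv : ∀ v, Measurable fun y => invSq (x - y) * (A.indicator 1 v * N.indicator 1 (y, v)) :=
    fun v => (measurable_invSq.comp (measurable_const.sub measurable_id)).mul (measurable_const.mul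
      ((measurable_one.indicator hNm).comp measurable_prodMk_right))
  calc ∫⁻ y, ∫⁻ v, invSq (x - y) * (B.indicator 1 (y, v) * N.indicator 1 (y, v))
      ≤ ∫⁻ y, ∫⁻ v, b * (invSq (x - y) * (A.indicator 1 v * N.indicator 1 (y, v))) := by
        refine lintegral_mono fun y => ?_
        rw [lintegral_const_mul _ (hBNy y),
          lintegral_const_mul _ ((hANy y).const_mul _),
          lintegral_const_mul _ (hANy y), mul_left_comm]
        refine mul_le_mul' le_rfl ?_
        simpa only [hNi] using hBA y
    _ = ∫⁻ v, ∫⁻ y, b * (invSq (x - y) * (A.indicator 1 v * N.indicator 1 (y, v))) := by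
        rw [lintegral_lintegral_swap]
        exact (hkAN.const_mul b).aemeasurable
    _ = ∫⁻ v, b * (ENNReal.ofReal (4 * π) * A.indicator (fun v => ENNReal.ofReal (δ v)) v) := by
        refine lintegral_congr fun v => ?_
        rw [lintegral_const_mul _ (hkANv v)]
        congr 1
        by_cases hv : v ∈ A
        · simp only [indicator_of_mem hv, Pi.one_apply, one_mul]
          rw [← ENNReal.ofReal_mul (by positivity), ← lintegral_invSq_ball (hδ0 v)]
          have hm : MeasurableSet {y : E3 | ‖y‖ ≤ δ v} :=
            measurableSet_le measurable_norm measurable_const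
          rw [← lintegral_indicator hm, ← lintegral_sub_left_eq_self _ x]
          refine lintegral_congr fun y => ?_
          by_cases hy : ‖y‖ ≤ δ v <;> simp [hN, indicator, hy]
        · simp [indicator_of_notMem hv]
    _ = b * (ENNReal.ofReal (4 * π) * ∫⁻ v in A, ENNReal.ofReal (δ v)) := by
        have hm : Measurable fun v => A.indicator (fun v => ENNReal.ofReal (δ v)) v :=
          (ENNReal.measurable_ofReal.comp hδ).indicator hA
        rw [lintegral_const_mul _ (hm.const_mul _), lintegral_const_mul _ hm,
          lintegral_indicator hA]

/-! ### Averaging over rings -/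

lemma exists_polar (x : E3) :
    ∃ a : ℝ, x 0 = slashN x * Real.cos a ∧ x 1 = slashN x * Real.sin a := by
  have h : ‖(⟨x 0, x 1⟩ : ℂ)‖ = slashN x := by
    rw [Complex.norm_def, Complex.normSq_mk, slashN]; congr 1; ring
  refine ⟨Complex.arg ⟨x 0, x 1⟩, ?_, ?_⟩
  · rw [← h, Complex.norm_mul_cos_arg]
  · rw [← h, Complex.norm_mul_sin_arg]

lemma integral_ring_kernel_le {a R r : ℝ} (ha : 0 < a) (hR : 0 ≤ R) (hr : 0 < r)
    (har : |R - r| ≤ a) :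
    ∫ φ in (-π)..π, 2 / (a ^ 2 + 2 * R * r * (1 - Real.cos φ)) ≤ 8 * π / (a * r) := by
  have hcos : ∀ φ, 0 ≤ 1 - Real.cos φ := fun φ => sub_nonneg.2 (Real.cos_le_one φ)
  have hden : ∀ φ, 0 < a ^ 2 + 2 * R * r * (1 - Real.cos φ) := fun φ => by
    have := hcos φ; positivity
  have hcont : Continuous fun φ => 2 / (a ^ 2 + 2 * R * r * (1 - Real.cos φ)) :=
    Continuous.div (by fun_prop) (by fun_prop) fun φ => (hden φ).ne'
  have hππ : -π ≤ π := by linarith [Real.pi_pos]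
  rcases le_or_gt (r / 2) R with h | h
  · set m : ℝ := Real.sqrt 2 * r / (π * a) with hm
    have hm0 : 0 < m := by positivity
    have hm2 : m ^ 2 * (π ^ 2 * a ^ 2) = 2 * r ^ 2 := by
      rw [hm, div_pow, mul_pow, Real.sq_sqrt (by norm_num)]; field_simp
    have hle : ∀ φ ∈ Icc (-π) π, 2 / (a ^ 2 + 2 * R * r * (1 - Real.cos φ)) ≤
        2 / a ^ 2 * (1 + (m * φ) ^ 2)⁻¹ := by
      intro φ hφ
      have h1 := Real.cos_le_one_sub_mul_cos_sq (abs_le.2 hφ)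
      have h2 : (m * φ) ^ 2 * a ^ 2 ≤ 2 * R * r * (1 - Real.cos φ) := by
        have e : (m * φ) ^ 2 * a ^ 2 = r ^ 2 * (2 / π ^ 2 * φ ^ 2) := by
          have : m ^ 2 * a ^ 2 = 2 * r ^ 2 / π ^ 2 := by
            rw [eq_div_iff (by positivity)]; linarith
          calc (m * φ) ^ 2 * a ^ 2 = (m ^ 2 * a ^ 2) * φ ^ 2 := by ring
            _ = _ := by rw [this]; ring
        rw [e]
        have : r ^ 2 ≤ 2 * R * r := by nlinarith
        exact mul_le_mul this (by linarith) (by positivity) (by positivity)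
      rw [← div_eq_mul_inv, div_div]
      apply div_le_div_of_nonneg_left (by norm_num) (by positivity)
      have e3 : a ^ 2 * (1 + (m * φ) ^ 2) = a ^ 2 + (m * φ) ^ 2 * a ^ 2 := by ring
      rw [e3]
      exact add_le_add le_rfl h2
    have hint : ∫ φ in (-π)..π, 2 / a ^ 2 * (1 + (m * φ) ^ 2)⁻¹ ≤ 2 / a ^ 2 * (π / m) := by
      rw [intervalIntegral.integral_const_mul,
        intervalIntegral.integral_comp_mul_left (fun x => (1 + x ^ 2)⁻¹) hm0.ne',
        integral_inv_one_add_sq, smul_eq_mul, div_eq_inv_mul π m]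
      gcongr
      linarith [Real.arctan_lt_pi_div_two (m * π), Real.neg_pi_div_two_lt_arctan (m * -π)]
    refine (intervalIntegral.integral_mono_on hππ (hcont.intervalIntegrable _ _) ?_ hle).trans
      (hint.trans ?_)
    · apply Continuous.intervalIntegrable
      exact continuous_const.mul (Continuous.inv₀ (by fun_prop) fun x => by positivity)
    · have e : 2 / a ^ 2 * (π / m) = Real.sqrt 2 * π * π / (a * r) := by
        rw [hm]
        have h2 : Real.sqrt 2 * Real.sqrt 2 = 2 := Real.mul_self_sqrt (by norm_num)
        field_simp
        linarith
      rw [e]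
      gcongr
      have h2 : Real.sqrt 2 ≤ 2 := Real.sqrt_le_iff.2 (by norm_num)
      nlinarith [Real.pi_le_four, Real.pi_pos, Real.sqrt_nonneg 2]
  · have ha2 : r / 2 ≤ a := by
      refine le_trans ?_ har
      rw [abs_sub_comm]; exact le_trans (by linarith) (le_abs_self _)
    have hle : ∀ φ ∈ Icc (-π) π, 2 / (a ^ 2 + 2 * R * r * (1 - Real.cos φ)) ≤ 4 / (a * r) := by
      intro φ _
      rw [div_le_div_iff₀ (hden φ) (by positivity)]
      have := mul_nonneg (mul_nonneg hR hr.le) (hcos φ)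
      nlinarith
    refine (intervalIntegral.integral_mono_on hππ (hcont.intervalIntegrable _ _)
      (by simp) hle).trans (le_of_eq ?_)
    rw [intervalIntegral.integral_const, smul_eq_mul]; ring

lemma lintegral_softK_ring_le (x y : E3) {δ : ℝ} (hδ : 0 < δ) (hy : 0 < slashN y) :
    ∫⁻ θ in Ioc (-π) π, softK δ (x - rotZ θ y) ≤ ENNReal.ofReal (2 * π) *
      ENNReal.ofReal (4 / (Real.sqrt (δ ^ 2 + (slashN x - slashN y) ^ 2) * slashN y)) := by
  obtain ⟨a, ha0, ha1⟩ := exists_polar x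
  obtain ⟨b, hb0, hb1⟩ := exists_polar y
  set R := slashN x with hR
  set r := slashN y with hr
  have hRn : 0 ≤ R := slashN_nonneg x
  set A := Real.sqrt (δ ^ 2 + (R - r) ^ 2) with hA
  have hA2 : A ^ 2 = δ ^ 2 + (R - r) ^ 2 := Real.sq_sqrt (by positivity)
  have hA0 : 0 < A := Real.sqrt_pos.2 (by positivity)
  set k : ℝ → ℝ := fun φ => 2 / (A ^ 2 + 2 * R * r * (1 - Real.cos φ)) with hk
  have hden : ∀ φ, 0 < A ^ 2 + 2 * R * r * (1 - Real.cos φ) := fun φ => by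
    have := sub_nonneg.2 (Real.cos_le_one φ); positivity
  have hcont : Continuous k := Continuous.div (by fun_prop) (by fun_prop) fun φ => (hden φ).ne'
  have hle : ∀ θ, softK δ (x - rotZ θ y) ≤ ENNReal.ofReal (k (θ + (b - a))) := by
    intro θ
    unfold softK
    apply ENNReal.ofReal_le_ofReal
    rw [hk]
    apply div_le_div_of_nonneg_left (by norm_num) (hden _)
    have e : ‖x - rotZ θ y‖ ^ 2 =
        (R - r) ^ 2 + 2 * R * r * (1 - Real.cos (θ + (b - a))) + (x 2 - y 2) ^ 2 := by
      rw [norm_sq_coord]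
      simp only [PiLp.sub_apply, rotZ_zero_coord, rotZ_one_coord, rotZ_two_coord, ha0, ha1, hb0,
        hb1]
      rw [show θ + (b - a) = (θ + b) - a by ring, Real.cos_sub, Real.cos_add, Real.sin_add]
      have h1 := Real.sin_sq_add_cos_sq a
      have h2 := Real.sin_sq_add_cos_sq b
      have h3 := Real.sin_sq_add_cos_sq θ
      linear_combination R ^ 2 * h1 + r ^ 2 * (Real.sin θ ^ 2 + Real.cos θ ^ 2) * h2 + r ^ 2 * h3
    rw [e, hA2]
    nlinarith [sq_nonneg (x 2 - y 2)]
  refine (lintegral_mono hle).trans ?_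
  have hππ : -π ≤ π := by linarith [Real.pi_pos]
  have hc2 : Continuous fun θ => k (θ + (b - a)) := hcont.comp (by fun_prop)
  rw [← ofReal_integral_eq_lintegral_ofReal
    ((hc2.intervalIntegrable (-π) π).1) (Filter.Eventually.of_forall fun θ => (by
      have := hden (θ + (b - a)); positivity)), ← ENNReal.ofReal_mul (by positivity)]
  apply ENNReal.ofReal_le_ofReal
  rw [← intervalIntegral.integral_of_le hππ]
  have hper : Function.Periodic k (2 * π) := fun φ => by simp [hk]
  have hshift : ∫ θ in (-π)..π, k (θ + (b - a)) = ∫ θ in (-π)..π, k θ := by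
    rw [intervalIntegral.integral_comp_add_right (fun θ => k θ)]
    have := hper.intervalIntegral_add_eq (-π + (b - a)) (-π)
    convert this using 2 <;> ring
  rw [hshift]
  refine (integral_ring_kernel_le hA0 hRn hy ?_).trans (le_of_eq ?_)
  · rw [hA]; apply Real.abs_le_sqrt; nlinarith
  · field_simp; norm_num

/-- Ring average of the regularised field of an axially symmetric density. -/
lemma lintegral_softK_le_ring {h : E3 × E3 → ℝ≥0∞} (hh : Measurable h)
    (hinv : ∀ θ p, h (rotP θ p) = h p) {δ : E3 → ℝ} (hδ : Measurable δ) (hδ0 : ∀ v, 0 < δ v)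
    (hδi : ∀ θ v, δ (rotZ θ v) = δ v) (hs : ∀ p, h p ≠ 0 → 0 < slashN p.1) (x : E3) :
    ∫⁻ p, h p * softK (δ p.2) (x - p.1) ≤ ∫⁻ p, h p *
      ENNReal.ofReal (4 / (Real.sqrt (δ p.2 ^ 2 + (slashN x - slashN p.1) ^ 2) * slashN p.1)) := by
  have h2π : ENNReal.ofReal (2 * π) ≠ 0 := by
    simp [Real.pi_pos]
  have hm : Measurable fun p : E3 × E3 => h p * softK (δ p.2) (x - p.1) :=
    hh.mul (measurable_softK (hδ.comp measurable_snd) (by fun_prop))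
  rw [← ENNReal.mul_le_mul_iff_right h2π ENNReal.ofReal_ne_top,
    lintegral_average rotP continuous_rotP_uncurry.measurable measurePreserving_rotP hm,
    ← lintegral_const_mul' _ _ ENNReal.ofReal_ne_top]
  refine lintegral_mono fun p => ?_
  simp only [hinv]
  simp only [rotP, hδi]
  by_cases hp : h p = 0
  · simp [hp]
  · have hm : Measurable fun θ => softK (δ p.2) (x - rotZ θ p.1) := by
      refine measurable_softK measurable_const (measurable_const.sub ?_)
      exact (continuous_rotZ_uncurry.comp (by fun_prop : Continuous fun θ : ℝ =>
        (θ, p.1))).measurable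
    rw [lintegral_const_mul _ hm, mul_left_comm]
    exact mul_le_mul' le_rfl (lintegral_softK_ring_le x p.1 (hδ0 _) (hs p hp))

/-! ### Dyadic scales -/

/-- Sum over the scales `r = 2 ^ j * η`, `j ≤ J`, of `r² / (r² + u²)^{3/2}`. -/
def scaleSum (η : ℝ) (J : ℕ) (u : ℝ) : ℝ :=
  ∑ j ∈ Finset.range (J + 1), (2 ^ j * η) ^ 2 / Real.sqrt ((2 ^ j * η) ^ 2 + u ^ 2) ^ 3

lemma scaleSum_nonneg (η : ℝ) (J : ℕ) (u : ℝ) : 0 ≤ scaleSum η J u :=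
  Finset.sum_nonneg fun _ _ => by positivity

lemma inv_sqrt_le_scaleSum {η : ℝ} {J : ℕ} (hη : 0 < η) (hJ : 2 ^ J * η = 1) (u : ℝ) :
    1 / Real.sqrt (η ^ 2 + u ^ 2) ≤ 1 + 8 * scaleSum η J u := by
  have hs := scaleSum_nonneg η J u
  set q := Real.sqrt (η ^ 2 + u ^ 2) with hq
  have hq0 : 0 < q := Real.sqrt_pos.2 (by positivity)
  have hηq : η ≤ q := Real.le_sqrt_of_sq_le (by nlinarith [sq_nonneg u])
  have huq : |u| ≤ q := Real.abs_le_sqrt (by nlinarith [sq_nonneg η])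
  rcases le_or_gt 1 |u| with h | h
  · have : 1 / q ≤ 1 := by rw [div_le_one hq0]; linarith
    linarith
  · have hex : ∃ j : ℕ, |u| ≤ 2 ^ j * η := ⟨J, by linarith⟩
    classical
    set j := Nat.find hex with hj
    have hj1 : |u| ≤ 2 ^ j * η := Nat.find_spec hex
    have hjJ : j ≤ J := Nat.find_min' hex (by linarith)
    have hj2 : 2 ^ j * η ≤ 2 * q := by
      rcases Nat.eq_zero_or_pos j with h0 | h0
      · rw [h0]; linarith [hηq, hq0]
      · have := Nat.find_min hex (Nat.sub_lt h0 one_pos)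
        rw [not_le] at this
        have e : (2 : ℝ) ^ j = 2 * 2 ^ (j - 1) := by
          rw [← pow_succ']; congr 1; omega
        rw [e]; linarith
    set r := 2 ^ j * η with hr
    have hr0 : 0 < r := by positivity
    have hterm : r ^ 2 / Real.sqrt (r ^ 2 + u ^ 2) ^ 3 ≤ scaleSum η J u :=
      Finset.single_le_sum (f := fun j : ℕ => (2 ^ j * η) ^ 2 /
        Real.sqrt ((2 ^ j * η) ^ 2 + u ^ 2) ^ 3) (fun _ _ => by positivity)
        (Finset.mem_range.2 (by omega))
    have hsq : Real.sqrt (r ^ 2 + u ^ 2) ≤ 3 / 2 * r := by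
      refine Real.sqrt_le_iff.2 ⟨by positivity, ?_⟩
      have : u ^ 2 ≤ r ^ 2 := sq_le_sq' (by linarith [neg_abs_le u]) (by linarith [le_abs_self u])
      nlinarith
    have h3 : 1 / (8 * q) ≤ r ^ 2 / Real.sqrt (r ^ 2 + u ^ 2) ^ 3 := by
      have hs0 : 0 < Real.sqrt (r ^ 2 + u ^ 2) := Real.sqrt_pos.2 (by positivity)
      calc 1 / (8 * q) ≤ 1 / (27 / 8 * r) :=
            one_div_le_one_div_of_le (by positivity) (by linarith)
        _ = r ^ 2 / (3 / 2 * r) ^ 3 := by field_simp; norm_num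
        _ ≤ _ := by gcongr
    have e : 1 / q = 8 * (1 / (8 * q)) := by field_simp
    rw [e]; linarith

lemma inv_le_scaleSum {η : ℝ} {J : ℕ} (hη : 0 < η) (hJ : 2 ^ J * η = 1) {u : ℝ} (hu : η ≤ u) :
    1 / u ≤ 2 * (1 + 8 * scaleSum η J u) := by
  have hu0 : 0 < u := hη.trans_le hu
  have h := inv_sqrt_le_scaleSum hη hJ u
  have h2 : Real.sqrt (η ^ 2 + u ^ 2) ≤ 2 * u :=
    Real.sqrt_le_iff.2 ⟨by positivity, by nlinarith⟩
  have h3 : 1 / (2 * u) ≤ 1 / Real.sqrt (η ^ 2 + u ^ 2) :=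
    one_div_le_one_div_of_le (Real.sqrt_pos.2 (by positivity)) h2
  have e : 1 / u = 2 * (1 / (2 * u)) := by field_simp
  rw [e]; linarith

/-! ### Averaging over the velocity angle -/

lemma sq_sub_le_abs_cos_sub {u w : ℝ} (hu : u ∈ Icc 0 π) (hw : w ∈ Icc 0 π) :
    2 * ((u - w) / π) ^ 2 ≤ |Real.cos u - Real.cos w| := by
  wlog h : u ≤ w generalizing u w
  · have := this hw hu (by linarith)
    rw [abs_sub_comm] at this
    convert this using 1; ring
  have h1 : (w - u) / π ≤ Real.sin ((w - u) / 2) := by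
    have := Real.mul_le_sin (x := (w - u) / 2) (by linarith) (by linarith [hw.2, hu.1])
    calc (w - u) / π = 2 / π * ((w - u) / 2) := by ring
      _ ≤ _ := this
  have h0 : 0 ≤ (w - u) / π := div_nonneg (by linarith) Real.pi_pos.le
  have h2 : (w - u) / π ≤ Real.sin ((w + u) / 2) := by
    refine h1.trans ?_
    have hp := Real.pi_pos
    rw [← Real.cos_pi_div_two_sub, ← Real.cos_pi_div_two_sub ((w + u) / 2),
      ← Real.cos_abs (π / 2 - (w + u) / 2)]
    apply Real.cos_le_cos_of_nonneg_of_le_pi (abs_nonneg _)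
    · linarith [hw.2, hu.1]
    · rw [abs_le]; constructor <;> linarith [hw.2, hu.1, hu.2, hw.1]
  have e : Real.cos u - Real.cos w = 2 * (Real.sin ((w + u) / 2) * Real.sin ((w - u) / 2)) := by
    rw [Real.cos_sub_cos, show (u - w) / 2 = -((w - u) / 2) by ring, Real.sin_neg, add_comm u w]
    ring
  rw [e]
  refine le_trans ?_ (le_abs_self _)
  have := mul_le_mul h2 h1 h0 (h0.trans h2)
  calc 2 * ((u - w) / π) ^ 2 = 2 * ((w - u) / π * ((w - u) / π)) := by ring
    _ ≤ _ := by linarith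

lemma volume_cos_le (α c k : ℝ) :
    volume {θ : ℝ | θ ∈ Ioc (-π) π ∧ |Real.cos (θ + α) - c| ≤ k} ≤
      ENNReal.ofReal (2 * π) * ENNReal.ofReal (2 * Real.sqrt k) := by
  have hp := Real.pi_pos
  set m : ℤ := ⌊(α - π) / π⌋ with hm
  set S : ℤ → Set ℝ := fun i => {θ : ℝ | θ + α - i * π ∈ Icc 0 π ∧ |Real.cos (θ + α) - c| ≤ k}
    with hS
  have hdiam : ∀ i, volume (S i) ≤ ENNReal.ofReal (π * Real.sqrt k) := by
    intro i
    refine (Real.volume_le_diam _).trans (Metric.ediam_le fun x hx y hy => ?_)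
    rw [edist_dist]
    apply ENNReal.ofReal_le_ofReal
    have h1 := sq_sub_le_abs_cos_sub hx.1 hy.1
    have hcos : ∀ w : ℝ, Real.cos (w - i * π) = (-1) ^ i * Real.cos w := fun w =>
      Real.cos_sub_int_mul_pi w i
    have h2 : |Real.cos (x + α - i * π) - Real.cos (y + α - i * π)| ≤ 2 * k := by
      rw [hcos, hcos, ← mul_sub, abs_mul, abs_zpow, abs_neg, abs_one, one_zpow, one_mul]
      have h3 := hx.2
      have h4 := hy.2
      rw [abs_le] at h3 h4 ⊢
      constructor <;> linarith [h3.1, h3.2, h4.1, h4.2]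
    have h5 : ((x - y) / π) ^ 2 ≤ k := by
      have e : x + α - i * π - (y + α - i * π) = x - y := by ring
      rw [e] at h1; linarith
    have h6 : |(x - y) / π| ≤ Real.sqrt k := Real.abs_le_sqrt h5
    rw [abs_div, abs_of_pos hp, div_le_iff₀ hp] at h6
    rw [Real.dist_eq]; linarith
  have hsub : {θ : ℝ | θ ∈ Ioc (-π) π ∧ |Real.cos (θ + α) - c| ≤ k} ⊆
      S m ∪ S (m + 1) ∪ S (m + 2) := by
    rintro θ ⟨⟨h1, h2⟩, h3⟩
    have f1 : (m : ℝ) * π ≤ α - π := by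
      have := Int.floor_le ((α - π) / π); rwa [le_div_iff₀ hp] at this
    have f2 : α - π < (m + 1) * π := by
      have := Int.lt_floor_add_one ((α - π) / π); rwa [div_lt_iff₀ hp] at this
    rcases le_or_gt (θ + α) ((m + 1) * π) with h4 | h4
    · refine Or.inl (Or.inl ⟨⟨by linarith, by linarith⟩, h3⟩)
    rcases le_or_gt (θ + α) ((m + 2) * π) with h5 | h5
    · refine Or.inl (Or.inr ⟨⟨?_, ?_⟩, h3⟩) <;> push_cast <;> linarith
    · refine Or.inr ⟨⟨?_, ?_⟩, h3⟩ <;> push_cast <;> linarith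
  refine (measure_mono hsub).trans ((measure_union_le _ _).trans
    ((add_le_add ((measure_union_le _ _).trans (add_le_add (hdiam _) (hdiam _))) (hdiam _)).trans ?_))
  rw [← ENNReal.ofReal_mul (by positivity), ← ENNReal.ofReal_add (by positivity) (by positivity),
    ← ENNReal.ofReal_add (by positivity) (by positivity)]
  apply ENNReal.ofReal_le_ofReal
  nlinarith [mul_nonneg hp.le (Real.sqrt_nonneg k)]

lemma lintegral_angle_le {G : E3 → ℝ≥0∞} (hG : Measurable G) (hGi : ∀ θ v, G (rotZ θ v) = G v)
    {c : E3 → ℝ} (hc : Measurable c) (hci : ∀ θ v, c (rotZ θ v) = c v) {y : E3}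
    (hy : 0 < slashN y) (k : ℝ) :
    ∫⁻ v, G v * {v : E3 | 0 < slashN v ∧ |y 0 * v 0 + y 1 * v 1 - c v| ≤
      k * (slashN y * slashN v)}.indicator 1 v ≤ ENNReal.ofReal (2 * Real.sqrt k) * ∫⁻ v, G v := by
  obtain ⟨S, hS⟩ : ∃ S : Set E3, S = {v : E3 | 0 < slashN v ∧ |y 0 * v 0 + y 1 * v 1 - c v| ≤
      k * (slashN y * slashN v)} := ⟨_, rfl⟩
  have hSm : MeasurableSet S := by
    rw [hS]
    refine (measurableSet_lt measurable_const continuous_slashN.measurable).inter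
      (measurableSet_le (Measurable.abs (Measurable.sub (by fun_prop) hc)) ?_)
    exact ((continuous_const.mul (continuous_const.mul continuous_slashN))).measurable
  rw [← hS]
  have h2π : ENNReal.ofReal (2 * π) ≠ 0 := by simp [Real.pi_pos]
  have hm : Measurable fun v => G v * S.indicator 1 v :=
    hG.mul (measurable_one.indicator hSm)
  rw [← ENNReal.mul_le_mul_iff_right h2π ENNReal.ofReal_ne_top,
    lintegral_average rotZ continuous_rotZ_uncurry.measurable measurePreserving_rotZ hm,
    ← mul_assoc, ← lintegral_const_mul' _ _ (by finiteness)]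
  refine lintegral_mono fun v => ?_
  have hmv : Measurable fun θ : ℝ => (S.indicator 1 (rotZ θ v) : ℝ≥0∞) :=
    (measurable_one.indicator hSm).comp (continuous_rotZ_uncurry.comp
      (by fun_prop : Continuous fun θ : ℝ => (θ, v))).measurable
  simp only [hGi]
  rw [lintegral_const_mul _ hmv, mul_comm]
  gcongr
  rcases (slashN_nonneg v).eq_or_lt with h0 | h0
  · have : ∀ θ, (S.indicator 1 (rotZ θ v) : ℝ≥0∞) = 0 := fun θ => by
      apply indicator_of_notMem
      rw [hS]; rintro ⟨h, _⟩
      rw [slashN_rotZ] at h; linarith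
    simp [this]
  · obtain ⟨a, ha0, ha1⟩ := exists_polar y
    obtain ⟨b, hb0, hb1⟩ := exists_polar v
    refine le_trans ?_ (volume_cos_le (b - a) (c v / (slashN y * slashN v)) k)
    have hT : MeasurableSet {θ : ℝ | rotZ θ v ∈ S} :=
      (continuous_rotZ_uncurry.comp (by fun_prop : Continuous fun θ : ℝ => (θ, v))).measurable hSm
    have e : ∀ θ, (S.indicator 1 (rotZ θ v) : ℝ≥0∞) = {θ : ℝ | rotZ θ v ∈ S}.indicator 1 θ :=
      fun θ => rfl
    simp only [e]
    rw [lintegral_indicator_one hT, Measure.restrict_apply hT]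
    refine measure_mono ?_
    rintro θ ⟨h1, h2⟩
    refine ⟨h2, ?_⟩
    rw [Set.mem_ofPred_eq, hS] at h1
    have h3 := h1.2
    rw [slashN_rotZ, hci, rotZ_zero_coord, rotZ_one_coord, ha0, ha1, hb0, hb1] at h3
    have hpos : 0 < slashN y * slashN v := mul_pos hy h0
    have e2 : Real.cos (θ + (b - a)) - c v / (slashN y * slashN v) =
        (slashN y * Real.cos a * (slashN v * Real.cos b * Real.cos θ -
          slashN v * Real.sin b * Real.sin θ) + slashN y * Real.sin a *
          (slashN v * Real.cos b * Real.sin θ + slashN v * Real.sin b * Real.cos θ) - c v) /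
          (slashN y * slashN v) := by
      rw [show θ + (b - a) = (θ + b) - a by ring, Real.cos_sub, Real.cos_add, Real.sin_add]
      field_simp
    rw [e2, abs_div, abs_of_pos hpos, div_le_iff₀ hpos]
    exact h3

/-! ### Velocity integrals -/

lemma lintegral_box {f : Fin 3 → ℝ → ℝ} (hf : ∀ i, Integrable (f i)) (hf0 : ∀ i x, 0 ≤ f i x) :
    ∫⁻ v : E3, ENNReal.ofReal (f 0 (v 0) * f 1 (v 1) * f 2 (v 2)) =
      ENNReal.ofReal ((∫ a, f 0 a) * (∫ a, f 1 a) * ∫ a, f 2 a) := by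
  have h := (PiLp.volume_preserving_toLp (Fin 3)).lintegral_comp_emb
    (MeasurableEquiv.toLp 2 (Fin 3 → ℝ)).measurableEmbedding
    (fun v : E3 => ENNReal.ofReal (f 0 (v 0) * f 1 (v 1) * f 2 (v 2)))
  rw [← h]
  have hi : Integrable fun w : Fin 3 → ℝ => ∏ i, f i (w i) := Integrable.fintype_prod hf
  have e := integral_fintype_prod_volume_eq_prod (ι := Fin 3) f
  rw [Fin.prod_univ_three] at e
  rw [← e, ofReal_integral_eq_lintegral_ofReal hi
    (Filter.Eventually.of_forall fun w => Finset.prod_nonneg fun i _ => hf0 i _)]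
  refine lintegral_congr fun w => ?_
  rw [Fin.prod_univ_three]

lemma volume_slab_le {w Q : ℝ} (hw : 0 ≤ w) (hQ : 0 ≤ Q) {A : Set E3} (hA : MeasurableSet A)
    (h : ∀ v ∈ A, slashN v ≤ w ∧ ‖v‖ ≤ Q) : volume A ≤ ENNReal.ofReal (8 * w ^ 2 * Q) := by
  set f : Fin 3 → ℝ → ℝ := ![(Icc (-w) w).indicator 1, (Icc (-w) w).indicator 1,
    (Icc (-Q) Q).indicator 1] with hf
  have hint : ∀ a : ℝ, Integrable ((Icc (-a) a).indicator (1 : ℝ → ℝ)) := fun a =>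
    (integrable_indicator_iff measurableSet_Icc).2 continuous_const.integrableOn_Icc
  have hval : ∀ a : ℝ, 0 ≤ a → ∫ x, (Icc (-a) a).indicator (1 : ℝ → ℝ) x = 2 * a := fun a ha => by
    rw [integral_indicator_one measurableSet_Icc, Real.volume_real_Icc_of_le (by linarith)]; ring
  have hi : ∀ i, Integrable (f i) := by
    intro i; fin_cases i <;> simp [hf, hint]
  have h0 : ∀ i x, 0 ≤ f i x := by
    intro i x; fin_cases i <;> exact indicator_nonneg (fun _ _ => zero_le_one) _
  have e := lintegral_box hi h0
  simp only [hf, Matrix.cons_val_zero, Matrix.cons_val_one, Matrix.cons_val] at e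
  rw [hval w hw, hval Q hQ] at e
  rw [← lintegral_indicator_one hA, show 8 * w ^ 2 * Q = 2 * w * (2 * w) * (2 * Q) by ring, ← e]
  refine lintegral_mono fun v => ?_
  by_cases hv : v ∈ A
  · obtain ⟨h1, h2⟩ := h v hv
    have hs := slashN_sq v
    have hs0 := slashN_nonneg v
    have m0 : v 0 ∈ Icc (-w) w := abs_le.1 (abs_le_of_sq_le_sq (by nlinarith [sq_nonneg (v 1)]) hw)
    have m1 : v 1 ∈ Icc (-w) w := abs_le.1 (abs_le_of_sq_le_sq (by nlinarith [sq_nonneg (v 0)]) hw)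
    have m2 : v 2 ∈ Icc (-Q) Q := abs_le.1 ((abs_coord_le_norm v 2).trans h2)
    simp [hv, m0, m1, m2]
  · simp [hv]

/-- The Japanese bracket `√(1+|v|²)`. -/
def jap (v : E3) : ℝ := Real.sqrt (1 + ‖v‖ ^ 2)

lemma one_le_jap (v : E3) : 1 ≤ jap v := Real.one_le_sqrt.2 (by nlinarith [sq_nonneg ‖v‖])

lemma jap_pos (v : E3) : 0 < jap v := one_pos.trans_le (one_le_jap v)

lemma norm_le_jap (v : E3) : ‖v‖ ≤ jap v := Real.le_sqrt_of_sq_le (by linarith)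

lemma jap_le (v : E3) : jap v ≤ 1 + ‖v‖ :=
  Real.sqrt_le_iff.2 ⟨by positivity, by nlinarith [norm_nonneg v]⟩

lemma slashN_le_jap (v : E3) : slashN v ≤ jap v := (slashN_le_norm v).trans (norm_le_jap v)

lemma continuous_jap : Continuous jap := by unfold jap; fun_prop

lemma jap_rotZ (θ : ℝ) (v : E3) : jap (rotZ θ v) = jap v := by rw [jap, norm_rotZ, jap]

lemma integral_inv_one_add_abs {l : ℝ} (hl : 0 ≤ l) :
    ∫ x in (-l)..l, (1 + |x|)⁻¹ = 2 * Real.log (1 + l) := by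
  have hc : Continuous fun x : ℝ => (1 + |x|)⁻¹ :=
    Continuous.inv₀ (by fun_prop) fun x => by positivity
  have h1 : ∫ x in (0 : ℝ)..l, (1 + |x|)⁻¹ = Real.log (1 + l) := by
    have : ∫ x in (0 : ℝ)..l, (1 + |x|)⁻¹ = ∫ x in (0 : ℝ)..l, (1 + x)⁻¹ := by
      refine intervalIntegral.integral_congr fun x hx => ?_
      rw [uIcc_of_le hl] at hx
      simp only [abs_of_nonneg hx.1]
    rw [this, intervalIntegral.integral_comp_add_left (fun x => x⁻¹),
      integral_inv_of_pos (by norm_num) (by linarith)]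
    simp
  have h2 : ∫ x in (-l)..0, (1 + |x|)⁻¹ = Real.log (1 + l) := by
    have := intervalIntegral.integral_comp_neg (a := 0) (b := l) (fun x : ℝ => (1 + |x|)⁻¹)
    simp only [abs_neg, neg_zero] at this
    rw [← h1, this]
  rw [← intervalIntegral.integral_add_adjacent_intervals (hc.intervalIntegrable _ 0)
    (hc.intervalIntegrable 0 _), h1, h2]
  ring

lemma lintegral_jap_div_sq_le {l : ℝ} (hl : 0 ≤ l) {A : Set E3} (hA : MeasurableSet A)
    (h : ∀ v ∈ A, 1 ≤ slashN v ∧ ‖v‖ ≤ l) :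
    ∫⁻ v in A, ENNReal.ofReal (jap v / slashN v ^ 2) ≤
      ENNReal.ofReal (32 * (1 + l) ^ 2 * Real.log (1 + l) ^ 2) := by
  set f : Fin 3 → ℝ → ℝ := ![(Icc (-l) l).indicator (fun x => (1 + |x|)⁻¹),
    (Icc (-l) l).indicator (fun x => (1 + |x|)⁻¹),
    (Icc (-l) l).indicator (fun _ => 4 * (1 + l))] with hf
  have hc : Continuous fun x : ℝ => (1 + |x|)⁻¹ :=
    Continuous.inv₀ (by fun_prop) fun x => by positivity
  have i1 : Integrable ((Icc (-l) l).indicator fun x : ℝ => (1 + |x|)⁻¹) :=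
    (integrable_indicator_iff measurableSet_Icc).2 hc.integrableOn_Icc
  have i2 : Integrable ((Icc (-l) l).indicator fun _ : ℝ => 4 * (1 + l)) :=
    (integrable_indicator_iff measurableSet_Icc).2 continuous_const.integrableOn_Icc
  have v1 : ∫ x, (Icc (-l) l).indicator (fun x : ℝ => (1 + |x|)⁻¹) x = 2 * Real.log (1 + l) := by
    rw [integral_indicator measurableSet_Icc, integral_Icc_eq_integral_Ioc,
      ← intervalIntegral.integral_of_le (by linarith), integral_inv_one_add_abs hl]
  have v2 : ∫ x, (Icc (-l) l).indicator (fun _ : ℝ => 4 * (1 + l)) x = 8 * l * (1 + l) := by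
    rw [integral_indicator measurableSet_Icc, setIntegral_const,
      Real.volume_real_Icc_of_le (by linarith), smul_eq_mul]; ring
  have hi : ∀ i, Integrable (f i) := by
    intro i; fin_cases i <;> simp only [hf] <;> first | exact i1 | exact i2
  have h0 : ∀ i x, 0 ≤ f i x := by
    intro i x
    have p1 : 0 ≤ (Icc (-l) l).indicator (fun x : ℝ => (1 + |x|)⁻¹) x :=
      indicator_nonneg (fun _ _ => by positivity) _
    have p2 : 0 ≤ (Icc (-l) l).indicator (fun _ : ℝ => 4 * (1 + l)) x :=
      indicator_nonneg (fun _ _ => by positivity) _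
    fin_cases i <;> first | exact p1 | exact p2
  have e := lintegral_box hi h0
  simp only [hf, Matrix.cons_val_zero, Matrix.cons_val_one, Matrix.cons_val] at e
  rw [v1, v2] at e
  have hlog : 0 ≤ Real.log (1 + l) := Real.log_nonneg (by linarith)
  calc ∫⁻ v in A, ENNReal.ofReal (jap v / slashN v ^ 2)
      ≤ ENNReal.ofReal (2 * Real.log (1 + l) * (2 * Real.log (1 + l)) * (8 * l * (1 + l))) := by
        rw [← e, ← lintegral_indicator hA]
        refine lintegral_mono fun v => ?_
        by_cases hv : v ∈ A
        · obtain ⟨h1, h2⟩ := h v hv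
          have hs := slashN_sq v
          have mem : ∀ i, v i ∈ Icc (-l) l := fun i => abs_le.1 ((abs_coord_le_norm v i).trans h2)
          simp only [indicator_of_mem hv, indicator_of_mem (mem _)]
          apply ENNReal.ofReal_le_ofReal
          have a0 := abs_nonneg (v 0)
          have a1 := abs_nonneg (v 1)
          have key : (1 + |v 0|) * (1 + |v 1|) ≤ 4 * slashN v ^ 2 := by
            have : 1 ≤ slashN v ^ 2 := by nlinarith
            have e0 := sq_abs (v 0)
            have e1 := sq_abs (v 1)
            nlinarith [sq_nonneg (|v 0| - |v 1|), sq_nonneg (|v 0| - 1), sq_nonneg (|v 1| - 1)]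
          rw [← mul_inv, div_le_iff₀ (by positivity), inv_mul_eq_div, div_mul_eq_mul_div,
            le_div_iff₀ (by positivity)]
          calc jap v * ((1 + |v 0|) * (1 + |v 1|)) ≤ (1 + l) * (4 * slashN v ^ 2) :=
                mul_le_mul (by linarith [jap_le v]) key (by positivity) (by linarith)
            _ = _ := by ring
        · simp [hv]
    _ ≤ _ := by
        apply ENNReal.ofReal_le_ofReal
        nlinarith [mul_nonneg (sq_nonneg (Real.log (1 + l))) (by linarith : (0:ℝ) ≤ 1 + l)]

/-! ### Static field bounds -/

/-- The angular momentum about the symmetry axis. -/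
def angL (p : E3 × E3) : ℝ := p.1 0 * p.2 1 - p.1 1 * p.2 0

lemma continuous_angL : Continuous angL := by unfold angL; fun_prop

lemma abs_angL_le (p : E3 × E3) : |angL p| ≤ slashN p.1 * slashN p.2 := by
  have h1 := slashN_sq p.1
  have h2 := slashN_sq p.2
  refine abs_le_of_sq_le_sq ?_ (mul_nonneg (slashN_nonneg _) (slashN_nonneg _))
  rw [mul_pow, h1, h2, angL]
  nlinarith [sq_nonneg (p.1 0 * p.2 0 + p.1 1 * p.2 1)]

lemma angL_rotP (θ : ℝ) (p : E3 × E3) : angL (rotP θ p) = angL p := by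
  simp only [angL, rotP, rotZ_zero_coord, rotZ_one_coord]
  linear_combination (p.1 0 * p.2 1 - p.1 1 * p.2 0) * Real.sin_sq_add_cos_sq θ

/-- An axially symmetric phase-space density with bounded amplitude and energy. -/
structure StaticData (g : E3 × E3 → ℝ≥0∞) (D : ℝ) : Prop where
  meas : Measurable g
  le : ∀ p, g p ≤ ENNReal.ofReal D
  inv : ∀ θ p, g (rotP θ p) = g p
  energy : ∫⁻ p, g p * ENNReal.ofReal (1 + ‖p.2‖) ≤ ENNReal.ofReal D

/-- The integrand of the cylindrical Morawetz estimate. -/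
def morI (g : E3 × E3 → ℝ≥0∞) (η : ℝ) (J : ℕ) : ℝ≥0∞ :=
  ∫⁻ p, g p * ENNReal.ofReal (slashN p.2 ^ 2 / jap p.2 * scaleSum η J (slashN p.1))

lemma StaticData.mass_le {g : E3 × E3 → ℝ≥0∞} {D : ℝ} (S : StaticData g D) (B : Set (E3 × E3)) :
    ∫⁻ p in B, g p ≤ ENNReal.ofReal D := by
  refine ((setLIntegral_le_lintegral _ _).trans (lintegral_mono fun p => ?_)).trans S.energy
  calc g p = g p * 1 := (mul_one _).symm
    _ ≤ _ := by
      gcongr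
      rw [← ENNReal.ofReal_one]
      exact ENNReal.ofReal_le_ofReal (by linarith [norm_nonneg p.2])

lemma near_of_subset {B : Set (E3 × E3)} {A : Set E3} (h : ∀ p ∈ B, p.2 ∈ A) (δ : E3 → ℝ)
    (x y : E3) :
    ∫⁻ v, B.indicator 1 (y, v) * {v | ‖x - y‖ ≤ δ v}.indicator 1 v ≤
      (1 : ℝ≥0∞) * ∫⁻ v, A.indicator 1 v * {v | ‖x - y‖ ≤ δ v}.indicator 1 v := by
  rw [one_mul]
  refine lintegral_mono fun v => ?_
  gcongr
  by_cases hv : (y, v) ∈ B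
  · simp [hv, h _ hv]
  · simp [hv]

lemma field_const_le {g : E3 × E3 → ℝ≥0∞} {D : ℝ} (S : StaticData g D) {B : Set (E3 × E3)}
    (hB : MeasurableSet B) {A : Set E3} (hA : MeasurableSet A) (hBA : ∀ p ∈ B, p.2 ∈ A)
    {δ : ℝ} (hδ : 0 < δ) (x : E3) :
    ∫⁻ p in B, g p * invSq (x - p.1) ≤
      ENNReal.ofReal D * ENNReal.ofReal (4 * π) * (ENNReal.ofReal δ * volume A) +
        ENNReal.ofReal (2 / δ ^ 2) * ∫⁻ p in B, g p := by
  refine (near_far S.le hB hA (δ := fun _ => δ) measurable_const (fun _ => hδ) 1 x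
    (near_of_subset hBA _ x)).trans ?_
  rw [mul_one, setLIntegral_const]
  gcongr
  rw [← lintegral_const_mul _ S.meas]
  refine lintegral_mono fun p => ?_
  rw [mul_comm]
  gcongr
  exact softK_le hδ _

lemma rotP_indicator {g : E3 × E3 → ℝ≥0∞} {B : Set (E3 × E3)} (hg : ∀ θ p, g (rotP θ p) = g p)
    (hBi : ∀ θ p, rotP θ p ∈ B ↔ p ∈ B) (θ : ℝ) (p : E3 × E3) :
    B.indicator g (rotP θ p) = B.indicator g p := by
  by_cases h : p ∈ B
  · rw [indicator_of_mem h, indicator_of_mem ((hBi θ p).2 h), hg]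
  · rw [indicator_of_notMem h, indicator_of_notMem (mt (hBi θ p).1 h)]

/-- Far field of an axially symmetric density, averaged over rings. -/
lemma far_ring_le {g : E3 × E3 → ℝ≥0∞} {D : ℝ} (S : StaticData g D) {B : Set (E3 × E3)}
    (hB : MeasurableSet B) (hBi : ∀ θ p, rotP θ p ∈ B ↔ p ∈ B)
    (hBs : ∀ p ∈ B, 0 < slashN p.1) {δ : E3 → ℝ} (hδ : Measurable δ) (hδ0 : ∀ v, 0 < δ v)
    (hδi : ∀ θ v, δ (rotZ θ v) = δ v) (x : E3) {K : E3 × E3 → ℝ≥0∞}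
    (hK : ∀ p ∈ B, ENNReal.ofReal (4 / (Real.sqrt (δ p.2 ^ 2 + (slashN x - slashN p.1) ^ 2) *
      slashN p.1)) ≤ K p) :
    ∫⁻ p in B, g p * softK (δ p.2) (x - p.1) ≤ ∫⁻ p, g p * K p := by
  have h := lintegral_softK_le_ring (h := B.indicator g) (S.meas.indicator hB)
    (rotP_indicator S.inv hBi) hδ hδ0 hδi (fun p hp => hBs p (mem_of_indicator_ne_zero hp)) x
  rw [← lintegral_indicator hB]
  refine le_trans (le_of_eq (lintegral_congr fun p => ?_)) (h.trans (lintegral_mono fun p => ?_))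
  · by_cases hp : p ∈ B <;> simp [hp]
  · by_cases hp : p ∈ B
    · rw [indicator_of_mem hp]; gcongr; exact hK p hp
    · simp [hp]

lemma field_ring_le {g : E3 × E3 → ℝ≥0∞} {D η : ℝ} {J : ℕ} (S : StaticData g D) (hD : 0 ≤ D)
    (hη : 0 < η) (hJ : 2 ^ J * η = 1) {B : Set (E3 × E3)}
    (hB : MeasurableSet B) (hBi : ∀ θ p, rotP θ p ∈ B ↔ p ∈ B)
    (hBv : ∀ p ∈ B, 1 ≤ slashN p.2 ∧ η ≤ slashN p.1) {A : Set E3} (hA : MeasurableSet A)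
    (hAv : ∀ v ∈ A, 1 ≤ slashN v) {b : ℝ≥0∞} {β : ℝ} (hβ : 0 < β) (x : E3)
    (hnear : ∀ δ : E3 → ℝ, Measurable δ → (∀ θ v, δ (rotZ θ v) = δ v) → ∀ y,
      ∫⁻ v, B.indicator 1 (y, v) * {v | ‖x - y‖ ≤ δ v}.indicator 1 v ≤
        b * ∫⁻ v, A.indicator 1 v * {v | ‖x - y‖ ≤ δ v}.indicator 1 v)
    (hb : b * ∫⁻ v in A, ENNReal.ofReal (jap v / slashN v ^ 2) ≤ ENNReal.ofReal (β ^ 2)) :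
    ∫⁻ p in B, g p * invSq (x - p.1) ≤
      ENNReal.ofReal (β * (24 * D)) + ENNReal.ofReal (64 * β) * morI g η J := by
  obtain ⟨δ, hδd⟩ : ∃ δ : E3 → ℝ, δ = fun v => β⁻¹ * (jap v / max 1 (slashN v) ^ 2) := ⟨_, rfl⟩
  have hmax : ∀ v, 0 < max 1 (slashN v) := fun v => one_pos.trans_le (le_max_left _ _)
  have hδ0 : ∀ v, 0 < δ v := fun v => by
    have := jap_pos v; have := hmax v; rw [hδd]; positivity
  have hδm : Measurable δ := by
    rw [hδd]
    refine (continuous_const.mul (continuous_jap.div ?_ fun v => ?_)).measurable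
    · exact (continuous_const.max continuous_slashN).pow 2
    · have := hmax v; positivity
  have hδi : ∀ θ v, δ (rotZ θ v) = δ v := fun θ v => by
    rw [hδd]; simp only [jap_rotZ, slashN_rotZ]
  have hδ1 : ∀ v, 1 ≤ slashN v → δ v = β⁻¹ * (jap v / slashN v ^ 2) := fun v hv => by
    rw [hδd]; simp only [max_eq_right hv]
  refine (near_far S.le hB hA hδm hδ0 b x (hnear δ hδm hδi)).trans ?_
  have hnr : ENNReal.ofReal D * b * ENNReal.ofReal (4 * π) * ∫⁻ v in A, ENNReal.ofReal (δ v) ≤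
      ENNReal.ofReal (β * (16 * D)) := by
    have e : ∫⁻ v in A, ENNReal.ofReal (δ v) =
        ENNReal.ofReal β⁻¹ * ∫⁻ v in A, ENNReal.ofReal (jap v / slashN v ^ 2) := by
      rw [← lintegral_const_mul' _ _ ENNReal.ofReal_ne_top]
      refine setLIntegral_congr_fun hA fun v hv => ?_
      simp only [hδ1 v (hAv v hv), ENNReal.ofReal_mul (inv_pos.2 hβ).le]
    rw [e]
    calc ENNReal.ofReal D * b * ENNReal.ofReal (4 * π) * (ENNReal.ofReal β⁻¹ *
          ∫⁻ v in A, ENNReal.ofReal (jap v / slashN v ^ 2))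
        = ENNReal.ofReal D * ENNReal.ofReal (4 * π) * ENNReal.ofReal β⁻¹ *
          (b * ∫⁻ v in A, ENNReal.ofReal (jap v / slashN v ^ 2)) := by ring
      _ ≤ ENNReal.ofReal D * ENNReal.ofReal (4 * π) * ENNReal.ofReal β⁻¹ *
          ENNReal.ofReal (β ^ 2) := by gcongr
      _ = ENNReal.ofReal (D * (4 * π) * β⁻¹ * β ^ 2) := by
          rw [← ENNReal.ofReal_mul hD, ← ENNReal.ofReal_mul (by positivity),
            ← ENNReal.ofReal_mul (by positivity)]
      _ ≤ _ := by
          apply ENNReal.ofReal_le_ofReal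
          have : D * (4 * π) * β⁻¹ * β ^ 2 = D * β * (4 * π) := by field_simp
          rw [this]
          nlinarith [mul_nonneg hD hβ.le, Real.pi_le_four]
  have hfar : ∫⁻ p in B, g p * softK (δ p.2) (x - p.1) ≤
      ENNReal.ofReal (β * (8 * D)) + ENNReal.ofReal (64 * β) * morI g η J := by
    refine (far_ring_le S hB hBi (fun p hp => hη.trans_le (hBv p hp).2) hδm hδ0 hδi x
      (K := fun p => ENNReal.ofReal (8 * β) * ENNReal.ofReal (1 + ‖p.2‖) +
        ENNReal.ofReal (64 * β) * ENNReal.ofReal (slashN p.2 ^ 2 / jap p.2 *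
          scaleSum η J (slashN p.1))) fun p hp => ?_).trans ?_
    · obtain ⟨h1, h2⟩ := hBv p hp
      have hsc := scaleSum_nonneg η J (slashN p.1)
      have hj := jap_pos p.2
      have hs0 : 0 < slashN p.1 := hη.trans_le h2
      have hv0 : 0 < slashN p.2 := by linarith
      rw [← ENNReal.ofReal_mul (by positivity), ← ENNReal.ofReal_mul (by positivity),
        ← ENNReal.ofReal_add (by positivity) (by positivity)]
      apply ENNReal.ofReal_le_ofReal
      have hd := hδ0 p.2
      have hle : δ p.2 ≤ Real.sqrt (δ p.2 ^ 2 + (slashN x - slashN p.1) ^ 2) :=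
        Real.le_sqrt_of_sq_le (by nlinarith [sq_nonneg (slashN x - slashN p.1)])
      have hw : slashN p.2 ^ 2 / jap p.2 ≤ 1 + ‖p.2‖ := by
        rw [div_le_iff₀ hj]
        have := slashN_le_norm p.2
        have := norm_le_jap p.2
        nlinarith [slashN_nonneg p.2, norm_nonneg p.2]
      calc 4 / (Real.sqrt (δ p.2 ^ 2 + (slashN x - slashN p.1) ^ 2) * slashN p.1)
          ≤ 4 / (δ p.2 * slashN p.1) := by gcongr
        _ = 4 * β * (slashN p.2 ^ 2 / jap p.2) * (1 / slashN p.1) := by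
            rw [hδ1 _ h1]; field_simp
        _ ≤ 4 * β * (slashN p.2 ^ 2 / jap p.2) * (2 * (1 + 8 * scaleSum η J (slashN p.1))) := by
            gcongr; exact inv_le_scaleSum hη hJ h2
        _ = 8 * β * (slashN p.2 ^ 2 / jap p.2) +
            64 * β * (slashN p.2 ^ 2 / jap p.2 * scaleSum η J (slashN p.1)) := by ring
        _ ≤ _ := by gcongr
    · simp only [mul_add]
      have m1 : Measurable fun p : E3 × E3 => g p * (ENNReal.ofReal (8 * β) *
          ENNReal.ofReal (1 + ‖p.2‖)) := S.meas.mul (by fun_prop)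
      rw [lintegral_add_left m1]
      refine add_le_add ?_ ?_
      · simp only [mul_left_comm (g _)]
        rw [lintegral_const_mul' _ _ ENNReal.ofReal_ne_top]
        refine (mul_le_mul' le_rfl S.energy).trans (le_of_eq ?_)
        rw [← ENNReal.ofReal_mul (by positivity)]; congr 1; ring
      · simp only [mul_left_comm (g _)]
        rw [lintegral_const_mul' _ _ ENNReal.ofReal_ne_top, morI]
  refine (add_le_add hnr hfar).trans (le_of_eq ?_)
  rw [← add_assoc, ← ENNReal.ofReal_add (by positivity) (by positivity)]
  congr 2; ring

/-- The standing assumptions for the quantitative field bounds, in terms of the large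
parameter `z`. -/
structure FieldData (g : E3 × E3 → ℝ≥0∞) (z η : ℝ) (J n : ℕ) : Prop extends StaticData g z where
  hz : 10 ^ 6 ≤ z
  hη : 0 < η
  hJ : 2 ^ J * η = 1
  hηz : η ≤ (z ^ 20000)⁻¹
  hn : 20000 ≤ n
  decay : ∫⁻ v : E3, ENNReal.ofReal ((1 + ‖v‖) ^ 4)⁻¹ ≤ ENNReal.ofReal z
  log_le : Real.log (1 + z ^ 6003) ≤ z
  lowL : ∫⁻ p in {p | |angL p| < (z ^ 1560)⁻¹}, g p ≤ ENNReal.ofReal (4 * z * (z ^ 18720)⁻¹)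
  moment : ∫⁻ p, g p * ENNReal.ofReal ((1 + ‖p.2‖) ^ n) ≤ ENNReal.ofReal ((z ^ 6000) ^ (n - 1))

namespace FieldData

variable {g : E3 × E3 → ℝ≥0∞} {z η : ℝ} {J n : ℕ}

lemma field_high_le (S : FieldData g z η J n) (x : E3) :
    ∫⁻ p in {p : E3 × E3 | z ^ 6003 < ‖p.2‖}, g p * invSq (x - p.1) ≤
      ENNReal.ofReal (z ^ 4) := by
  have hz := S.hz
  have hz1 : (1 : ℝ) ≤ z := by linarith
  have hB : MeasurableSet {p : E3 × E3 | z ^ 6003 < ‖p.2‖} :=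
    measurableSet_lt measurable_const (by fun_prop)
  obtain ⟨δ, hδ⟩ : ∃ δ : E3 → ℝ, δ = fun v => ((1 + ‖v‖) ^ 4)⁻¹ := ⟨_, rfl⟩
  have hδ0 : ∀ v, 0 < δ v := fun v => by rw [hδ]; positivity
  have hδm : Measurable δ := by rw [hδ]; fun_prop
  refine (near_far S.le hB MeasurableSet.univ hδm hδ0 1 x
    (near_of_subset (fun _ _ => mem_univ _) _ x)).trans ?_
  have h1 : ENNReal.ofReal z * 1 * ENNReal.ofReal (4 * π) *
      ∫⁻ v in univ, ENNReal.ofReal (δ v) ≤ ENNReal.ofReal (z * (4 * π) * z) := by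
    rw [mul_one, ← ENNReal.ofReal_mul (by positivity),
      ENNReal.ofReal_mul (p := z * (4 * π)) (by positivity), Measure.restrict_univ, hδ]
    gcongr
    exact S.decay
  have hfar : ∫⁻ p in {p : E3 × E3 | z ^ 6003 < ‖p.2‖}, g p * softK (δ p.2) (x - p.1) ≤
      ENNReal.ofReal 2 := by
    set c : ℝ := 2 / (z ^ 6003) ^ (n - 8) with hc
    have hp : ∀ p ∈ {p : E3 × E3 | z ^ 6003 < ‖p.2‖}, g p * softK (δ p.2) (x - p.1) ≤
        ENNReal.ofReal c * (g p * ENNReal.ofReal ((1 + ‖p.2‖) ^ n)) := by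
      intro p hp
      rw [mul_left_comm]
      gcongr
      refine (softK_le (hδ0 _) _).trans ?_
      rw [← ENNReal.ofReal_mul (by positivity)]
      apply ENNReal.ofReal_le_ofReal
      have hv : z ^ 6003 ≤ 1 + ‖p.2‖ := by
        have : z ^ 6003 < ‖p.2‖ := hp
        linarith
      have e1 : 2 / δ p.2 ^ 2 = 2 * (1 + ‖p.2‖) ^ 8 := by
        rw [hδ]; field_simp
      have e2 : (1 + ‖p.2‖) ^ n = (1 + ‖p.2‖) ^ 8 * (1 + ‖p.2‖) ^ (n - 8) := by
        rw [← pow_add]; congr 1; have := S.hn; omega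
      rw [e1, e2, hc, div_mul_eq_mul_div, le_div_iff₀ (by positivity)]
      have : (z ^ 6003) ^ (n - 8) ≤ (1 + ‖p.2‖) ^ (n - 8) := by gcongr
      nlinarith [pow_pos (by positivity : 0 < 1 + ‖p.2‖) 8]
    refine (setLIntegral_mono' hB hp).trans ((setLIntegral_le_lintegral _ _).trans ?_)
    rw [lintegral_const_mul' _ _ ENNReal.ofReal_ne_top]
    refine (mul_le_mul' le_rfl S.moment).trans ?_
    rw [← ENNReal.ofReal_mul (by positivity)]
    apply ENNReal.ofReal_le_ofReal
    rw [hc, div_mul_eq_mul_div, div_le_iff₀ (by positivity), ← pow_mul, ← pow_mul]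
    have : z ^ (6000 * (n - 1)) ≤ z ^ (6003 * (n - 8)) :=
      pow_le_pow_right₀ hz1 (by have := S.hn; omega)
    linarith
  refine (add_le_add h1 hfar).trans ?_
  rw [← ENNReal.ofReal_add (by positivity) (by norm_num)]
  apply ENNReal.ofReal_le_ofReal
  have : z * (4 * π) * z ≤ z ^ 2 * 16 := by nlinarith [Real.pi_le_four, sq_nonneg z]
  have h4 : z ^ 4 = z ^ 2 * z ^ 2 := by ring
  rw [h4]
  have : 100 ≤ z ^ 2 := by nlinarith
  nlinarith

/-- Numerical form of the splitting at a constant radius. -/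
lemma field_const_num_le (S : FieldData g z η J n) {B : Set (E3 × E3)}
    (hB : MeasurableSet B) {w Q δ m a : ℝ} (hw : 0 ≤ w) (hQ : 0 ≤ Q) (hm : 0 ≤ m)
    (hBA : ∀ p ∈ B, slashN p.2 ≤ w ∧ ‖p.2‖ ≤ Q)
    (hδ : 0 < δ) (hmass : ∫⁻ p in B, g p ≤ ENNReal.ofReal m)
    (ha : 128 * (z * w ^ 2 * Q * δ) + 2 / δ ^ 2 * m ≤ a) (x : E3) :
    ∫⁻ p in B, g p * invSq (x - p.1) ≤ ENNReal.ofReal a := by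
  have hz0 : 0 ≤ z := by linarith [S.hz]
  have hA : MeasurableSet {v : E3 | slashN v ≤ w ∧ ‖v‖ ≤ Q} :=
    (measurableSet_le continuous_slashN.measurable measurable_const).inter
      (measurableSet_le measurable_norm measurable_const)
  refine (field_const_le S.toStaticData hB hA hBA hδ x).trans ?_
  refine (add_le_add (mul_le_mul' le_rfl (mul_le_mul' le_rfl (volume_slab_le hw hQ hA
    fun v hv => hv))) (mul_le_mul' le_rfl hmass)).trans ?_
  rw [← ENNReal.ofReal_mul hz0, ← ENNReal.ofReal_mul hδ.le, ← ENNReal.ofReal_mul (by positivity),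
    ← ENNReal.ofReal_mul (by positivity), ← ENNReal.ofReal_add (by positivity) (by positivity)]
  apply ENNReal.ofReal_le_ofReal
  have : z * (4 * π) * (δ * (8 * w ^ 2 * Q)) ≤ 128 * (z * w ^ 2 * Q * δ) := by
    have h0 : 0 ≤ z * w ^ 2 * Q * δ := by positivity
    nlinarith [Real.pi_le_four]
  linarith

lemma field_lowL_le (S : FieldData g z η J n) (x : E3) :
    ∫⁻ p in {p : E3 × E3 | ‖p.2‖ ≤ z ^ 6003 ∧ |angL p| < (z ^ 1560)⁻¹},
      g p * invSq (x - p.1) ≤ ENNReal.ofReal (z ^ 5780) := by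
  have hz := S.hz
  have hz0 : 0 < z := by linarith
  refine S.field_const_num_le (w := z ^ 6003) (Q := z ^ 6003) (δ := (z ^ 12240)⁻¹)
    (m := 4 * z * (z ^ 18720)⁻¹) ?_ (by positivity) (by positivity) (by positivity)
    (fun p hp => ⟨(slashN_le_norm _).trans hp.1, hp.1⟩) (by positivity)
    ((lintegral_mono_set fun p hp => hp.2).trans S.lowL) ?_ x
  · exact (measurableSet_le measurable_snd.norm measurable_const).inter
      (measurableSet_lt continuous_angL.abs.measurable measurable_const)
  · have e1 : z * (z ^ 6003) ^ 2 * z ^ 6003 * (z ^ 12240)⁻¹ = z ^ 5770 := by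
      field_simp
    have e2 : 2 / ((z ^ 12240)⁻¹) ^ 2 * (4 * z * (z ^ 18720)⁻¹) = 8 * z ^ 5761 := by
      field_simp; norm_num
    rw [e1, e2]
    have h1 : z ^ 5780 = z ^ 10 * z ^ 5770 := by rw [← pow_add]
    have h2 : z ^ 5761 ≤ z ^ 5770 := pow_le_pow_right₀ (by linarith) (by norm_num)
    have h3 : z ≤ z ^ 10 := le_self_pow₀ (by linarith) (by norm_num)
    rw [h1]
    nlinarith [pow_pos hz0 5770]

lemma field_axial_le (S : FieldData g z η J n) (x : E3) :
    ∫⁻ p in {p : E3 × E3 | ‖p.2‖ ≤ z ^ 6003 ∧ slashN p.2 < 1},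
      g p * invSq (x - p.1) ≤ ENNReal.ofReal (z ^ 5780) := by
  have hz := S.hz
  have hz0 : 0 < z := by linarith
  refine S.field_const_num_le (w := 1) (Q := z ^ 6003) (δ := (z ^ 2001)⁻¹)
    (m := z) ?_ (by positivity) (by positivity) (by positivity)
    (fun p hp => ⟨hp.2.le, hp.1⟩) (by positivity) (S.toStaticData.mass_le _) ?_ x
  · exact (measurableSet_le measurable_snd.norm measurable_const).inter
      (measurableSet_lt (continuous_slashN.comp continuous_snd).measurable measurable_const)
  · have e1 : z * 1 ^ 2 * z ^ 6003 * (z ^ 2001)⁻¹ = z ^ 4003 := by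
      field_simp
    have e2 : 2 / ((z ^ 2001)⁻¹) ^ 2 * z = 2 * z ^ 4003 := by
      field_simp
    rw [e1, e2]
    have h1 : z ^ 5780 = z ^ 1777 * z ^ 4003 := by rw [← pow_add]
    have h3 : z ≤ z ^ 1777 := le_self_pow₀ (by linarith) (by norm_num)
    rw [h1]
    nlinarith [pow_pos hz0 4003]

end FieldData

/-- The regularised cylindrical radius. -/
def radR (η : ℝ) (x : E3) : ℝ := Real.sqrt (η ^ 2 + slashN x ^ 2)

/-- The regularised radial velocity. -/
def radV (η : ℝ) (p : E3 × E3) : ℝ :=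
  (p.1 0 * p.2 0 + p.1 1 * p.2 1) / (jap p.2 * radR η p.1)

/-- The velocity weight used in the radial virial identity. -/
def omg (q : ℝ) (v : E3) : ℝ := jap v ^ 2 / (q + jap v)

/-- The integrand of the radial virial estimate. -/
def rvI (g : E3 × E3 → ℝ≥0∞) (η : ℝ) (J : ℕ) (q N R : ℝ) : ℝ≥0∞ :=
  ∫⁻ p, g p * ENNReal.ofReal (omg q p.2 * (radV η p - N) ^ 2 * scaleSum η J (radR η p.1 - R))

lemma radR_pos {η : ℝ} (hη : 0 < η) (x : E3) : 0 < radR η x := Real.sqrt_pos.2 (by positivity)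

lemma radR_sq (η : ℝ) (x : E3) : radR η x ^ 2 = η ^ 2 + slashN x ^ 2 :=
  Real.sq_sqrt (by positivity)

lemma continuous_radR (η : ℝ) : Continuous (radR η) := by
  unfold radR
  have := continuous_slashN
  fun_prop

lemma radR_rotZ (η θ : ℝ) (x : E3) : radR η (rotZ θ x) = radR η x := by
  rw [radR, slashN_rotZ, radR]

lemma continuous_radV {η : ℝ} (hη : 0 < η) : Continuous (radV η) := by
  unfold radV
  refine Continuous.div (by fun_prop) ((continuous_jap.comp continuous_snd).mul
    ((continuous_radR η).comp continuous_fst)) fun p => ?_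
  exact (mul_pos (jap_pos _) (radR_pos hη _)).ne'

lemma radV_rotP (η θ : ℝ) (p : E3 × E3) : radV η (rotP θ p) = radV η p := by
  simp only [radV, rotP, jap_rotZ, radR_rotZ, rotZ_zero_coord, rotZ_one_coord]
  congr 1
  linear_combination (p.1 0 * p.2 0 + p.1 1 * p.2 1) * Real.sin_sq_add_cos_sq θ

lemma continuous_omg {q : ℝ} (hq : 0 ≤ q) : Continuous (omg q) := by
  unfold omg
  refine Continuous.div (continuous_jap.pow 2) (continuous_const.add continuous_jap) fun v => ?_
  linarith [jap_pos v]

lemma omg_nonneg {q : ℝ} (hq : 0 ≤ q) (v : E3) : 0 ≤ omg q v := by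
  have := jap_pos v; unfold omg; positivity

lemma abs_radR_sub_le (η : ℝ) (x y : E3) : |radR η x - radR η y| ≤ |slashN x - slashN y| := by
  have h1 := radR_sq η x
  have h2 := radR_sq η y
  have hx : slashN x ≤ radR η x := Real.le_sqrt_of_sq_le (by nlinarith [sq_nonneg η])
  have hy : slashN y ≤ radR η y := Real.le_sqrt_of_sq_le (by nlinarith [sq_nonneg η])
  have hx0 := slashN_nonneg x
  have hy0 := slashN_nonneg y
  rcases (add_nonneg hx0 hy0).eq_or_lt with h | h
  · have e1 : slashN x = 0 := by linarith
    have e2 : slashN y = 0 := by linarith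
    simp [radR, e1, e2]
  · have e : (radR η x - radR η y) * (radR η x + radR η y) =
        (slashN x - slashN y) * (slashN x + slashN y) := by nlinarith
    have e' : |radR η x - radR η y| * (radR η x + radR η y) =
        |slashN x - slashN y| * (slashN x + slashN y) := by
      rw [← abs_of_nonneg (by linarith : 0 ≤ radR η x + radR η y), ← abs_mul, e, abs_mul,
        abs_of_nonneg h.le]
    by_contra hlt
    rw [not_le] at hlt
    nlinarith [abs_nonneg (slashN x - slashN y)]

namespace FieldData

variable {g : E3 × E3 → ℝ≥0∞} {z η : ℝ} {J n : ℕ}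

lemma slashN_ge (S : FieldData g z η J n) {p : E3 × E3} (hv : ‖p.2‖ ≤ z ^ 6003)
    (hL : (z ^ 1560)⁻¹ ≤ |angL p|) :
    η ≤ slashN p.1 ∧ 0 < slashN p.1 ∧ 1 / slashN p.1 ≤ slashN p.2 * z ^ 1560 := by
  have hz : 0 < z := by linarith [S.hz]
  have h := hL.trans (abs_angL_le p)
  have hpos : 0 < (z ^ 1560)⁻¹ := by positivity
  have h0 : 0 < slashN p.1 := by
    rcases (slashN_nonneg p.1).eq_or_lt with h0 | h0
    · rw [← h0, zero_mul] at h; linarith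
    · exact h0
  refine ⟨S.hηz.trans ?_, h0, ?_⟩
  · have h2 : (z ^ 1560)⁻¹ ≤ slashN p.1 * z ^ 6003 :=
      h.trans (mul_le_mul_of_nonneg_left ((slashN_le_norm _).trans hv) h0.le)
    have h3 : (z ^ 7563)⁻¹ ≤ slashN p.1 := by
      rw [← div_le_iff₀ (by positivity)] at h2
      refine le_trans (le_of_eq ?_) h2
      field_simp
    refine le_trans ?_ h3
    gcongr
    · linarith [S.hz]
    · norm_num
  · rw [div_le_iff₀ h0]
    rw [inv_le_iff_one_le_mul₀ (by positivity)] at h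
    linarith

lemma field_ring_num_le (S : FieldData g z η J n) {k : ℕ} (hk : k ≤ 6003)
    {B : Set (E3 × E3)} (hB : MeasurableSet B) (hBi : ∀ θ p, rotP θ p ∈ B ↔ p ∈ B)
    (hBv : ∀ p ∈ B, 1 ≤ slashN p.2 ∧ η ≤ slashN p.1) {b β : ℝ} (hb0 : 0 ≤ b) (hβ : 0 < β) (x : E3)
    (hnear : ∀ δ : E3 → ℝ, Measurable δ → (∀ θ v, δ (rotZ θ v) = δ v) → ∀ y,
      ∫⁻ v, B.indicator 1 (y, v) * {v | ‖x - y‖ ≤ δ v}.indicator 1 v ≤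
        ENNReal.ofReal b * ∫⁻ v, {v : E3 | 1 ≤ slashN v ∧ ‖v‖ ≤ z ^ k}.indicator 1 v *
          {v | ‖x - y‖ ≤ δ v}.indicator 1 v)
    (hb : b * (128 * z ^ (2 * k + 2)) ≤ β ^ 2) :
    ∫⁻ p in B, g p * invSq (x - p.1) ≤ ENNReal.ofReal (β * z ^ 2) * (1 + morI g η J) := by
  have hz := S.hz
  have hz0 : 0 < z := by linarith
  have hA : MeasurableSet {v : E3 | 1 ≤ slashN v ∧ ‖v‖ ≤ z ^ k} :=
    (measurableSet_le measurable_const continuous_slashN.measurable).inter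
      (measurableSet_le measurable_norm measurable_const)
  refine (field_ring_le S.toStaticData hz0.le S.hη S.hJ hB hBi hBv hA (fun v hv => hv.1) hβ x
    hnear ?_).trans ?_
  · refine (mul_le_mul' le_rfl (lintegral_jap_div_sq_le (l := z ^ k) (by positivity) hA
      fun v hv => hv)).trans ?_
    rw [← ENNReal.ofReal_mul hb0]
    apply ENNReal.ofReal_le_ofReal
    refine le_trans (mul_le_mul_of_nonneg_left ?_ hb0) hb
    have h1 : 1 ≤ z ^ k := one_le_pow₀ (by linarith)
    have hlog : Real.log (1 + z ^ k) ≤ z := by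
      refine le_trans (Real.log_le_log (by positivity) ?_) S.log_le
      gcongr
      linarith
    have hlog0 : 0 ≤ Real.log (1 + z ^ k) := Real.log_nonneg (by linarith)
    calc 32 * (1 + z ^ k) ^ 2 * Real.log (1 + z ^ k) ^ 2 ≤ 32 * (2 * z ^ k) ^ 2 * z ^ 2 := by
          gcongr; linarith
      _ = 128 * z ^ (2 * k + 2) := by ring
  · rw [mul_add, mul_one]
    refine add_le_add (ENNReal.ofReal_le_ofReal ?_)
      (mul_le_mul' (ENNReal.ofReal_le_ofReal ?_) le_rfl)
    · have : 24 * z ≤ z ^ 2 := by nlinarith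
      gcongr
    · rw [mul_comm]
      have : 64 ≤ z ^ 2 := by nlinarith
      gcongr

lemma near_one {k : ℕ} {B : Set (E3 × E3)}
    (hBv : ∀ p ∈ B, 1 ≤ slashN p.2 ∧ ‖p.2‖ ≤ z ^ k) (x : E3) (δ : E3 → ℝ) (y : E3) :
    ∫⁻ v, B.indicator 1 (y, v) * {v | ‖x - y‖ ≤ δ v}.indicator 1 v ≤
        ENNReal.ofReal 1 * ∫⁻ v, {v : E3 | 1 ≤ slashN v ∧ ‖v‖ ≤ z ^ k}.indicator 1 v *
          {v | ‖x - y‖ ≤ δ v}.indicator 1 v := by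
  rw [ENNReal.ofReal_one]
  exact near_of_subset hBv δ x y

lemma field_slow_le (S : FieldData g z η J n) {k : ℕ} (hk : k ≤ 6003) (x : E3) :
    ∫⁻ p in {p : E3 × E3 | ‖p.2‖ ≤ z ^ k ∧ 1 ≤ slashN p.2 ∧ (z ^ 1560)⁻¹ ≤ |angL p|},
      g p * invSq (x - p.1) ≤ ENNReal.ofReal (z ^ (k + 5)) * (1 + morI g η J) := by
  have hz := S.hz
  have hz0 : 0 < z := by linarith
  have hpk : z ^ k ≤ z ^ 6003 := pow_le_pow_right₀ (by linarith) hk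
  refine (S.field_ring_num_le hk (b := 1) (β := z ^ (k + 2)) ?_ (fun θ p => ?_)
    (fun p hp => ⟨hp.2.1, (S.slashN_ge (hp.1.trans hpk) hp.2.2).1⟩) zero_le_one (by positivity) x
    (fun δ _ _ y => near_one (fun p hp => ⟨hp.2.1, hp.1⟩) x δ y) ?_).trans ?_
  · exact (measurableSet_le measurable_snd.norm measurable_const).inter
      ((measurableSet_le measurable_const (continuous_slashN.comp continuous_snd).measurable).inter
      (measurableSet_le measurable_const continuous_angL.abs.measurable))
  · simp only [Set.mem_ofPred_eq, angL_rotP]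
    simp only [rotP, norm_rotZ, slashN_rotZ]
  · have e : (z ^ (k + 2)) ^ 2 = z ^ 2 * z ^ (2 * k + 2) := by ring
    rw [e, one_mul]
    gcongr
    nlinarith
  · refine mul_le_mul' (ENNReal.ofReal_le_ofReal ?_) le_rfl
    rw [← pow_add]
    exact pow_le_pow_right₀ (by linarith) (by omega)

lemma univ_field_le {ι : Type*} (s : Finset ι) (B : ι → Set (E3 × E3)) (h : E3 × E3 → ℝ≥0∞)
    (hc : ∀ p, ∃ i ∈ s, p ∈ B i) : ∫⁻ p, h p ≤ ∑ i ∈ s, ∫⁻ p in B i, h p := by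
  rw [← lintegral_finsetSum_measure]
  refine lintegral_mono' ?_ le_rfl
  intro t
  rw [Measure.finsetSum_apply]
  calc volume t ≤ volume (⋃ i ∈ s, t ∩ B i) := measure_mono fun p hp => by
        obtain ⟨i, hi, hpi⟩ := hc p
        exact mem_biUnion hi ⟨hp, hpi⟩
    _ ≤ ∑ i ∈ s, volume (t ∩ B i) := measure_biUnion_finset_le _ _
    _ ≤ _ := Finset.sum_le_sum fun i _ => Measure.le_restrict_apply _ _

/-- The field is controlled everywhere by the Morawetz integrand. -/
lemma field_le (S : FieldData g z η J n) (x : E3) :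
    ∫⁻ p, g p * invSq (x - p.1) ≤ ENNReal.ofReal (z ^ 6010) * (1 + morI g η J) := by
  have hz := S.hz
  have hz0 : 0 < z := by linarith
  set B : Fin 4 → Set (E3 × E3) := ![{p | z ^ 6003 < ‖p.2‖},
    {p | ‖p.2‖ ≤ z ^ 6003 ∧ |angL p| < (z ^ 1560)⁻¹}, {p | ‖p.2‖ ≤ z ^ 6003 ∧ slashN p.2 < 1},
    {p | ‖p.2‖ ≤ z ^ 6003 ∧ 1 ≤ slashN p.2 ∧ (z ^ 1560)⁻¹ ≤ |angL p|}] with hBd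
  refine (univ_field_le Finset.univ B _ fun p => ?_).trans ?_
  · rcases lt_or_ge (z ^ 6003) ‖p.2‖ with h | h
    · exact ⟨0, Finset.mem_univ _, h⟩
    rcases lt_or_ge |angL p| (z ^ 1560)⁻¹ with h2 | h2
    · exact ⟨1, Finset.mem_univ _, h, h2⟩
    rcases lt_or_ge (slashN p.2) 1 with h3 | h3
    · exact ⟨2, Finset.mem_univ _, h, h3⟩
    · exact ⟨3, Finset.mem_univ _, h, h3, h2⟩
  · rw [Fin.sum_univ_four]
    have h0 := S.field_high_le x
    have h1 := S.field_lowL_le x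
    have h2 := S.field_axial_le x
    have h3 := S.field_slow_le (k := 6003) le_rfl x
    have m : ∀ k : ℕ, k ≤ 6008 → ENNReal.ofReal (z ^ k) ≤
        ENNReal.ofReal (z ^ 6008) * (1 + morI g η J) := fun k hk => by
      calc ENNReal.ofReal (z ^ k) ≤ ENNReal.ofReal (z ^ 6008) * 1 := by
            rw [mul_one]
            exact ENNReal.ofReal_le_ofReal (pow_le_pow_right₀ (by linarith) hk)
        _ ≤ _ := by gcongr; exact le_self_add
    refine (add_le_add (add_le_add (add_le_add (h0.trans (m _ (by norm_num)))
      (h1.trans (m _ (by norm_num)))) (h2.trans (m _ (by norm_num)))) h3).trans ?_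
    have e : ENNReal.ofReal (z ^ 6010) = ENNReal.ofReal (z ^ 2) * ENNReal.ofReal (z ^ 6008) := by
      rw [← ENNReal.ofReal_mul (by positivity), ← pow_add]
    rw [e]
    have h4 : (4 : ℝ≥0∞) ≤ ENNReal.ofReal (z ^ 2) := by
      rw [show (4 : ℝ≥0∞) = ENNReal.ofReal 4 by simp]
      exact ENNReal.ofReal_le_ofReal (by nlinarith)
    calc _ = 4 * (ENNReal.ofReal (z ^ 6008) * (1 + morI g η J)) := by norm_num; ring
      _ ≤ _ := by rw [mul_assoc]; gcongr

end FieldData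

namespace FieldData

variable {g : E3 × E3 → ℝ≥0∞} {z η : ℝ} {J n : ℕ}

lemma field_fast_axial_le (S : FieldData g z η J n) (x : E3) :
    ∫⁻ p in {p : E3 × E3 | z ^ 5903 ≤ ‖p.2‖ ∧ ‖p.2‖ ≤ z ^ 6003 ∧ slashN p.2 < z ^ 2700 ∧
      (z ^ 1560)⁻¹ ≤ |angL p|}, g p * invSq (x - p.1) ≤ ENNReal.ofReal (z ^ 5910) := by
  have hz := S.hz
  have hz0 : 0 < z := by linarith
  obtain ⟨B, hBd⟩ : ∃ B : Set (E3 × E3), B = {p : E3 × E3 | z ^ 5903 ≤ ‖p.2‖ ∧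
    ‖p.2‖ ≤ z ^ 6003 ∧ slashN p.2 < z ^ 2700 ∧ (z ^ 1560)⁻¹ ≤ |angL p|} := ⟨_, rfl⟩
  have hB : MeasurableSet B := by
    rw [hBd]
    exact (measurableSet_le measurable_const measurable_snd.norm).inter
      ((measurableSet_le measurable_snd.norm measurable_const).inter
      ((measurableSet_lt (continuous_slashN.comp continuous_snd).measurable measurable_const).inter
      (measurableSet_le measurable_const continuous_angL.abs.measurable)))
  have hBi : ∀ θ p, rotP θ p ∈ B ↔ p ∈ B := fun θ p => by
    rw [hBd]
    simp only [Set.mem_ofPred_eq, angL_rotP]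
    simp only [rotP, norm_rotZ, slashN_rotZ]
  rw [← hBd]
  have hA : MeasurableSet {v : E3 | slashN v ≤ z ^ 2700 ∧ ‖v‖ ≤ z ^ 6003} :=
    (measurableSet_le continuous_slashN.measurable measurable_const).inter
      (measurableSet_le measurable_norm measurable_const)
  have hδ : 0 < (z ^ 5500)⁻¹ := by positivity
  refine (near_far S.le hB hA (δ := fun _ => (z ^ 5500)⁻¹) measurable_const (fun _ => hδ) 1 x
    (near_of_subset (fun p hp => ?_) _ x)).trans ?_
  · rw [hBd] at hp
    exact ⟨hp.2.2.1.le, hp.2.1⟩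
  have hfar := far_ring_le S.toStaticData hB hBi (fun p hp => by
      rw [hBd] at hp; exact (S.slashN_ge hp.2.1 hp.2.2.2).2.1)
    (δ := fun _ => (z ^ 5500)⁻¹) measurable_const (fun _ => hδ) (fun _ _ => rfl) x
    (K := fun p => ENNReal.ofReal (4 * z ^ 3857) * ENNReal.ofReal (1 + ‖p.2‖)) fun p hp => by
      rw [hBd] at hp
      obtain ⟨h1, h2, h3, h4⟩ := hp
      obtain ⟨-, hs0, hs⟩ := S.slashN_ge h2 h4
      rw [← ENNReal.ofReal_mul (by positivity)]
      apply ENNReal.ofReal_le_ofReal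
      have hle : (z ^ 5500)⁻¹ ≤ Real.sqrt ((z ^ 5500)⁻¹ ^ 2 + (slashN x - slashN p.1) ^ 2) :=
        Real.le_sqrt_of_sq_le (by nlinarith [sq_nonneg (slashN x - slashN p.1)])
      calc 4 / (Real.sqrt ((z ^ 5500)⁻¹ ^ 2 + (slashN x - slashN p.1) ^ 2) * slashN p.1)
          ≤ 4 / ((z ^ 5500)⁻¹ * slashN p.1) := by gcongr
        _ = 4 * z ^ 5500 * (1 / slashN p.1) := by field_simp
        _ ≤ 4 * z ^ 5500 * (z ^ 2700 * z ^ 1560) := by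
            gcongr; refine hs.trans ?_; gcongr
        _ = 4 * z ^ 3857 * z ^ 5903 := by ring
        _ ≤ _ := by gcongr; linarith
  refine (add_le_add (mul_le_mul' le_rfl ((setLIntegral_const _ _).le.trans (mul_le_mul' le_rfl
    (volume_slab_le (by positivity) (by positivity) hA fun v hv => hv)))) (hfar.trans
    (b := ∫⁻ p, g p * (ENNReal.ofReal (4 * z ^ 3857) * ENNReal.ofReal (1 + ‖p.2‖)))
    (c := ENNReal.ofReal (4 * z ^ 3857) * ENNReal.ofReal z) ?_)).trans ?_
  · simp only [mul_left_comm (g _)]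
    rw [lintegral_const_mul' _ _ ENNReal.ofReal_ne_top]
    exact mul_le_mul' le_rfl S.energy
  · rw [mul_one, ← ENNReal.ofReal_mul (by positivity), ← ENNReal.ofReal_mul (by positivity),
      ← ENNReal.ofReal_mul (by positivity), ← ENNReal.ofReal_mul (by positivity),
      ← ENNReal.ofReal_add (by positivity) (by positivity)]
    apply ENNReal.ofReal_le_ofReal
    have e1 : z * (4 * π) * ((z ^ 5500)⁻¹ * (8 * (z ^ 2700) ^ 2 * z ^ 6003)) =
        z ^ 5904 * (32 * π) := by field_simp; norm_num
    have e2 : 4 * z ^ 3857 * z = z ^ 3858 * 4 := by ring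
    have h1 : z ^ 5910 = z ^ 6 * z ^ 5904 := by rw [← pow_add]
    have h2 : z ^ 3858 ≤ z ^ 5904 := pow_le_pow_right₀ (by linarith) (by norm_num)
    have h3 : z ≤ z ^ 6 := le_self_pow₀ (by linarith) (by norm_num)
    rw [e1, e2, h1]
    nlinarith [pow_pos hz0 5904, Real.pi_le_four]

lemma field_noncollinear_le (S : FieldData g z η J n) (x : E3) (N : ℝ) :
    ∫⁻ p in {p : E3 × E3 | z ^ 5903 ≤ ‖p.2‖ ∧ ‖p.2‖ ≤ z ^ 6003 ∧ z ^ 2700 ≤ slashN p.2 ∧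
      (z ^ 1560)⁻¹ ≤ |angL p| ∧ slashN p.2 * (z ^ 6403)⁻¹ ≤ |radV η p - N|},
      g p * invSq (x - p.1) ≤
        ENNReal.ofReal (z ^ 5910) * (1 + rvI g η J (z ^ 6003) N (radR η x)) := by
  have hz := S.hz
  have hz0 : 0 < z := by linarith
  have hη := S.hη
  obtain ⟨B, hBd⟩ : ∃ B : Set (E3 × E3), B = {p : E3 × E3 | z ^ 5903 ≤ ‖p.2‖ ∧
    ‖p.2‖ ≤ z ^ 6003 ∧ z ^ 2700 ≤ slashN p.2 ∧ (z ^ 1560)⁻¹ ≤ |angL p| ∧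
    slashN p.2 * (z ^ 6403)⁻¹ ≤ |radV η p - N|} := ⟨_, rfl⟩
  have hsm : Measurable fun p : E3 × E3 => slashN p.2 :=
    (continuous_slashN.comp continuous_snd).measurable
  have hB : MeasurableSet B := by
    rw [hBd]
    exact (measurableSet_le measurable_const measurable_snd.norm).inter
      ((measurableSet_le measurable_snd.norm measurable_const).inter
      ((measurableSet_le measurable_const hsm).inter
      ((measurableSet_le measurable_const continuous_angL.abs.measurable).inter
      (measurableSet_le (hsm.mul_const _) ((continuous_radV hη).sub continuous_const).abs.measurable))))
  have hBi : ∀ θ p, rotP θ p ∈ B ↔ p ∈ B := fun θ p => by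
    rw [hBd]
    simp only [Set.mem_ofPred_eq, angL_rotP, radV_rotP]
    simp only [rotP, norm_rotZ, slashN_rotZ]
  rw [← hBd]
  have hA : MeasurableSet {v : E3 | slashN v ≤ z ^ 6003 ∧ ‖v‖ ≤ z ^ 6003} :=
    (measurableSet_le continuous_slashN.measurable measurable_const).inter
      (measurableSet_le measurable_norm measurable_const)
  refine (near_far S.le hB hA (δ := fun _ => η) measurable_const (fun _ => hη) 1 x
    (near_of_subset (fun p hp => ?_) _ x)).trans ?_
  · rw [hBd] at hp
    exact ⟨(slashN_le_norm _).trans hp.2.1, hp.2.1⟩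
  obtain ⟨R, hR⟩ : ∃ R, R = radR η x := ⟨_, rfl⟩
  rw [← hR]
  have hfar := far_ring_le S.toStaticData hB hBi (fun p hp => by
      rw [hBd] at hp; exact (S.slashN_ge hp.2.1 hp.2.2.2.1).2.1)
    (δ := fun _ => η) measurable_const (fun _ => hη) (fun _ _ => rfl) x
    (K := fun p => ENNReal.ofReal (4 * z ^ 1560) * ENNReal.ofReal (1 + ‖p.2‖) +
      ENNReal.ofReal (96 * z ^ 5863) * ENNReal.ofReal (omg (z ^ 6003) p.2 * (radV η p - N) ^ 2 *
        scaleSum η J (radR η p.1 - R))) fun p hp => by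
      rw [hBd] at hp
      obtain ⟨h1, h2, h3, h4, h5⟩ := hp
      obtain ⟨-, hs0, hs⟩ := S.slashN_ge h2 h4
      have ho := omg_nonneg (q := z ^ 6003) (by positivity) p.2
      have hsc := scaleSum_nonneg η J (radR η p.1 - R)
      rw [← ENNReal.ofReal_mul (by positivity), ← ENNReal.ofReal_mul (by positivity),
        ← ENNReal.ofReal_add (by positivity) (by positivity)]
      apply ENNReal.ofReal_le_ofReal
      have hsq : (radR η p.1 - R) ^ 2 ≤ (slashN x - slashN p.1) ^ 2 := by
        rw [sq_le_sq, abs_sub_comm (slashN x), hR]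
        exact abs_radR_sub_le η p.1 x
      have hq := inv_sqrt_le_scaleSum hη S.hJ (radR η p.1 - R)
      have hle : 1 / Real.sqrt (η ^ 2 + (slashN x - slashN p.1) ^ 2) ≤
          1 + 8 * scaleSum η J (radR η p.1 - R) := by
        refine le_trans ?_ hq
        gcongr
      have hw0 := slashN_nonneg p.2
      have homg : z ^ 5803 / 3 ≤ omg (z ^ 6003) p.2 := by
        have hj1 : z ^ 5903 ≤ jap p.2 := h1.trans (norm_le_jap _)
        have hj2 : jap p.2 ≤ 2 * z ^ 6003 := by
          have : 1 ≤ z ^ 6003 := one_le_pow₀ (by linarith)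
          linarith [jap_le p.2]
        have hj := jap_pos p.2
        unfold omg
        rw [div_le_div_iff₀ (by norm_num) (by positivity)]
        have e : z ^ 5803 * z ^ 6003 = z ^ 5903 * z ^ 5903 := by ring
        nlinarith [pow_pos hz0 5803, pow_pos hz0 5903, pow_pos hz0 6003]
      have hv2 : slashN p.2 ^ 2 * (z ^ 12806)⁻¹ ≤ (radV η p - N) ^ 2 := by
        have := pow_le_pow_left₀ (by positivity) h5 2
        rw [sq_abs] at this
        refine le_trans (le_of_eq ?_) this
        rw [mul_pow, inv_pow, ← pow_mul]
      have hkey : slashN p.2 * z ^ 1560 * 32 ≤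
          96 * z ^ 5863 * (omg (z ^ 6003) p.2 * (radV η p - N) ^ 2) := by
        calc slashN p.2 * z ^ 1560 * 32
            = 96 * z ^ 5863 * (z ^ 5803 / 3 * (slashN p.2 * z ^ 2700 * (z ^ 12806)⁻¹)) := by
              field_simp; ring
          _ ≤ 96 * z ^ 5863 * (z ^ 5803 / 3 * (slashN p.2 * slashN p.2 * (z ^ 12806)⁻¹)) := by
              gcongr
          _ ≤ _ := by
              rw [← sq]; gcongr
      calc 4 / (Real.sqrt (η ^ 2 + (slashN x - slashN p.1) ^ 2) * slashN p.1)
          = 4 * (1 / slashN p.1) * (1 / Real.sqrt (η ^ 2 + (slashN x - slashN p.1) ^ 2)) := by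
            field_simp
        _ ≤ 4 * (slashN p.2 * z ^ 1560) * (1 + 8 * scaleSum η J (radR η p.1 - R)) := by
            gcongr
        _ = 4 * z ^ 1560 * slashN p.2 +
            slashN p.2 * z ^ 1560 * 32 * scaleSum η J (radR η p.1 - R) := by ring
        _ ≤ 4 * z ^ 1560 * (1 + ‖p.2‖) + 96 * z ^ 5863 * (omg (z ^ 6003) p.2 *
              (radV η p - N) ^ 2) * scaleSum η J (radR η p.1 - R) := by
            gcongr
            linarith [slashN_le_norm p.2]
        _ = _ := by ring
  refine (add_le_add (mul_le_mul' le_rfl ((setLIntegral_const _ _).le.trans (mul_le_mul' le_rfl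
    (volume_slab_le (by positivity) (by positivity) hA fun v hv => hv)))) (hfar.trans
    (c := ENNReal.ofReal (4 * z ^ 1560) * ENNReal.ofReal z +
      ENNReal.ofReal (96 * z ^ 5863) * rvI g η J (z ^ 6003) N R) ?_)).trans ?_
  · simp only [mul_add, mul_left_comm (g _)]
    have m1 : Measurable fun p : E3 × E3 => ENNReal.ofReal (4 * z ^ 1560) *
        (g p * ENNReal.ofReal (1 + ‖p.2‖)) := (S.meas.mul (by fun_prop)).const_mul _
    rw [lintegral_add_left m1, lintegral_const_mul' _ _ ENNReal.ofReal_ne_top,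
      lintegral_const_mul' _ _ ENNReal.ofReal_ne_top, rvI]
    gcongr
    exact S.energy
  · rw [mul_one, ← ENNReal.ofReal_mul (by positivity), ← ENNReal.ofReal_mul (by positivity),
      ← ENNReal.ofReal_mul (by positivity), ← ENNReal.ofReal_mul (by positivity), ← add_assoc,
      ← ENNReal.ofReal_add (by positivity) (by positivity), mul_add, mul_one]
    have h1 : z ^ 5910 = z ^ 47 * z ^ 5863 := by rw [← pow_add]
    have h3 : z ≤ z ^ 47 := le_self_pow₀ (by linarith) (by norm_num)
    refine add_le_add (ENNReal.ofReal_le_ofReal ?_)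
      (mul_le_mul' (ENNReal.ofReal_le_ofReal ?_) le_rfl)
    · have e1 : z * (4 * π) * (η * (8 * (z ^ 6003) ^ 2 * z ^ 6003)) ≤ 32 * π := by
        calc z * (4 * π) * (η * (8 * (z ^ 6003) ^ 2 * z ^ 6003))
            = 32 * π * (η * z ^ 18010) := by ring
          _ ≤ 32 * π * ((z ^ 20000)⁻¹ * z ^ 20000) := by
              gcongr
              · exact S.hηz
              · linarith
              · norm_num
          _ = 32 * π := by rw [inv_mul_cancel₀ (by positivity), mul_one]
      have e2 : 4 * z ^ 1560 * z ≤ 4 * z ^ 5863 := by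
        have : z ^ 1561 ≤ z ^ 5863 := pow_le_pow_right₀ (by linarith) (by norm_num)
        calc 4 * z ^ 1560 * z = 4 * z ^ 1561 := by ring
          _ ≤ _ := by linarith
      have h5 : 1 ≤ z ^ 5863 := one_le_pow₀ (by linarith)
      rw [h1]
      nlinarith [Real.pi_le_four]
    · rw [h1]
      have := pow_pos hz0 5863
      gcongr
      linarith

lemma field_collinear_le (S : FieldData g z η J n) (x : E3) (N : ℝ) :
    ∫⁻ p in {p : E3 × E3 | ‖p.2‖ ≤ z ^ 6003 ∧ 1 ≤ slashN p.2 ∧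
      (z ^ 1560)⁻¹ ≤ |angL p| ∧ |radV η p - N| ≤ slashN p.2 * (z ^ 6403)⁻¹},
      g p * invSq (x - p.1) ≤ ENNReal.ofReal (z ^ 5910) * (1 + morI g η J) := by
  have hz := S.hz
  have hz0 : 0 < z := by linarith
  have hη := S.hη
  obtain ⟨B, hBd⟩ : ∃ B : Set (E3 × E3), B = {p : E3 × E3 | ‖p.2‖ ≤ z ^ 6003 ∧ 1 ≤ slashN p.2 ∧
    (z ^ 1560)⁻¹ ≤ |angL p| ∧ |radV η p - N| ≤ slashN p.2 * (z ^ 6403)⁻¹} := ⟨_, rfl⟩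
  have hsm : Measurable fun p : E3 × E3 => slashN p.2 :=
    (continuous_slashN.comp continuous_snd).measurable
  have hB : MeasurableSet B := by
    rw [hBd]
    exact (measurableSet_le measurable_snd.norm measurable_const).inter
      ((measurableSet_le measurable_const hsm).inter
      ((measurableSet_le measurable_const continuous_angL.abs.measurable).inter
      (measurableSet_le ((continuous_radV hη).sub continuous_const).abs.measurable
        (hsm.mul_const _))))
  have hBi : ∀ θ p, rotP θ p ∈ B ↔ p ∈ B := fun θ p => by
    rw [hBd]
    simp only [Set.mem_ofPred_eq, angL_rotP, radV_rotP]
    simp only [rotP, norm_rotZ, slashN_rotZ]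
  rw [← hBd]
  have hBg : ∀ p ∈ B, η ≤ slashN p.1 := fun p hp => by
    rw [hBd] at hp; exact (S.slashN_ge hp.1 hp.2.2.1).1
  refine (S.field_ring_num_le (k := 6003) le_rfl hB hBi (fun p hp => ⟨?_, hBg p hp⟩)
    (b := 2 * Real.sqrt (4 * (z ^ 400)⁻¹)) (β := z ^ 5906) (by positivity) (by positivity) x
    (fun δ hδm hδi y => ?_) ?_).trans ?_
  · rw [hBd] at hp; exact hp.2.1
  · by_cases hy : η ≤ slashN y
    · have hy0 : 0 < slashN y := hη.trans_le hy
      obtain ⟨A, hAd⟩ : ∃ A : Set E3, A = {v : E3 | 1 ≤ slashN v ∧ ‖v‖ ≤ z ^ 6003} := ⟨_, rfl⟩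
      have hA : MeasurableSet A := by
        rw [hAd]
        exact (measurableSet_le measurable_const continuous_slashN.measurable).inter
          (measurableSet_le measurable_norm measurable_const)
      obtain ⟨C, hCd⟩ : ∃ C : Set E3, C = {v : E3 | ‖x - y‖ ≤ δ v} := ⟨_, rfl⟩
      have hC : MeasurableSet C := by rw [hCd]; exact measurableSet_le measurable_const hδm
      rw [← hAd, ← hCd]
      have hG : Measurable fun v => (A.indicator 1 v * C.indicator 1 v : ℝ≥0∞) :=
        (measurable_one.indicator hA).mul (measurable_one.indicator hC)
      have hGi : ∀ θ v, (A.indicator 1 (rotZ θ v) * C.indicator 1 (rotZ θ v) : ℝ≥0∞) =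
          A.indicator 1 v * C.indicator 1 v := fun θ v => by
        have a1 : rotZ θ v ∈ A ↔ v ∈ A := by rw [hAd]; simp [slashN_rotZ, norm_rotZ]
        have a2 : rotZ θ v ∈ C ↔ v ∈ C := by rw [hCd]; simp [hδi]
        by_cases h1 : v ∈ A <;> by_cases h2 : v ∈ C <;> simp [h1, h2, a1, a2]
      refine le_trans (lintegral_mono fun v => ?_)
        (lintegral_angle_le hG hGi (c := fun v => N * (jap v * radR η y))
          (continuous_const.mul (continuous_jap.mul continuous_const)).measurable
          (fun θ v => by simp only [jap_rotZ]) hy0 (4 * (z ^ 400)⁻¹))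
      by_cases hv : (y, v) ∈ B
      · have hv' := hv
        rw [hBd] at hv'
        obtain ⟨h1, h2, h3, h4⟩ := hv'
        have hvA : v ∈ A := by rw [hAd]; exact ⟨h2, h1⟩
        have hj := jap_pos v
        have hr := radR_pos hη y
        have hvS : v ∈ {v : E3 | 0 < slashN v ∧ |y 0 * v 0 + y 1 * v 1 - N * (jap v * radR η y)| ≤
            4 * (z ^ 400)⁻¹ * (slashN y * slashN v)} := by
          refine ⟨by linarith, ?_⟩
          have e : y 0 * v 0 + y 1 * v 1 - N * (jap v * radR η y) =
              (radV η (y, v) - N) * (jap v * radR η y) := by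
            unfold radV; field_simp
          rw [e, abs_mul, abs_of_pos (mul_pos hj hr)]
          have hj2 : jap v ≤ 2 * z ^ 6003 := by
            have : 1 ≤ z ^ 6003 := one_le_pow₀ (by linarith)
            linarith [jap_le v]
          have hr2 : radR η y ≤ 2 * slashN y :=
            Real.sqrt_le_iff.2 ⟨by positivity, by nlinarith⟩
          have hs0 := slashN_nonneg v
          calc |radV η (y, v) - N| * (jap v * radR η y)
              ≤ slashN v * (z ^ 6403)⁻¹ * (2 * z ^ 6003 * (2 * slashN y)) := by gcongr
            _ = _ := by field_simp; norm_num
        rw [indicator_of_mem hv, indicator_of_mem hvA, indicator_of_mem hvS]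
        simp
      · simp [hv]
    · have : ∀ v, (B.indicator 1 (y, v) : ℝ≥0∞) = 0 := fun v =>
        indicator_of_notMem (fun h => hy (hBg _ h)) _
      simp [this]
  · have : Real.sqrt (4 * (z ^ 400)⁻¹) ≤ 2 * (z ^ 200)⁻¹ :=
      Real.sqrt_le_iff.2 ⟨by positivity, le_of_eq (by field_simp; norm_num)⟩
    calc 2 * Real.sqrt (4 * (z ^ 400)⁻¹) * (128 * z ^ (2 * 6003 + 2))
        ≤ 2 * (2 * (z ^ 200)⁻¹) * (128 * z ^ (2 * 6003 + 2)) := by gcongr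
      _ = 512 * z ^ 11808 := by field_simp; ring
      _ ≤ z ^ 4 * z ^ 11808 := by
          gcongr
          have : z ≤ z ^ 4 := le_self_pow₀ (by linarith) (by norm_num)
          linarith
      _ = _ := by ring
  · refine mul_le_mul' (ENNReal.ofReal_le_ofReal ?_) le_rfl
    rw [← pow_add]
    exact pow_le_pow_right₀ (by linarith) (by norm_num)

/-- Refined bound of the field at a point moving with radial velocity `N`. -/
lemma field_target_le (S : FieldData g z η J n) (x : E3) (N : ℝ) :
    ∫⁻ p, g p * invSq (x - p.1) ≤ ENNReal.ofReal (z ^ 5912) *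
      (1 + morI g η J + rvI g η J (z ^ 6003) N (radR η x)) := by
  have hz := S.hz
  have hz0 : 0 < z := by linarith
  set B : Fin 7 → Set (E3 × E3) := ![{p | z ^ 6003 < ‖p.2‖},
    {p | ‖p.2‖ ≤ z ^ 6003 ∧ |angL p| < (z ^ 1560)⁻¹}, {p | ‖p.2‖ ≤ z ^ 6003 ∧ slashN p.2 < 1},
    {p | ‖p.2‖ ≤ z ^ 5903 ∧ 1 ≤ slashN p.2 ∧ (z ^ 1560)⁻¹ ≤ |angL p|},
    {p | z ^ 5903 ≤ ‖p.2‖ ∧ ‖p.2‖ ≤ z ^ 6003 ∧ slashN p.2 < z ^ 2700 ∧ (z ^ 1560)⁻¹ ≤ |angL p|},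
    {p | z ^ 5903 ≤ ‖p.2‖ ∧ ‖p.2‖ ≤ z ^ 6003 ∧ z ^ 2700 ≤ slashN p.2 ∧
      (z ^ 1560)⁻¹ ≤ |angL p| ∧ slashN p.2 * (z ^ 6403)⁻¹ ≤ |radV η p - N|},
    {p | ‖p.2‖ ≤ z ^ 6003 ∧ 1 ≤ slashN p.2 ∧
      (z ^ 1560)⁻¹ ≤ |angL p| ∧ |radV η p - N| ≤ slashN p.2 * (z ^ 6403)⁻¹}] with hBd
  refine (univ_field_le Finset.univ B _ fun p => ?_).trans ?_
  · rcases lt_or_ge (z ^ 6003) ‖p.2‖ with h | h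
    · exact ⟨0, Finset.mem_univ _, h⟩
    rcases lt_or_ge |angL p| (z ^ 1560)⁻¹ with h2 | h2
    · exact ⟨1, Finset.mem_univ _, h, h2⟩
    rcases lt_or_ge (slashN p.2) 1 with h3 | h3
    · exact ⟨2, Finset.mem_univ _, h, h3⟩
    rcases le_total ‖p.2‖ (z ^ 5903) with h4 | h4
    · exact ⟨3, Finset.mem_univ _, h4, h3, h2⟩
    rcases lt_or_ge (slashN p.2) (z ^ 2700) with h5 | h5
    · exact ⟨4, Finset.mem_univ _, h4, h, h5, h2⟩
    rcases le_total (slashN p.2 * (z ^ 6403)⁻¹) |radV η p - N| with h6 | h6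
    · exact ⟨5, Finset.mem_univ _, h4, h, h5, h2, h6⟩
    · exact ⟨6, Finset.mem_univ _, h, h3, h2, h6⟩
  · set Y := 1 + morI g η J + rvI g η J (z ^ 6003) N (radR η x) with hY
    have y1 : 1 ≤ Y := by rw [hY, add_assoc]; exact le_self_add
    have y2 : 1 + morI g η J ≤ Y := le_self_add
    have y3 : 1 + rvI g η J (z ^ 6003) N (radR η x) ≤ Y := by
      rw [hY]; gcongr; exact le_self_add
    have m : ∀ k : ℕ, k ≤ 5910 → ENNReal.ofReal (z ^ k) ≤ ENNReal.ofReal (z ^ 5910) :=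
      fun k hk => ENNReal.ofReal_le_ofReal (pow_le_pow_right₀ (by linarith) hk)
    have hle : ∀ i ∈ Finset.univ, ∫⁻ p in B i, g p * invSq (x - p.1) ≤
        ENNReal.ofReal (z ^ 5910) * Y := by
      have h1 : ∀ {a : ℝ≥0∞} {k : ℕ}, k ≤ 5910 → a ≤ ENNReal.ofReal (z ^ k) →
          a ≤ ENNReal.ofReal (z ^ 5910) * Y := fun hk h => by
        refine (h.trans (m _ hk)).trans ?_
        calc _ = ENNReal.ofReal (z ^ 5910) * 1 := (mul_one _).symm
          _ ≤ _ := by gcongr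
      intro i _
      fin_cases i
      · exact h1 (by norm_num) (S.field_high_le x)
      · exact h1 (by norm_num) (S.field_lowL_le x)
      · exact h1 (by norm_num) (S.field_axial_le x)
      · exact (S.field_slow_le (k := 5903) (by norm_num) x).trans
          (mul_le_mul' (m _ (by norm_num)) y2)
      · exact h1 (by norm_num) (S.field_fast_axial_le x)
      · exact (S.field_noncollinear_le x N).trans (mul_le_mul' le_rfl y3)
      · exact (S.field_collinear_le x N).trans (mul_le_mul' le_rfl y2)
    refine (Finset.sum_le_sum hle).trans ?_
    rw [Finset.sum_const, Finset.card_univ, Fintype.card_fin, nsmul_eq_mul, ← mul_assoc]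
    gcongr
    have e : ENNReal.ofReal (z ^ 5912) = ENNReal.ofReal (z ^ 2) * ENNReal.ofReal (z ^ 5910) := by
      rw [← ENNReal.ofReal_mul (by positivity), ← pow_add]
    rw [e]
    gcongr
    rw [show ((7 : ℕ) : ℝ≥0∞) = ENNReal.ofReal 7 by simp]
    exact ENNReal.ofReal_le_ofReal (by nlinarith)

end FieldData

/-- The phase space density at a fixed time as an extended nonnegative function. -/
def dens (F : ℝ → E3 → E3 → ℝ) (s : ℝ) (p : E3 × E3) : ℝ≥0∞ := ENNReal.ofReal (F s p.1 p.2)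

/-- A bounded axially symmetric solution on `[0, t]`, extended to all times by freezing it outside
`[0, t]`, with the quantitative bounds in terms of a large parameter `z`. -/
structure Sol (F : ℝ → E3 → E3 → ℝ) (t z : ℝ) (n : ℕ) : Prop where
  cont : Continuous fun q : ℝ × E3 × E3 => F q.1 q.2.1 q.2.2
  nonneg : ∀ s x v, 0 ≤ F s x v
  le : ∀ s x v, F s x v ≤ z
  inv : ∀ s θ x v, F s (rotZ θ x) (rotZ θ v) = F s x v
  energy : ∀ s, ∫⁻ p, dens F s p * ENNReal.ofReal (1 + ‖p.2‖) ≤ ENNReal.ofReal z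
  moment : ∀ s, ∫⁻ p, dens F s p * ENNReal.ofReal ((1 + ‖p.2‖) ^ n) ≤
    ENNReal.ofReal ((z ^ 6000) ^ (n - 1))
  hn : 20000 ≤ n
  hz : 10 ^ 6 ≤ z
  decay : ∫⁻ v : E3, ENNReal.ofReal (((1 + ‖v‖) ^ 4)⁻¹) ≤ ENNReal.ofReal z
  deriv : ∃ G : ℝ × E3 × E3 → (ℝ × E3 × E3 →L[ℝ] ℝ), Continuous G ∧ ∀ s ∈ Ioo 0 t, ∀ p,
    HasFDerivAt (fun q : ℝ × E3 × E3 => F q.1 q.2.1 q.2.2) (G (s, p)) (s, p) ∧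
    G (s, p) (1, vhat p.2, rvpField F s p.1) = 0

/-- The Newtonian majorant of the field. -/
def majF (F : ℝ → E3 → E3 → ℝ) (s : ℝ) (x : E3) : ℝ≥0∞ := ∫⁻ p, dens F s p * invSq (x - p.1)

namespace Sol
variable {F : ℝ → E3 → E3 → ℝ} {t z : ℝ} {n : ℕ}

lemma cont_slice (S : Sol F t z n) (s : ℝ) : Continuous fun p : E3 × E3 => F s p.1 p.2 :=
  S.cont.comp (by fun_prop : Continuous fun p : E3 × E3 => (s, p))

lemma measurable_dens (S : Sol F t z n) (s : ℝ) : Measurable (dens F s) :=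
  ENNReal.measurable_ofReal.comp (S.cont_slice s).measurable

lemma measurable_dens_uncurry (S : Sol F t z n) :
    Measurable fun q : ℝ × E3 × E3 => dens F q.1 q.2 :=
  ENNReal.measurable_ofReal.comp S.cont.measurable

lemma staticData (S : Sol F t z n) (s : ℝ) : StaticData (dens F s) z where
  meas := S.measurable_dens s
  le p := ENNReal.ofReal_le_ofReal (S.le s _ _)
  inv θ p := by simp only [dens, rotP, S.inv]
  energy := S.energy s

/-- Functions of at most linear growth in velocity are integrable against the density. -/
lemma integrable_mul (S : Sol F t z n) (s : ℝ) {φ : E3 × E3 → ℝ} (hφ : AEStronglyMeasurable φ)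
    {C : ℝ} (hC : ∀ p, |φ p| ≤ C * (1 + ‖p.2‖)) :
    Integrable fun p : E3 × E3 => F s p.1 p.2 * φ p := by
  have hC0 : 0 ≤ C := by
    have := (abs_nonneg _).trans (hC 0)
    simpa using this
  refine ⟨(S.cont_slice s).aestronglyMeasurable.mul hφ, ?_⟩
  refine (lintegral_mono (g := fun p => ENNReal.ofReal C *
    (dens F s p * ENNReal.ofReal (1 + ‖p.2‖))) fun p => ?_).trans_lt ?_
  · rw [enorm_mul, Real.enorm_of_nonneg (S.nonneg _ _ _)]
    beta_reduce
    rw [mul_left_comm]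
    refine mul_le_mul' le_rfl ?_
    rw [← ENNReal.ofReal_mul hC0, ← ofReal_norm]
    exact ENNReal.ofReal_le_ofReal (hC p)
  · rw [lintegral_const_mul' _ _ ENNReal.ofReal_ne_top]
    exact ENNReal.mul_lt_top ENNReal.ofReal_lt_top ((S.energy s).trans_lt ENNReal.ofReal_lt_top)

lemma abs_integral_mul_le (S : Sol F t z n) (s : ℝ) {φ : E3 × E3 → ℝ}
    {C : ℝ} (hC : ∀ p, |φ p| ≤ C * (1 + ‖p.2‖)) :
    |∫ p : E3 × E3, F s p.1 p.2 * φ p| ≤ C * z := by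
  have hC0 : 0 ≤ C := by
    have := (abs_nonneg _).trans (hC 0)
    simpa using this
  have hz := S.hz
  rw [← ENNReal.ofReal_le_ofReal_iff (by positivity), ← Real.norm_eq_abs, ofReal_norm]
  refine (enorm_integral_le_lintegral_enorm _).trans ?_
  refine (lintegral_mono (g := fun p => ENNReal.ofReal C *
    (dens F s p * ENNReal.ofReal (1 + ‖p.2‖))) fun p => ?_).trans ?_
  · rw [enorm_mul, Real.enorm_of_nonneg (S.nonneg _ _ _)]
    beta_reduce
    rw [mul_left_comm]
    refine mul_le_mul' le_rfl ?_
    rw [← ENNReal.ofReal_mul hC0, ← ofReal_norm]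
    exact ENNReal.ofReal_le_ofReal (hC p)
  · rw [lintegral_const_mul' _ _ ENNReal.ofReal_ne_top, ENNReal.ofReal_mul hC0]
    exact mul_le_mul' le_rfl (S.energy s)

lemma rho_nonneg (S : Sol F t z n) (s : ℝ) (y : E3) : 0 ≤ rvpRho F s y :=
  integral_nonneg fun v => S.nonneg s y v

lemma ofReal_rho_le (S : Sol F t z n) (s : ℝ) (y : E3) :
    ENNReal.ofReal (rvpRho F s y) ≤ ∫⁻ v, dens F s (y, v) := by
  rw [← Real.enorm_of_nonneg (S.rho_nonneg s y)]
  refine (enorm_integral_le_lintegral_enorm _).trans (lintegral_mono fun v => ?_)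
  rw [Real.enorm_of_nonneg (S.nonneg _ _ _), dens]

lemma majF_eq (S : Sol F t z n) (s : ℝ) (x : E3) :
    majF F s x = ∫⁻ y, (∫⁻ v, dens F s (y, v)) * invSq (x - y) := by
  have hm : Measurable fun p : E3 × E3 => dens F s p * invSq (x - p.1) :=
    (S.measurable_dens s).mul (measurable_invSq.comp (by fun_prop))
  rw [majF, Measure.volume_eq_prod, lintegral_prod _ hm.aemeasurable]
  refine lintegral_congr fun y => ?_
  have hy : Measurable fun v => dens F s (y, v) := (S.measurable_dens s).comp measurable_prodMk_left
  exact lintegral_mul_const (μ := volume) (invSq (x - y)) hy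

lemma enorm_kernel_le (S : Sol F t z n) (s : ℝ) (x y : E3) :
    ‖(rvpRho F s y / ‖x - y‖ ^ 3) • (x - y)‖ₑ ≤ (∫⁻ v, dens F s (y, v)) * invSq (x - y) := by
  have h : ‖(rvpRho F s y / ‖x - y‖ ^ 3) • (x - y)‖ₑ =
      ENNReal.ofReal (rvpRho F s y) * invSq (x - y) := by
    rw [← ofReal_norm, norm_smul, Real.norm_of_nonneg (div_nonneg (S.rho_nonneg s y) (by positivity)),
      invSq, ← ENNReal.ofReal_mul (S.rho_nonneg s y)]
    congr 1
    by_cases h0 : ‖x - y‖ = 0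
    · simp [h0]
    · field_simp
  rw [h]
  exact mul_le_mul' (S.ofReal_rho_le s y) le_rfl

lemma enorm_field_le (S : Sol F t z n) (s : ℝ) (x : E3) : ‖rvpField F s x‖ₑ ≤ majF F s x := by
  rw [rvpField, enorm_smul, S.majF_eq]
  calc _ ≤ 1 * ‖∫ y, (rvpRho F s y / ‖x - y‖ ^ 3) • (x - y)‖ₑ := by
        refine mul_le_mul' ?_ le_rfl
        rw [Real.enorm_of_nonneg (by positivity), ← ENNReal.ofReal_one]
        refine ENNReal.ofReal_le_ofReal (inv_le_one_of_one_le₀ ?_)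
        linarith [Real.pi_gt_three]
    _ ≤ _ := by
        rw [one_mul]
        exact (enorm_integral_le_lintegral_enorm _).trans (lintegral_mono (S.enorm_kernel_le s x))

lemma exists_majF_le (S : Sol F t z n) : ∃ C : ℝ, 0 < C ∧ ∀ s x, majF F s x ≤ ENNReal.ofReal C := by
  have hz := S.hz
  have hδ : Measurable fun v : E3 => ((1 + ‖v‖) ^ 4)⁻¹ := by fun_prop
  refine ⟨z * (4 * π) * z + 2 * (z ^ 6000) ^ (n - 1), by positivity, fun s x => ?_⟩
  have := near_far (S.staticData s).le (B := univ) MeasurableSet.univ (A := univ)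
    MeasurableSet.univ hδ (fun v => by positivity) 1 x (fun y => by simp)
  simp only [Measure.restrict_univ, mul_one] at this
  rw [majF]
  refine this.trans ?_
  rw [ENNReal.ofReal_add (by positivity) (by positivity),
    ENNReal.ofReal_mul (p := z * (4 * π)) (by positivity),
    ENNReal.ofReal_mul (p := z) (by positivity), ENNReal.ofReal_mul (p := 2) (by positivity)]
  refine add_le_add (mul_le_mul' le_rfl S.decay) ?_
  refine le_trans (lintegral_mono (g := fun p => ENNReal.ofReal 2 *
    (dens F s p * ENNReal.ofReal ((1 + ‖p.2‖) ^ n))) fun p => ?_) ?_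
  · beta_reduce
    rw [mul_left_comm]
    refine mul_le_mul' le_rfl ?_
    refine (softK_le (by positivity) _).trans ?_
    rw [← ENNReal.ofReal_mul (by positivity)]
    refine ENNReal.ofReal_le_ofReal ?_
    have h1 : 2 / (((1 + ‖p.2‖) ^ 4)⁻¹) ^ 2 = 2 * (1 + ‖p.2‖) ^ 8 := by field_simp
    rw [h1]
    have := pow_le_pow_right₀ (a := 1 + ‖p.2‖) (by linarith [norm_nonneg p.2])
      (show 8 ≤ n by linarith [S.hn])
    linarith
  · rw [lintegral_const_mul' _ _ ENNReal.ofReal_ne_top]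
    exact mul_le_mul' le_rfl (S.moment s)

lemma exists_field_le (S : Sol F t z n) : ∃ C : ℝ, 0 < C ∧ ∀ s x, ‖rvpField F s x‖ ≤ C := by
  obtain ⟨C, hC, h⟩ := S.exists_majF_le
  refine ⟨C, hC, fun s x => ?_⟩
  rw [← ENNReal.ofReal_le_ofReal_iff hC.le, ofReal_norm]
  exact (S.enorm_field_le s x).trans (h s x)

lemma measurable_rho (S : Sol F t z n) : StronglyMeasurable fun q : ℝ × E3 => rvpRho F q.1 q.2 := by
  have : StronglyMeasurable (Function.uncurry fun (q : ℝ × E3) (v : E3) => F q.1 q.2 v) :=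
    (S.cont.comp (by fun_prop : Continuous fun r : (ℝ × E3) × E3 =>
      (r.1.1, r.1.2, r.2))).stronglyMeasurable
  exact this.integral_prod_right

lemma measurable_field (S : Sol F t z n) : Measurable fun q : ℝ × E3 => rvpField F q.1 q.2 := by
  have h : StronglyMeasurable (Function.uncurry fun (q : ℝ × E3) (y : E3) =>
      (rvpRho F q.1 y / ‖q.2 - y‖ ^ 3) • (q.2 - y)) := by
    have h1 : Measurable fun r : (ℝ × E3) × E3 => rvpRho F r.1.1 r.2 :=
      S.measurable_rho.measurable.comp
        (by fun_prop : Measurable fun r : (ℝ × E3) × E3 => (r.1.1, r.2))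
    have h2 : Measurable fun r : (ℝ × E3) × E3 =>
        (rvpRho F r.1.1 r.2 / ‖r.1.2 - r.2‖ ^ 3) • (r.1.2 - r.2) :=
      (h1.div (by fun_prop)).smul (by fun_prop)
    exact h2.stronglyMeasurable
  exact (h.integral_prod_right (ν := volume)).measurable.const_smul (4 * π)⁻¹

lemma measurable_field_slice (S : Sol F t z n) (s : ℝ) : Measurable (rvpField F s) :=
  S.measurable_field.comp measurable_prodMk_left

end Sol

/-- Integration by parts in a direction along which the coefficient is constant. -/
lemma integral_fderiv_mul_of_invariant {F Ψ c : E3 × E3 → ℝ} {F' : E3 × E3 → (E3 × E3 →L[ℝ] ℝ)}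
    (hF : ∀ p, HasFDerivAt F (F' p) p) (hF' : Continuous F') (hΨ : ContDiff ℝ 1 Ψ)
    (hΨc : HasCompactSupport Ψ) (hc : Measurable c) {C : ℝ} (hcb : ∀ p, |c p| ≤ C) {w : E3 × E3}
    (hcw : ∀ p (h : ℝ), c (p + h • w) = c p) :
    Integrable (fun p => F' p w * (c p * Ψ p)) ∧ Integrable (fun p => F p * (c p * fderiv ℝ Ψ p w)) ∧
    ∫ p, F' p w * (c p * Ψ p) = -∫ p, F p * (c p * fderiv ℝ Ψ p w) := by
  have hFc : Continuous F := continuous_iff_continuousAt.2 fun p => (hF p).continuousAt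
  have hint : ∀ k : E3 × E3 → ℝ, Continuous k → HasCompactSupport k →
      Integrable fun p => c p * k p := fun k hk hkc =>
    (hk.integrable_of_hasCompactSupport hkc).bdd_mul hc.aestronglyMeasurable
      (Eventually.of_forall hcb)
  have hΨ' : Continuous fun p => fderiv ℝ Ψ p w := (hΨ.continuous_fderiv one_ne_zero).clm_apply
    continuous_const
  have hΨ'c : HasCompactSupport fun p => fderiv ℝ Ψ p w :=
    (hΨc.fderiv ℝ).comp_left (g := fun L : E3 × E3 →L[ℝ] ℝ => L w) (by simp)
  have i1 : Integrable fun p => F' p w * (c p * Ψ p) := by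
    refine (hint (fun p => F' p w * Ψ p) ((hF'.clm_apply continuous_const).mul hΨ.continuous)
      hΨc.mul_left).congr (Eventually.of_forall fun p => ?_)
    ring
  have i2 : Integrable fun p => F p * (c p * fderiv ℝ Ψ p w) := by
    refine (hint (fun p => F p * fderiv ℝ Ψ p w) (hFc.mul hΨ') hΨ'c.mul_left).congr
      (Eventually.of_forall fun p => ?_)
    ring
  have i3 : Integrable fun p => F p * (c p * Ψ p) := by
    refine (hint (fun p => F p * Ψ p) (hFc.mul hΨ.continuous) hΨc.mul_left).congr
      (Eventually.of_forall fun p => ?_)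
    ring
  refine ⟨i1, i2, ?_⟩
  have : (volume : Measure (E3 × E3)).IsAddHaarMeasure := by
    rw [Measure.volume_eq_prod]; infer_instance
  have key := integral_bilinear_hasLineDerivAt_right_eq_neg_left_of_integrable (μ := volume)
    (f := F) (f' := fun p => F' p w) (g := fun p => c p * Ψ p)
    (g' := fun p => c p * fderiv ℝ Ψ p w) (v := w) (B := ContinuousLinearMap.mul ℝ ℝ)
    i1 i2 i3 (fun p _ => (hF p).hasLineDerivAt w) (fun p _ => by
      have h1 : HasLineDerivAt ℝ Ψ (fderiv ℝ Ψ p w) p w :=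
        (hΨ.differentiable one_ne_zero p).hasFDerivAt.hasLineDerivAt w
      have h2 := HasDerivAt.const_mul (c p) h1
      unfold HasLineDerivAt
      refine h2.congr_of_eventuallyEq (Eventually.of_forall fun h => ?_)
      simp only [hcw])
  simp only [ContinuousLinearMap.mul_apply'] at key
  rw [key, neg_neg]

lemma e3_eq_sum (a : E3) : a = ∑ i : Fin 3, a i • EuclideanSpace.single i (1 : ℝ) := by
  ext j
  fin_cases j <;> simp [Fin.sum_univ_three]

/-- Transport fields of the form `(a(v), b(x))` are divergence free. -/
lemma integral_transport_mul {F Ψ : E3 × E3 → ℝ} {F' : E3 × E3 → (E3 × E3 →L[ℝ] ℝ)}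
    (hF : ∀ p, HasFDerivAt F (F' p) p) (hF' : Continuous F') (hΨ : ContDiff ℝ 1 Ψ)
    (hΨc : HasCompactSupport Ψ) {a b : E3 → E3} (ha : Measurable a) (hb : Measurable b) {C : ℝ}
    (hac : ∀ v, ‖a v‖ ≤ C) (hbc : ∀ x, ‖b x‖ ≤ C) :
    Integrable (fun p : E3 × E3 => F' p (a p.2, b p.1) * Ψ p) ∧
    ∫ p : E3 × E3, F' p (a p.2, b p.1) * Ψ p =
      -∫ p : E3 × E3, F p * fderiv ℝ Ψ p (a p.2, b p.1) := by
  have hx : ∀ i : Fin 3, _ := fun i => integral_fderiv_mul_of_invariant hF hF' hΨ hΨc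
    (c := fun p => a p.2 i) (by fun_prop) (fun p => (abs_coord_le_norm _ i).trans (hac _))
    (w := (EuclideanSpace.single i (1 : ℝ), 0)) (fun p h => by simp)
  have hv : ∀ i : Fin 3, _ := fun i => integral_fderiv_mul_of_invariant hF hF' hΨ hΨc
    (c := fun p => b p.1 i) (by fun_prop) (fun p => (abs_coord_le_norm _ i).trans (hbc _))
    (w := (0, EuclideanSpace.single i (1 : ℝ))) (fun p h => by simp)
  have dec : ∀ (L : E3 × E3 →L[ℝ] ℝ) (x v : E3), L (x, v) =
      ∑ i : Fin 3, (x i * L (EuclideanSpace.single i (1 : ℝ), 0) +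
        v i * L (0, EuclideanSpace.single i (1 : ℝ))) := fun L x v => by
    have h : (x, v) = ∑ i : Fin 3, (x i • ((EuclideanSpace.single i (1 : ℝ), 0) : E3 × E3) +
        v i • ((0, EuclideanSpace.single i (1 : ℝ)) : E3 × E3)) := by
      refine Prod.ext ?_ ?_
      · rw [Prod.fst_sum]; simpa using e3_eq_sum x
      · rw [Prod.snd_sum]; simpa using e3_eq_sum v
    rw [h, map_sum]
    simp only [map_add, map_smul, smul_eq_mul]
  have e1 : (fun p : E3 × E3 => F' p (a p.2, b p.1) * Ψ p) = fun p => ∑ i : Fin 3,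
      (F' p (EuclideanSpace.single i (1 : ℝ), 0) * (a p.2 i * Ψ p) +
        F' p (0, EuclideanSpace.single i (1 : ℝ)) * (b p.1 i * Ψ p)) := by
    funext p
    rw [dec (F' p), Finset.sum_mul]
    exact Finset.sum_congr rfl fun i _ => by ring
  have e2 : (fun p : E3 × E3 => F p * fderiv ℝ Ψ p (a p.2, b p.1)) = fun p => ∑ i : Fin 3,
      (F p * (a p.2 i * fderiv ℝ Ψ p (EuclideanSpace.single i (1 : ℝ), 0)) +
        F p * (b p.1 i * fderiv ℝ Ψ p (0, EuclideanSpace.single i (1 : ℝ)))) := by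
    funext p
    rw [dec (fderiv ℝ Ψ p), Finset.mul_sum]
    exact Finset.sum_congr rfl fun i _ => by ring
  have j1 : ∀ i : Fin 3, Integrable fun p : E3 × E3 =>
      F' p (EuclideanSpace.single i (1 : ℝ), 0) * (a p.2 i * Ψ p) +
        F' p (0, EuclideanSpace.single i (1 : ℝ)) * (b p.1 i * Ψ p) :=
    fun i => (hx i).1.add (hv i).1
  have j2 : ∀ i : Fin 3, Integrable fun p : E3 × E3 =>
      F p * (a p.2 i * fderiv ℝ Ψ p (EuclideanSpace.single i (1 : ℝ), 0)) +
        F p * (b p.1 i * fderiv ℝ Ψ p (0, EuclideanSpace.single i (1 : ℝ))) :=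
    fun i => (hx i).2.1.add (hv i).2.1
  rw [e1, e2]
  refine ⟨integrable_finsetSum _ fun i _ => j1 i, ?_⟩
  rw [integral_finsetSum _ fun i _ => j1 i, integral_finsetSum _ fun i _ => j2 i,
    ← Finset.sum_neg_distrib]
  refine Finset.sum_congr rfl fun i _ => ?_
  rw [integral_add (hx i).1 (hv i).1, integral_add (hx i).2.1 (hv i).2.1, (hx i).2.2, (hv i).2.2,
    neg_add]

/-- Smooth cutoffs exhausting phase space. -/
lemma exists_cutoff : ∃ (χ : ℕ → E3 × E3 → ℝ) (C : ℝ), 0 < C ∧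
    (∀ m, ContDiff ℝ 1 (χ m)) ∧ (∀ m, HasCompactSupport (χ m)) ∧ (∀ m p, 0 ≤ χ m p) ∧
    (∀ m p, χ m p ≤ 1) ∧ (∀ p, Tendsto (fun m => χ m p) atTop (𝓝 1)) ∧
    ∀ m p, ‖fderiv ℝ (χ m) p‖ ≤ C * ((m : ℝ) + 1)⁻¹ := by
  let φ : ContDiffBump (0 : E3 × E3) := ⟨1, 2, one_pos, one_lt_two⟩
  have hφ : ContDiff ℝ 1 φ := φ.contDiff
  obtain ⟨C, hC⟩ := (hφ.continuous_fderiv one_ne_zero).bounded_above_of_compact_support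
    (φ.hasCompactSupport.fderiv ℝ)
  have hC0 : 0 ≤ C := (norm_nonneg _).trans (hC 0)
  have hm : ∀ m : ℕ, ((m : ℝ) + 1)⁻¹ ≠ 0 := fun m => by positivity
  refine ⟨fun m p => φ (((m : ℝ) + 1)⁻¹ • p), C + 1, by linarith, fun m => ?_, fun m => ?_,
    fun m p => φ.nonneg, fun m p => φ.le_one, fun p => ?_, fun m p => ?_⟩
  · exact hφ.comp (contDiff_const_smul _)
  · exact φ.hasCompactSupport.comp_homeomorph (Homeomorph.smulOfNeZero _ (hm m))
  · refine tendsto_const_nhds.congr' ?_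
    filter_upwards [eventually_ge_atTop ⌈‖p‖⌉₊] with m hmp
    refine (φ.one_of_mem_closedBall ?_).symm
    rw [mem_closedBall_zero_iff, norm_smul, norm_inv, Real.norm_of_nonneg (by positivity)]
    have : ‖p‖ ≤ m := (Nat.le_ceil _).trans (by exact_mod_cast hmp)
    change _ ≤ (1 : ℝ)
    rw [inv_mul_le_iff₀ (by positivity)]
    linarith
  · have h : HasFDerivAt (fun p => φ (((m : ℝ) + 1)⁻¹ • p))
        ((fderiv ℝ φ (((m : ℝ) + 1)⁻¹ • p)).comp
          (((m : ℝ) + 1)⁻¹ • ContinuousLinearMap.id ℝ (E3 × E3))) p :=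
      HasFDerivAt.comp (g := (φ : E3 × E3 → ℝ)) p
        (hφ.differentiable one_ne_zero (((m : ℝ) + 1)⁻¹ • p)).hasFDerivAt
        (((m : ℝ) + 1)⁻¹ • ContinuousLinearMap.id ℝ (E3 × E3)).hasFDerivAt
    rw [h.fderiv, ContinuousLinearMap.comp_smul, norm_smul, ContinuousLinearMap.comp_id, norm_inv,
      Real.norm_of_nonneg (by positivity), mul_comm]
    have := hC (((m : ℝ) + 1)⁻¹ • p)
    gcongr
    linarith

lemma vhat_eq (v : E3) : vhat v = (jap v)⁻¹ • v := rfl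

lemma continuous_vhat : Continuous vhat := by
  have : Continuous fun v => (jap v)⁻¹ • v :=
    (continuous_jap.inv₀ fun v => (jap_pos v).ne').smul continuous_id
  exact this

lemma norm_vhat_le (v : E3) : ‖vhat v‖ ≤ 1 := by
  rw [vhat_eq, norm_smul, norm_inv, Real.norm_of_nonneg (jap_pos v).le, inv_mul_le_iff₀ (jap_pos v),
    mul_one]
  exact norm_le_jap v

/-- The derivative of a time dependent observable along the transport field. -/
def transD (F : ℝ → E3 → E3 → ℝ) (ψ ψ' : ℝ → E3 × E3 → ℝ) (s : ℝ) (p : E3 × E3) : ℝ :=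
  ψ' s p + fderiv ℝ (ψ s) p (vhat p.2, rvpField F s p.1)

/-- Admissible time dependent observables on `[a, b]`. -/
structure Obs (F : ℝ → E3 → E3 → ℝ) (ψ ψ' : ℝ → E3 × E3 → ℝ) (a b C : ℝ) : Prop where
  smooth : ∀ s, ContDiff ℝ 1 (ψ s)
  cont : ∀ p, Continuous fun s => ψ s p
  hasDeriv : ∀ s ∈ Ioo a b, ∀ p, HasDerivAt (fun s => ψ s p) (ψ' s p) s
  meas : Measurable fun q : ℝ × E3 × E3 => ψ q.1 q.2
  meas' : Measurable fun q : ℝ × E3 × E3 => ψ' q.1 q.2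
  le : ∀ s p, |ψ s p| ≤ C * (1 + ‖p.2‖)
  le' : ∀ s p, |ψ' s p| ≤ C * (1 + ‖p.2‖)
  leD : ∀ s p, |transD F ψ ψ' s p| ≤ C * (1 + ‖p.2‖)

namespace Sol
variable {F : ℝ → E3 → E3 → ℝ} {t z : ℝ} {n : ℕ}

/-- The localized weak formulation. -/
lemma weak_cutoff (S : Sol F t z n) {ψ ψ' : ℝ → E3 × E3 → ℝ} {a b C : ℝ}
    (O : Obs F ψ ψ' a b C) (ha : 0 ≤ a) (hab : a ≤ b) (hb : b ≤ t) {χ : E3 × E3 → ℝ}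
    (hχ : ContDiff ℝ 1 χ) (hχc : HasCompactSupport χ) :
    Integrable (fun s => ∫ p : E3 × E3, F s p.1 p.2 * (χ p * transD F ψ ψ' s p +
        ψ s p * fderiv ℝ χ p (vhat p.2, rvpField F s p.1))) (volume.restrict (Ioo a b)) ∧
    ∫ s in Ioo a b, ∫ p : E3 × E3, F s p.1 p.2 * (χ p * transD F ψ ψ' s p +
        ψ s p * fderiv ℝ χ p (vhat p.2, rvpField F s p.1)) =
      ∫ p : E3 × E3, (F b p.1 p.2 * (χ p * ψ b p) - F a p.1 p.2 * (χ p * ψ a p)) := by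
  obtain ⟨G, hGc, hG⟩ := S.deriv
  obtain ⟨CE, hCE, hE⟩ := S.exists_field_le
  have hC0 : 0 ≤ C := by
    have := (abs_nonneg _).trans (O.le 0 0)
    simpa using this
  have hz := S.hz
  have hIoo : ∀ s ∈ Ioo a b, s ∈ Ioo 0 t := fun s hs => ⟨ha.trans_lt hs.1, hs.2.trans_le hb⟩
  obtain ⟨k, hk⟩ : ∃ k : ℝ → E3 × E3 → ℝ, k = fun s p =>
    χ p * (G (s, p) (1, 0) * ψ s p + F s p.1 p.2 * ψ' s p) := ⟨_, rfl⟩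
  have hkm : Measurable fun q : ℝ × E3 × E3 => k q.1 q.2 := by
    simp only [hk]
    have h1 : Measurable fun q : ℝ × E3 × E3 => G q (1, 0) :=
      (hGc.clm_apply continuous_const).measurable
    exact (hχ.continuous.measurable.comp measurable_snd).mul
      ((h1.mul O.meas).add (S.cont.measurable.mul O.meas'))
  obtain ⟨B, hB⟩ : ∃ B : ℝ, ∀ q ∈ Icc a b ×ˢ tsupport χ, ‖G q‖ ≤ B :=
    (isCompact_Icc.prod hχc).exists_bound_of_continuousOn hGc.continuousOn
  obtain ⟨B', hB'⟩ : ∃ B' : ℝ, ∀ p ∈ tsupport χ, ‖χ p * (1 + ‖p.2‖)‖ ≤ B' :=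
    IsCompact.exists_bound_of_continuousOn hχc
      (hχ.continuous.mul (by fun_prop : Continuous fun p : E3 × E3 => 1 + ‖p.2‖)).continuousOn
  have hone : ‖((1, 0) : ℝ × E3 × E3)‖ ≤ 1 := by simp [Prod.norm_def]
  have hkb : ∀ s ∈ Icc a b, ∀ p, ‖k s p‖ ≤ (tsupport χ).indicator
      (fun _ => (|B| + z) * C * |B'|) p := by
    intro s hs p
    by_cases hp : p ∈ tsupport χ
    · rw [indicator_of_mem hp, hk]
      have g1 : |G (s, p) (1, 0)| ≤ |B| := by
        have := (G (s, p)).le_opNorm (1, 0)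
        rw [Real.norm_eq_abs] at this
        have h2 := (hB (s, p) ⟨hs, hp⟩).trans (le_abs_self B)
        calc _ ≤ ‖G (s, p)‖ * ‖((1, 0) : ℝ × E3 × E3)‖ := this
          _ ≤ |B| * 1 := by gcongr
          _ = _ := mul_one _
      have g2 := (hB' p hp).trans (le_abs_self B')
      rw [Real.norm_eq_abs, abs_mul, abs_of_pos (by positivity : (0:ℝ) < 1 + ‖p.2‖)] at g2
      have g3 : |F s p.1 p.2| ≤ z := abs_le.2 ⟨by linarith [S.nonneg s p.1 p.2], S.le s _ _⟩
      rw [Real.norm_eq_abs, abs_mul]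
      calc |χ p| * |G (s, p) (1, 0) * ψ s p + F s p.1 p.2 * ψ' s p|
          ≤ |χ p| * (|B| * (C * (1 + ‖p.2‖)) + z * (C * (1 + ‖p.2‖))) := by
            refine mul_le_mul_of_nonneg_left ?_ (abs_nonneg _)
            refine (abs_add_le _ _).trans ?_
            rw [abs_mul, abs_mul]
            exact add_le_add (mul_le_mul g1 (O.le s p) (abs_nonneg _) (abs_nonneg _))
              (mul_le_mul g3 (O.le' s p) (abs_nonneg _) (by linarith))
        _ = (|B| + z) * C * (|χ p| * (1 + ‖p.2‖)) := by ring
        _ ≤ _ := by gcongr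
    · rw [indicator_of_notMem hp, hk]
      simp [image_eq_zero_of_notMem_tsupport hp]
  have hki : Integrable (Function.uncurry k) ((volume.restrict (Ioo a b)).prod volume) := by
    have hi : Integrable ((tsupport χ).indicator (fun _ => (|B| + z) * C * |B'|)) volume :=
      (integrable_indicator_iff (isClosed_tsupport χ).measurableSet).2
        (integrableOn_const (hχc.measure_lt_top).ne)
    refine (hi.comp_snd (volume.restrict (Ioo a b))).mono' hkm.aestronglyMeasurable ?_
    have : ∀ᵐ q ∂((volume.restrict (Ioo a b)).prod (volume : Measure (E3 × E3))), q.1 ∈ Ioo a b :=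
      Measure.quasiMeasurePreserving_fst.ae (ae_restrict_mem measurableSet_Ioo)
    filter_upwards [this] with q hq
    exact hkb q.1 (Ioo_subset_Icc_self hq) q.2
  have hslice : ∀ s ∈ Ioo a b, ∫ p, k s p = ∫ p : E3 × E3, F s p.1 p.2 *
      (χ p * transD F ψ ψ' s p + ψ s p * fderiv ℝ χ p (vhat p.2, rvpField F s p.1)) := by
    intro s hs
    have hΨ : ContDiff ℝ 1 fun p => χ p * ψ s p := hχ.mul (O.smooth s)
    have hF : ∀ p : E3 × E3, HasFDerivAt (fun p : E3 × E3 => F s p.1 p.2)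
        ((G (s, p)).comp (ContinuousLinearMap.inr ℝ ℝ (E3 × E3))) p := fun p => by
      have := (hG s (hIoo s hs) p).1.comp p (hasFDerivAt_prodMk_right s p)
      exact this
    have hF' : Continuous fun p : E3 × E3 =>
        (G (s, p)).comp (ContinuousLinearMap.inr ℝ ℝ (E3 × E3)) :=
      (hGc.comp (by fun_prop : Continuous fun p : E3 × E3 => (s, p))).clm_comp continuous_const
    obtain ⟨i1, i2⟩ := integral_transport_mul hF hF' hΨ hχc.mul_right
      continuous_vhat.measurable (S.measurable_field_slice s) (C := max 1 CE)
      (fun v => (norm_vhat_le v).trans (le_max_left _ _))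
      (fun x => (hE s x).trans (le_max_right _ _))
    have hGe : ∀ p, G (s, p) (1, 0) = -((G (s, p)).comp (ContinuousLinearMap.inr ℝ ℝ (E3 × E3)))
        (vhat p.2, rvpField F s p.1) := fun p => by
      have h := (hG s (hIoo s hs) p).2
      have e : ((1, vhat p.2, rvpField F s p.1) : ℝ × E3 × E3) =
          (1, 0) + (0, (vhat p.2, rvpField F s p.1)) := by simp
      rw [e, map_add] at h
      simp only [ContinuousLinearMap.comp_apply, ContinuousLinearMap.inr_apply]
      linarith
    have i3 : Integrable fun p : E3 × E3 => F s p.1 p.2 * (χ p * ψ' s p) := by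
      have h0 : Continuous fun p : E3 × E3 => F s p.1 p.2 * χ p * (1 + ‖p.2‖) :=
        ((S.cont_slice s).mul hχ.continuous).mul (by fun_prop)
      have := h0.integrable_of_hasCompactSupport (μ := volume) (hχc.mul_left.mul_right)
      refine (this.norm.const_mul C).mono' ?_ (Eventually.of_forall fun p => ?_)
      · exact ((S.cont_slice s).aestronglyMeasurable.mul (hχ.continuous.aestronglyMeasurable.mul
          (O.meas'.comp measurable_prodMk_left).aestronglyMeasurable))
      · have h1 := O.le' s p
        simp only [Real.norm_eq_abs, abs_mul]
        rw [abs_of_pos (by positivity : (0:ℝ) < 1 + ‖p.2‖)]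
        calc |F s p.1 p.2| * (|χ p| * |ψ' s p|) ≤
            |F s p.1 p.2| * (|χ p| * (C * (1 + ‖p.2‖))) := by gcongr
          _ = _ := by ring
    have hfd : ∀ p w, fderiv ℝ (fun p => χ p * ψ s p) p w =
        χ p * fderiv ℝ (ψ s) p w + ψ s p * fderiv ℝ χ p w := fun p w => by
      have h := (hχ.differentiable one_ne_zero p).hasFDerivAt.mul
        ((O.smooth s).differentiable one_ne_zero p).hasFDerivAt
      have h' : HasFDerivAt (fun p => χ p * ψ s p) _ p := h
      rw [h'.fderiv]
      simp
    have i4 : Integrable fun p : E3 × E3 => F s p.1 p.2 *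
        fderiv ℝ (fun p => χ p * ψ s p) p (vhat p.2, rvpField F s p.1) := by
      have h0 : Continuous fun p : E3 × E3 => F s p.1 p.2 * ‖fderiv ℝ (fun p => χ p * ψ s p) p‖ :=
        (S.cont_slice s).mul (hΨ.continuous_fderiv one_ne_zero).norm
      have hcs : HasCompactSupport fun p : E3 × E3 =>
          F s p.1 p.2 * ‖fderiv ℝ (fun p => χ p * ψ s p) p‖ :=
        ((hχc.mul_right (f' := ψ s)).fderiv ℝ).norm.mul_left
      refine ((h0.integrable_of_hasCompactSupport (μ := volume) hcs).norm.const_mul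
        (max 1 CE)).mono' ?_ (Eventually.of_forall fun p => ?_)
      · have hmf : Measurable fun p : E3 × E3 => (vhat p.2, rvpField F s p.1) :=
          (continuous_vhat.measurable.comp measurable_snd).prodMk
            ((S.measurable_field_slice s).comp measurable_fst)
        refine (S.cont_slice s).aestronglyMeasurable.mul (Measurable.aestronglyMeasurable ?_)
        have hev : Continuous fun r : (E3 × E3 →L[ℝ] ℝ) × (E3 × E3) => r.1 r.2 := by fun_prop
        exact hev.measurable.comp
          ((hΨ.continuous_fderiv one_ne_zero).measurable.prodMk hmf)
      · have h1 : ‖((vhat p.2, rvpField F s p.1) : E3 × E3)‖ ≤ max 1 CE := by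
          rw [Prod.norm_def]
          exact max_le_max (norm_vhat_le _) (hE _ _)
        have h2 := (fderiv ℝ (fun p => χ p * ψ s p) p).le_opNorm (vhat p.2, rvpField F s p.1)
        rw [norm_mul, norm_mul, norm_norm]
        calc ‖F s p.1 p.2‖ * ‖fderiv ℝ (fun p => χ p * ψ s p) p (vhat p.2, rvpField F s p.1)‖
            ≤ ‖F s p.1 p.2‖ * (‖fderiv ℝ (fun p => χ p * ψ s p) p‖ * max 1 CE) := by
              gcongr
              exact h2.trans (by gcongr)
          _ = _ := by ring
    calc ∫ p, k s p = ∫ p : E3 × E3, (-(((G (s, p)).comp (ContinuousLinearMap.inr ℝ ℝ (E3 × E3)))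
          (vhat p.2, rvpField F s p.1) * (χ p * ψ s p)) + F s p.1 p.2 * (χ p * ψ' s p)) := by
          refine integral_congr_ae (Eventually.of_forall fun p => ?_)
          simp only [hk]
          rw [hGe p]
          ring
      _ = ∫ p : E3 × E3, (F s p.1 p.2 * fderiv ℝ (fun p => χ p * ψ s p) p
            (vhat p.2, rvpField F s p.1) + F s p.1 p.2 * (χ p * ψ' s p)) := by
          rw [integral_add i1.fun_neg i3, integral_neg, i2, neg_neg, integral_add i4 i3]
      _ = _ := by
          refine integral_congr_ae (Eventually.of_forall fun p => ?_)
          simp only [transD]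
          rw [hfd]
          ring
  have hFTC : ∀ p : E3 × E3, ∫ s in Ioo a b, k s p =
      F b p.1 p.2 * (χ p * ψ b p) - F a p.1 p.2 * (χ p * ψ a p) := by
    intro p
    rw [← integral_Ioc_eq_integral_Ioo, ← intervalIntegral.integral_of_le hab]
    refine intervalIntegral.integral_eq_sub_of_hasDerivAt_of_le hab
      (f := fun s => F s p.1 p.2 * (χ p * ψ s p)) ?_ ?_ ?_
    · exact ((S.cont.comp (by fun_prop : Continuous fun s : ℝ => (s, p))).mul
        (continuous_const.mul (O.cont p))).continuousOn
    · intro s hs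
      have h1 : HasDerivAt (fun s => F s p.1 p.2) (G (s, p) (1, 0)) s := by
        have := (hG s (hIoo s hs) p).1.comp_hasDerivAt s
          ((hasDerivAt_id s).prodMk (hasDerivAt_const s p))
        exact this
      have h2 := h1.mul ((O.hasDeriv s hs p).const_mul (χ p))
      have h3 : HasDerivAt (fun s => F s p.1 p.2 * (χ p * ψ s p)) _ s := h2
      refine h3.congr_deriv ?_
      simp only [hk]; ring
    · rw [intervalIntegrable_iff, uIoc_of_le hab]
      refine Integrable.mono' (integrableOn_const (C := (tsupport χ).indicator
        (fun _ => (|B| + z) * C * |B'|) p) (by simp)) ?_ ?_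
      · exact (hkm.comp (by fun_prop : Measurable fun s : ℝ => (s, p))).aestronglyMeasurable
      · filter_upwards [ae_restrict_mem measurableSet_Ioc] with s hs
        exact hkb s (Ioc_subset_Icc_self hs) p
  have hae : (fun s => ∫ p, k s p) =ᵐ[volume.restrict (Ioo a b)] fun s => ∫ p : E3 × E3,
      F s p.1 p.2 * (χ p * transD F ψ ψ' s p +
        ψ s p * fderiv ℝ χ p (vhat p.2, rvpField F s p.1)) := by
    filter_upwards [ae_restrict_mem measurableSet_Ioo] with s hs
    exact hslice s hs
  refine ⟨hki.integral_prod_left.congr hae, ?_⟩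
  rw [← integral_congr_ae hae, integral_integral_swap hki]
  exact integral_congr_ae (Eventually.of_forall hFTC)

end Sol

namespace Sol
variable {F : ℝ → E3 → E3 → ℝ} {t z : ℝ} {n : ℕ}

lemma measurable_fderiv_field (S : Sol F t z n) (s : ℝ) {φ : E3 × E3 → ℝ} (hφ : ContDiff ℝ 1 φ) :
    Measurable fun p : E3 × E3 => fderiv ℝ φ p (vhat p.2, rvpField F s p.1) := by
  have hmf : Measurable fun p : E3 × E3 => (vhat p.2, rvpField F s p.1) :=
    (continuous_vhat.measurable.comp measurable_snd).prodMk
      ((S.measurable_field_slice s).comp measurable_fst)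
  have hev : Continuous fun r : (E3 × E3 →L[ℝ] ℝ) × (E3 × E3) => r.1 r.2 := by fun_prop
  exact hev.measurable.comp ((hφ.continuous_fderiv one_ne_zero).measurable.prodMk hmf)

lemma measurable_transD (S : Sol F t z n) {ψ ψ' : ℝ → E3 × E3 → ℝ} {a b C : ℝ}
    (O : Obs F ψ ψ' a b C) (s : ℝ) : Measurable (transD F ψ ψ' s) := by
  have h : Measurable (ψ' s) := O.meas'.comp measurable_prodMk_left
  exact h.add (S.measurable_fderiv_field s (O.smooth s))

/-- The weak formulation of the transport equation. -/
lemma weak (S : Sol F t z n) {ψ ψ' : ℝ → E3 × E3 → ℝ} {a b C : ℝ}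
    (O : Obs F ψ ψ' a b C) (ha : 0 ≤ a) (hab : a ≤ b) (hb : b ≤ t) :
    IntegrableOn (fun s => ∫ p : E3 × E3, F s p.1 p.2 * transD F ψ ψ' s p) (Ioo a b) ∧
    ∫ s in Ioo a b, ∫ p : E3 × E3, F s p.1 p.2 * transD F ψ ψ' s p =
      (∫ p : E3 × E3, F b p.1 p.2 * ψ b p) - ∫ p : E3 × E3, F a p.1 p.2 * ψ a p := by
  obtain ⟨CE, hCE, hE⟩ := S.exists_field_le
  have hz := S.hz
  have hC0 : 0 ≤ C := by
    have := (abs_nonneg _).trans (O.le 0 0)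
    simpa using this
  obtain ⟨χ, Cχ, hCχ, hχs, hχc, hχ0, hχ1, hχt, hχd⟩ := exists_cutoff
  obtain ⟨A, hA⟩ : ∃ A : ℝ, A = C + C * (Cχ * max 1 CE) := ⟨_, rfl⟩
  obtain ⟨k, hk⟩ : ∃ k : ℕ → ℝ → E3 × E3 → ℝ, k = fun m s p => χ m p * transD F ψ ψ' s p +
      ψ s p * fderiv ℝ (χ m) p (vhat p.2, rvpField F s p.1) := ⟨_, rfl⟩
  have hdir : ∀ s (p : E3 × E3), ‖((vhat p.2, rvpField F s p.1) : E3 × E3)‖ ≤ max 1 CE :=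
    fun s p => by
      rw [Prod.norm_def]
      exact max_le_max (norm_vhat_le _) (hE _ _)
  have hfd : ∀ m s (p : E3 × E3), |fderiv ℝ (χ m) p (vhat p.2, rvpField F s p.1)| ≤
      Cχ * max 1 CE * ((m : ℝ) + 1)⁻¹ := fun m s p => by
    have := (fderiv ℝ (χ m) p).le_opNorm (vhat p.2, rvpField F s p.1)
    rw [Real.norm_eq_abs] at this
    calc _ ≤ _ := this
      _ ≤ (Cχ * ((m : ℝ) + 1)⁻¹) * max 1 CE := by
          have h1 := hdir s p
          have h2 := hχd m p
          gcongr
      _ = _ := by ring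
  have hkb : ∀ m s p, |k m s p| ≤ A * (1 + ‖p.2‖) := by
    intro m s p
    have h1 : ((m : ℝ) + 1)⁻¹ ≤ 1 := inv_le_one_of_one_le₀ (by linarith [m.cast_nonneg (α := ℝ)])
    have h2 : |fderiv ℝ (χ m) p (vhat p.2, rvpField F s p.1)| ≤ Cχ * max 1 CE :=
      (hfd m s p).trans (mul_le_of_le_one_right (by positivity) h1)
    rw [hk, hA]
    refine (abs_add_le _ _).trans ?_
    rw [abs_mul, abs_mul, abs_of_nonneg (hχ0 m p), add_mul]
    refine add_le_add ?_ ?_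
    · exact (mul_le_of_le_one_left (abs_nonneg _) (hχ1 m p)).trans (O.leD s p)
    · calc |ψ s p| * _ ≤ (C * (1 + ‖p.2‖)) * (Cχ * max 1 CE) :=
          mul_le_mul (O.le s p) h2 (abs_nonneg _) (by positivity)
        _ = _ := by ring
  have hkt : ∀ s p, Tendsto (fun m => k m s p) atTop (𝓝 (transD F ψ ψ' s p)) := by
    intro s p
    have h1 : Tendsto (fun m : ℕ => Cχ * max 1 CE * ((m : ℝ) + 1)⁻¹) atTop (𝓝 0) := by
      have := tendsto_one_div_add_atTop_nhds_zero_nat (𝕜 := ℝ)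
      simp only [one_div] at this
      simpa using this.const_mul (Cχ * max 1 CE)
    have h2 : Tendsto (fun m => fderiv ℝ (χ m) p (vhat p.2, rvpField F s p.1)) atTop (𝓝 0) :=
      squeeze_zero_norm (fun m => hfd m s p) h1
    have := ((hχt p).mul_const (transD F ψ ψ' s p)).add (h2.const_mul (ψ s p))
    simpa [hk] using this
  have hkm : ∀ m s, Measurable (k m s) := by
    intro m s
    have h : Measurable (ψ s) := (O.smooth s).continuous.measurable
    rw [hk]
    exact ((hχs m).continuous.measurable.mul (S.measurable_transD O s)).add
      (h.mul (S.measurable_fderiv_field s (hχs m)))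
  have hin : ∀ s, Tendsto (fun m => ∫ p : E3 × E3, F s p.1 p.2 * k m s p) atTop
      (𝓝 (∫ p : E3 × E3, F s p.1 p.2 * transD F ψ ψ' s p)) := by
    intro s
    refine tendsto_integral_of_dominated_convergence
      (fun p => F s p.1 p.2 * (A * (1 + ‖p.2‖))) (fun m => ?_) ?_ (fun m => ?_) ?_
    · exact (S.cont_slice s).aestronglyMeasurable.mul (hkm m s).aestronglyMeasurable
    · refine S.integrable_mul s (C := |A|)
        (by fun_prop : Continuous fun p : E3 × E3 => A * (1 + ‖p.2‖)).aestronglyMeasurable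
        fun p => ?_
      rw [abs_mul, abs_of_pos (by positivity : (0:ℝ) < 1 + ‖p.2‖)]
    · refine Eventually.of_forall fun p => ?_
      rw [norm_mul, Real.norm_of_nonneg (S.nonneg _ _ _)]
      exact mul_le_mul_of_nonneg_left (hkb m s p) (S.nonneg _ _ _)
    · exact Eventually.of_forall fun p => (hkt s p).const_mul _
  have hcut := fun m => S.weak_cutoff O ha hab hb (hχs m) (hχc m)
  have hcut' : ∀ m, IntegrableOn (fun s => ∫ p : E3 × E3, F s p.1 p.2 * k m s p) (Ioo a b) ∧
      ∫ s in Ioo a b, ∫ p : E3 × E3, F s p.1 p.2 * k m s p =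
      ∫ p : E3 × E3, (F b p.1 p.2 * (χ m p * ψ b p) - F a p.1 p.2 * (χ m p * ψ a p)) := by
    rw [hk]; exact hcut
  have hout := tendsto_integral_of_dominated_convergence (μ := volume.restrict (Ioo a b))
    (F := fun m s => ∫ p : E3 × E3, F s p.1 p.2 * k m s p) (fun _ => A * z)
    (fun m => (hcut' m).1.aestronglyMeasurable) (integrableOn_const (by simp))
    (fun m => Eventually.of_forall fun s => S.abs_integral_mul_le s (hkb m s))
    (Eventually.of_forall hin)
  have hend : ∀ s, Integrable fun p : E3 × E3 => F s p.1 p.2 * ψ s p := fun s =>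
    S.integrable_mul s (O.smooth s).continuous.aestronglyMeasurable (O.le s)
  have hendχ : ∀ m s, Integrable fun p : E3 × E3 => F s p.1 p.2 * (χ m p * ψ s p) := fun m s => by
    refine S.integrable_mul s ((hχs m).continuous.mul (O.smooth s).continuous).aestronglyMeasurable
      (C := C) fun p => ?_
    rw [abs_mul, abs_of_nonneg (hχ0 m p)]
    exact (mul_le_of_le_one_left (abs_nonneg _) (hχ1 m p)).trans (O.le s p)
  have hendt : ∀ s, Tendsto (fun m => ∫ p : E3 × E3, F s p.1 p.2 * (χ m p * ψ s p)) atTop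
      (𝓝 (∫ p : E3 × E3, F s p.1 p.2 * ψ s p)) := by
    intro s
    refine tendsto_integral_of_dominated_convergence
      (fun p => ‖F s p.1 p.2 * ψ s p‖) (fun m => (hendχ m s).aestronglyMeasurable) (hend s).norm
      (fun m => Eventually.of_forall fun p => ?_) (Eventually.of_forall fun p => ?_)
    · rw [mul_left_comm, norm_mul, Real.norm_of_nonneg (hχ0 m p)]
      exact mul_le_of_le_one_left (norm_nonneg _) (hχ1 m p)
    · have := ((hχt p).mul_const (ψ s p)).const_mul (F s p.1 p.2)
      simpa using this
  refine ⟨?_, ?_⟩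
  · have hmeas : AEStronglyMeasurable (fun s => ∫ p : E3 × E3, F s p.1 p.2 * transD F ψ ψ' s p)
        (volume.restrict (Ioo a b)) :=
      aestronglyMeasurable_of_tendsto_ae atTop (fun m => (hcut' m).1.aestronglyMeasurable)
        (Eventually.of_forall hin)
    have hcst : Integrable (fun _ : ℝ => C * z) (volume.restrict (Ioo a b)) :=
      integrableOn_const (by simp)
    exact hcst.mono' hmeas (Eventually.of_forall fun s => S.abs_integral_mul_le s (O.leD s))
  · refine tendsto_nhds_unique hout ?_
    have := (hendt b).sub (hendt a)
    refine this.congr fun m => ?_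
    rw [(hcut' m).2, integral_sub (hendχ m b) (hendχ m a)]

end Sol

lemma exists_rotZ_eq {a b : E3} (h : slashN a = slashN b) (h2 : a 2 = b 2) : ∃ θ, rotZ θ a = b := by
  obtain ⟨α, hα0, hα1⟩ := exists_polar a
  obtain ⟨β, hβ0, hβ1⟩ := exists_polar b
  have e0 : Real.cos β = Real.cos α * Real.cos (β - α) - Real.sin α * Real.sin (β - α) := by
    rw [← Real.cos_add]; congr 1; ring
  have e1 : Real.sin β = Real.sin (β - α) * Real.cos α + Real.cos (β - α) * Real.sin α := by
    rw [← Real.sin_add]; congr 1; ring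
  refine ⟨β - α, ?_⟩
  ext i
  fin_cases i
  · simp only [Fin.zero_eta, rotZ_zero_coord]
    rw [hβ0, hα0, hα1, h, e0]; ring
  · simp only [Fin.mk_one, rotZ_one_coord]
    rw [hβ1, hα0, hα1, h, e1]; ring
  · simpa using h2

lemma volume_angL_eq_zero : volume {p : E3 × E3 | angL p = 0} = 0 := by
  have hker : ∀ L : E3 →ₗ[ℝ] ℝ, L ≠ 0 → volume {v : E3 | L v = 0} = 0 := by
    intro L hL
    have := Measure.addHaar_submodule (volume : Measure E3) (LinearMap.ker L)
      (fun h => hL (LinearMap.ker_eq_top.1 h))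
    exact this
  have hm : MeasurableSet {p : E3 × E3 | angL p = 0} :=
    measurableSet_eq_fun continuous_angL.measurable measurable_const
  rw [Measure.volume_eq_prod, Measure.measure_prod_null hm]
  have h0 : ∀ᵐ y : E3, y 0 ≠ 0 := by
    rw [ae_iff]
    simp only [ne_eq, not_not]
    refine hker ((EuclideanSpace.proj (0 : Fin 3) : E3 →L[ℝ] ℝ) : E3 →ₗ[ℝ] ℝ) fun h => ?_
    have := LinearMap.congr_fun h (EuclideanSpace.single 0 1)
    simp at this
  filter_upwards [h0] with y hy
  refine hker ((y 0 • (EuclideanSpace.proj (1 : Fin 3) : E3 →L[ℝ] ℝ) -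
    y 1 • (EuclideanSpace.proj (0 : Fin 3) : E3 →L[ℝ] ℝ) : E3 →L[ℝ] ℝ) : E3 →ₗ[ℝ] ℝ) fun h => ?_
  have := LinearMap.congr_fun h (EuclideanSpace.single 1 1)
  simp at this
  exact hy this

namespace Sol
variable {F : ℝ → E3 → E3 → ℝ} {t z : ℝ} {n : ℕ}

lemma rho_rotZ (S : Sol F t z n) (s θ : ℝ) (y : E3) : rvpRho F s (rotZ θ y) = rvpRho F s y := by
  unfold rvpRho
  rw [← (measurePreserving_rotZ θ).integral_comp (rotIso θ).toHomeomorph.measurableEmbedding]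
  simp only [S.inv]

lemma integrable_kernel (S : Sol F t z n) (s : ℝ) (x : E3) :
    Integrable fun y => (rvpRho F s y / ‖x - y‖ ^ 3) • (x - y) := by
  obtain ⟨C, hC, h⟩ := S.exists_majF_le
  have hm : Measurable (rvpRho F s) := S.measurable_rho.measurable.comp measurable_prodMk_left
  refine ⟨((hm.div (by fun_prop)).smul (by fun_prop)).aestronglyMeasurable, ?_⟩
  refine (lintegral_mono (S.enorm_kernel_le s x)).trans_lt ?_
  rw [← S.majF_eq]
  exact (h s x).trans_lt ENNReal.ofReal_lt_top

/-- The torque of an axially symmetric field vanishes. -/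
lemma field_torque (S : Sol F t z n) (s : ℝ) (x : E3) :
    x 0 * rvpField F s x 1 - x 1 * rvpField F s x 0 = 0 := by
  obtain ⟨u, hu⟩ : ∃ u : E3, u = !₂[-x 1, x 0, 0] := ⟨_, rfl⟩
  obtain ⟨σ, hσ⟩ : ∃ σ : E3 ≃ₗᵢ[ℝ] E3, σ = (ℝ ∙ u)ᗮ.reflection := ⟨_, rfl⟩
  have hux : inner ℝ u x = 0 := by
    simp [hu, PiLp.inner_apply, Fin.sum_univ_three]; ring
  have hσx : σ x = x := by
    rw [hσ, Submodule.reflection_mem_subspace_eq_self]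
    exact Submodule.mem_orthogonal_singleton_iff_inner_right.2 hux
  have hσu : σ u = -u := by
    rw [hσ]; exact Submodule.reflection_orthogonalComplement_singleton_eq_neg u
  have hinner : ∀ y, inner ℝ u (σ y) = -inner ℝ u y := fun y => by
    have := σ.inner_map_map u y
    rw [hσu, inner_neg_left] at this
    linarith
  have h2 : ∀ y, (σ y) 2 = y 2 := fun y => by
    have he : σ (EuclideanSpace.single 2 (1 : ℝ)) = EuclideanSpace.single 2 (1 : ℝ) := by
      rw [hσ, Submodule.reflection_mem_subspace_eq_self]
      refine Submodule.mem_orthogonal_singleton_iff_inner_right.2 ?_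
      simp [hu, PiLp.inner_apply]
    have := σ.inner_map_map (EuclideanSpace.single 2 (1 : ℝ)) y
    rw [he] at this
    simpa [PiLp.inner_apply, Fin.sum_univ_three] using this
  have hsl : ∀ y, slashN (σ y) = slashN y := fun y => by
    have e1 := norm_sq_coord (σ y)
    have e2 := norm_sq_coord y
    rw [σ.norm_map, h2] at e1
    unfold slashN
    congr 1
    linarith
  have hρ : ∀ y, rvpRho F s (σ y) = rvpRho F s y := fun y => by
    obtain ⟨θ, hθ⟩ := exists_rotZ_eq (hsl y).symm (h2 y).symm
    rw [← hθ, S.rho_rotZ]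
  have hI := S.integrable_kernel s x
  have key : ∫ y, inner ℝ u ((rvpRho F s y / ‖x - y‖ ^ 3) • (x - y)) = 0 := by
    have h1 := σ.measurePreserving.integral_comp σ.toHomeomorph.measurableEmbedding
      (fun y => inner ℝ u ((rvpRho F s y / ‖x - y‖ ^ 3) • (x - y)))
    have h3 : ∀ y, inner ℝ u ((rvpRho F s (σ y) / ‖x - σ y‖ ^ 3) • (x - σ y)) =
        -inner ℝ u ((rvpRho F s y / ‖x - y‖ ^ 3) • (x - y)) := fun y => by
      have e : x - σ y = σ (x - y) := by rw [map_sub, hσx]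
      rw [hρ, e, σ.norm_map, inner_smul_right, inner_smul_right, hinner]
      ring
    simp only [h3, integral_neg] at h1
    linarith
  rw [integral_inner hI] at key
  have : inner ℝ u (rvpField F s x) = 0 := by
    rw [rvpField, inner_smul_right, key, mul_zero]
  rw [← this, hu]
  simp [PiLp.inner_apply, Fin.sum_univ_three]
  ring

lemma fderiv_angL (p : E3 × E3) (w : E3 × E3) :
    fderiv ℝ angL p w = w.1 0 * p.2 1 + p.1 0 * w.2 1 - (w.1 1 * p.2 0 + p.1 1 * w.2 0) := by
  have h1 : ∀ i : Fin 3, HasFDerivAt (fun p : E3 × E3 => p.1 i)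
      ((EuclideanSpace.proj i : E3 →L[ℝ] ℝ).comp (ContinuousLinearMap.fst ℝ E3 E3)) p := fun i =>
    ((EuclideanSpace.proj i : E3 →L[ℝ] ℝ).comp (ContinuousLinearMap.fst ℝ E3 E3)).hasFDerivAt
  have h2 : ∀ i : Fin 3, HasFDerivAt (fun p : E3 × E3 => p.2 i)
      ((EuclideanSpace.proj i : E3 →L[ℝ] ℝ).comp (ContinuousLinearMap.snd ℝ E3 E3)) p := fun i =>
    ((EuclideanSpace.proj i : E3 →L[ℝ] ℝ).comp (ContinuousLinearMap.snd ℝ E3 E3)).hasFDerivAt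
  have h : HasFDerivAt angL _ p := ((h1 0).mul (h2 1)).sub ((h1 1).mul (h2 0))
  rw [h.fderiv]
  simp
  ring

lemma contDiff_angL : ContDiff ℝ 1 angL := by
  unfold angL
  fun_prop

/-- Few particles have small angular momentum, by conservation along the flow. -/
lemma lowL_le (S : Sol F t z n)
    (initBound : ∫⁻ p, dens F 0 p * ENNReal.ofReal ((|angL p| ^ 13)⁻¹) ≤ ENNReal.ofReal z)
    {l : ℝ} (hl : 0 < l) {s : ℝ} (hs : s ∈ Icc 0 t) :
    ∫⁻ p in {p | |angL p| < l}, dens F s p ≤ ENNReal.ofReal (4 * z * l ^ 12) := by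
  have hz := S.hz
  obtain ⟨ψ, hψ⟩ : ∃ ψ : E3 × E3 → ℝ, ψ = fun p => (l ^ 12 + angL p ^ 12)⁻¹ := ⟨_, rfl⟩
  have hL12 : ∀ p, 0 ≤ angL p ^ 12 := fun p => Even.pow_nonneg (by decide) _
  have hpos : ∀ p, 0 < l ^ 12 + angL p ^ 12 := fun p => by have := hL12 p; positivity
  have hψ0 : ∀ p, 0 ≤ ψ p := fun p => by rw [hψ]; exact (inv_pos.2 (hpos p)).le
  have hsm : ContDiff ℝ 1 ψ := by
    rw [hψ]
    exact (contDiff_const.add (contDiff_angL.pow 12)).inv fun p => (hpos p).ne'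
  have hD : ∀ s p, transD F (fun _ => ψ) (fun _ _ => 0) s p = 0 := by
    intro s p
    have h1 : HasFDerivAt angL (fderiv ℝ angL p) p :=
      (contDiff_angL.differentiable one_ne_zero p).hasFDerivAt
    obtain ⟨c, h2⟩ : ∃ c : ℝ, HasFDerivAt ψ (c • fderiv ℝ angL p) p := by
      rw [hψ]
      exact ⟨_, (HasDerivAt.inv (c := fun x : ℝ => l ^ 12 + x ^ 12)
        ((hasDerivAt_pow 12 (angL p)).const_add _) (hpos p).ne').comp_hasFDerivAt p h1⟩
    have h3 : fderiv ℝ angL p (vhat p.2, rvpField F s p.1) = 0 := by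
      rw [fderiv_angL]
      have := S.field_torque s p.1
      simp only [vhat_eq, PiLp.smul_apply, smul_eq_mul]
      linear_combination this
    simp only [transD]
    rw [h2.fderiv, smul_apply, h3]
    simp
  have hb : ∀ p : E3 × E3, |ψ p| ≤ (l ^ 12)⁻¹ * (1 + ‖p.2‖) := by
    intro p
    rw [abs_of_nonneg (hψ0 p), hψ]
    have h1 : (l ^ 12 + angL p ^ 12)⁻¹ ≤ (l ^ 12)⁻¹ :=
      inv_anti₀ (by positivity) (by linarith [hL12 p])
    exact h1.trans (le_mul_of_one_le_right (by positivity) (by linarith [norm_nonneg p.2]))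
  have O : Obs F (fun _ => ψ) (fun _ _ => 0) 0 s ((l ^ 12)⁻¹) :=
    { smooth := fun _ => hsm
      cont := fun _ => continuous_const
      hasDeriv := fun s _ p => hasDerivAt_const s (ψ p)
      meas := hsm.continuous.measurable.comp measurable_snd
      meas' := measurable_const
      le := fun _ => hb
      le' := fun _ p => by rw [abs_zero]; positivity
      leD := fun s p => by rw [hD, abs_zero]; positivity }
  have hw := (S.weak O le_rfl hs.1 hs.2).2
  simp only [hD, mul_zero, integral_zero] at hw
  have hlint : ∀ s, ∫⁻ p, dens F s p * ENNReal.ofReal (ψ p) =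
      ENNReal.ofReal (∫ p : E3 × E3, F s p.1 p.2 * ψ p) := fun s => by
    rw [ofReal_integral_eq_lintegral_ofReal
      (S.integrable_mul s hsm.continuous.aestronglyMeasurable hb)
      (Eventually.of_forall fun p => mul_nonneg (S.nonneg _ _ _) (hψ0 p))]
    refine lintegral_congr fun p => ?_
    rw [dens, ENNReal.ofReal_mul (S.nonneg _ _ _)]
  have h0 : ∫⁻ p, dens F 0 p * ENNReal.ofReal (ψ p) ≤ ENNReal.ofReal z + ENNReal.ofReal z := by
    have hne : ∀ᵐ p : E3 × E3, angL p ≠ 0 := by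
      rw [ae_iff]; simpa using volume_angL_eq_zero
    calc ∫⁻ p, dens F 0 p * ENNReal.ofReal (ψ p)
        ≤ ∫⁻ p, (dens F 0 p * ENNReal.ofReal ((|angL p| ^ 13)⁻¹) +
            dens F 0 p * ENNReal.ofReal (1 + ‖p.2‖)) := by
          refine lintegral_mono_ae ?_
          filter_upwards [hne] with p hp
          rw [← mul_add, ← ENNReal.ofReal_add (by positivity) (by positivity)]
          refine mul_le_mul' le_rfl (ENNReal.ofReal_le_ofReal ?_)
          have ha : 0 < |angL p| := abs_pos.2 hp
          have h12 : angL p ^ 12 = |angL p| ^ 12 := (Even.pow_abs (by decide) _).symm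
          rw [hψ]
          have h1 : (l ^ 12 + angL p ^ 12)⁻¹ ≤ (|angL p| ^ 12)⁻¹ := by
            rw [h12]
            exact inv_anti₀ (by positivity) (by linarith [pow_pos hl 12])
          refine h1.trans ?_
          by_cases hc : |angL p| ≤ 1
          · have : (|angL p| ^ 12)⁻¹ ≤ (|angL p| ^ 13)⁻¹ :=
              inv_anti₀ (by positivity) (pow_le_pow_of_le_one ha.le hc (by norm_num))
            linarith [norm_nonneg p.2]
          · have : (|angL p| ^ 12)⁻¹ ≤ 1 :=
              inv_le_one_of_one_le₀ (one_le_pow₀ (not_le.1 hc).le)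
            have : 0 ≤ (|angL p| ^ 13)⁻¹ := by positivity
            linarith [norm_nonneg p.2]
      _ ≤ _ := by
          have hme : Measurable fun p : E3 × E3 => dens F 0 p * ENNReal.ofReal (1 + ‖p.2‖) :=
            (S.measurable_dens 0).mul (ENNReal.measurable_ofReal.comp (by fun_prop))
          rw [lintegral_add_right _ hme]
          exact add_le_add initBound (S.energy 0)
  have hcons : ∫⁻ p, dens F s p * ENNReal.ofReal (ψ p) ≤ ENNReal.ofReal (2 * z) := by
    rw [hlint] at h0 ⊢
    rw [show (∫ p : E3 × E3, F s p.1 p.2 * ψ p) = ∫ p : E3 × E3, F 0 p.1 p.2 * ψ p by linarith]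
    rwa [← ENNReal.ofReal_add (by linarith) (by linarith), ← two_mul] at h0
  have hm : MeasurableSet {p : E3 × E3 | |angL p| < l} :=
    measurableSet_lt (continuous_abs.comp continuous_angL).measurable measurable_const
  calc ∫⁻ p in {p | |angL p| < l}, dens F s p
      ≤ ∫⁻ p in {p | |angL p| < l}, ENNReal.ofReal (2 * l ^ 12) *
          (dens F s p * ENNReal.ofReal (ψ p)) := by
        refine setLIntegral_mono' hm fun p hp => ?_
        have hp' : |angL p| < l := hp
        rw [mul_left_comm, ← ENNReal.ofReal_mul (by positivity)]
        refine le_mul_of_one_le_right' ?_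
        rw [← ENNReal.ofReal_one]
        refine ENNReal.ofReal_le_ofReal ?_
        have h12 : angL p ^ 12 = |angL p| ^ 12 := (Even.pow_abs (by decide) _).symm
        have h1 : |angL p| ^ 12 ≤ l ^ 12 := pow_le_pow_left₀ (abs_nonneg _) hp'.le 12
        rw [hψ, ← div_eq_mul_inv, one_le_div (hpos p), h12]
        linarith
    _ ≤ ∫⁻ p, ENNReal.ofReal (2 * l ^ 12) * (dens F s p * ENNReal.ofReal (ψ p)) :=
        setLIntegral_le_lintegral _ _
    _ ≤ ENNReal.ofReal (2 * l ^ 12) * ENNReal.ofReal (2 * z) := by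
        rw [lintegral_const_mul' _ _ ENNReal.ofReal_ne_top]
        exact mul_le_mul' le_rfl hcons
    _ = _ := by
        rw [← ENNReal.ofReal_mul (by positivity)]
        congr 1; ring

end Sol

namespace Sol
variable {F : ℝ → E3 → E3 → ℝ} {t z : ℝ} {n : ℕ}

lemma measurable_rho_slice (S : Sol F t z n) (s : ℝ) : Measurable (rvpRho F s) :=
  S.measurable_rho.measurable.comp measurable_prodMk_left

/-- The field does nonnegative work against monotone vector fields. -/
lemma integral_field_monotone_nonneg (S : Sol F t z n) (s : ℝ) {w : E3 → E3} (hw : Measurable w)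
    (hw1 : ∀ y, ‖w y‖ ≤ 1) (hmono : ∀ x y, 0 ≤ inner ℝ (y - x) (w y - w x)) :
    0 ≤ ∫ p : E3 × E3, F s p.1 p.2 * inner ℝ (rvpField F s p.1) (w p.1) := by
  obtain ⟨C, hC, hmaj⟩ := S.exists_majF_le
  obtain ⟨CE, hCE, hE⟩ := S.exists_field_le
  have hρ := S.measurable_rho_slice s
  have hwE : Measurable fun y : E3 => (inner ℝ (rvpField F s y) (w y) : ℝ) :=
    (S.measurable_field_slice s).inner hw
  obtain ⟨K, hK⟩ : ∃ K : E3 → E3 → ℝ, K = fun y x =>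
    rvpRho F s y * inner ℝ ((rvpRho F s x / ‖y - x‖ ^ 3) • (y - x)) (w y) := ⟨_, rfl⟩
  have hKm : Measurable (Function.uncurry K) := by
    rw [hK]
    have h1 : Measurable fun q : E3 × E3 => rvpRho F s q.2 / ‖q.1 - q.2‖ ^ 3 :=
      (hρ.comp measurable_snd).div (by fun_prop)
    have h2 : Measurable fun q : E3 × E3 => (rvpRho F s q.2 / ‖q.1 - q.2‖ ^ 3) • (q.1 - q.2) :=
      h1.smul (by fun_prop)
    exact (hρ.comp measurable_fst).mul (h2.inner (hw.comp measurable_fst))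
  have hKi : Integrable (Function.uncurry K) (volume.prod volume) := by
    refine ⟨hKm.aestronglyMeasurable, ?_⟩
    rw [HasFiniteIntegral, lintegral_prod _ hKm.enorm.aemeasurable]
    have hle : ∀ y, ∫⁻ x, ‖Function.uncurry K (y, x)‖ₑ ≤
        (∫⁻ v, dens F s (y, v)) * ENNReal.ofReal C := by
      intro y
      calc ∫⁻ x, ‖Function.uncurry K (y, x)‖ₑ
          ≤ ∫⁻ x, ENNReal.ofReal (rvpRho F s y) *
              ((∫⁻ v, dens F s (x, v)) * invSq (y - x)) := by
            refine lintegral_mono fun x => ?_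
            rw [hK]
            simp only [Function.uncurry_apply_pair]
            rw [enorm_mul, Real.enorm_of_nonneg (S.rho_nonneg s y)]
            refine mul_le_mul' le_rfl (le_trans ?_ (S.enorm_kernel_le s y x))
            rw [← ofReal_norm, ← ofReal_norm]
            refine ENNReal.ofReal_le_ofReal ((norm_inner_le_norm _ _).trans ?_)
            exact mul_le_of_le_one_right (norm_nonneg _) (hw1 y)
        _ = ENNReal.ofReal (rvpRho F s y) * majF F s y := by
            rw [lintegral_const_mul' _ _ ENNReal.ofReal_ne_top, S.majF_eq]
        _ ≤ _ := mul_le_mul' (S.ofReal_rho_le s y) (hmaj s y)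
    refine (lintegral_mono hle).trans_lt ?_
    rw [lintegral_mul_const' _ _ ENNReal.ofReal_ne_top]
    refine ENNReal.mul_lt_top ?_ ENNReal.ofReal_lt_top
    rw [← lintegral_prod _ (S.measurable_dens s).aemeasurable, ← Measure.volume_eq_prod]
    have := (S.staticData s).mass_le univ
    rw [Measure.restrict_univ] at this
    exact this.trans_lt ENNReal.ofReal_lt_top
  have hsym : 0 ≤ ∫ q, Function.uncurry K q ∂(volume.prod volume) := by
    have h1 := integral_prod_swap (μ := (volume : Measure E3)) (ν := (volume : Measure E3))
      (Function.uncurry K)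
    have h2 : 0 ≤ ∫ q : E3 × E3, (Function.uncurry K q + Function.uncurry K q.swap)
        ∂(volume.prod volume) := by
      refine integral_nonneg fun q => ?_
      obtain ⟨y, x⟩ := q
      rw [hK]
      simp only [Prod.swap_prod_mk, Function.uncurry_apply_pair, inner_smul_left]
      have e : (inner ℝ (x - y) (w x) : ℝ) = -inner ℝ (y - x) (w x) := by
        rw [← neg_sub y x, inner_neg_left]
      have hm := hmono x y
      rw [inner_sub_right] at hm
      have h3 := S.rho_nonneg s x
      have h4 := S.rho_nonneg s y
      rw [e, norm_sub_rev x y]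
      simp only [conj_trivial, Pi.zero_apply]
      have : 0 ≤ rvpRho F s y * rvpRho F s x / ‖y - x‖ ^ 3 *
        (inner ℝ (y - x) (w y) - inner ℝ (y - x) (w x)) := by positivity
      refine this.trans (le_of_eq ?_)
      ring
    have hKs : Integrable (fun q : E3 × E3 => Function.uncurry K q.swap) (volume.prod volume) :=
      hKi.swap
    rw [integral_add hKi hKs] at h2
    rw [h1] at h2
    linarith
  have hFi : Integrable fun p : E3 × E3 => F s p.1 p.2 * inner ℝ (rvpField F s p.1) (w p.1) := by
    refine S.integrable_mul s (hwE.comp measurable_fst).aestronglyMeasurable (C := CE) fun p => ?_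
    refine (abs_real_inner_le_norm _ _).trans ?_
    have h1 := hE s p.1
    have h2 := hw1 p.1
    have h3 := norm_nonneg p.2
    calc _ ≤ CE * 1 := by gcongr
      _ ≤ _ := by gcongr; linarith
  rw [Measure.volume_eq_prod] at hFi ⊢
  rw [integral_prod _ hFi]
  have e : ∀ y, ∫ v, F s (y, v).1 (y, v).2 * inner ℝ (rvpField F s (y, v).1) (w (y, v).1) =
      (4 * π)⁻¹ * ∫ x, Function.uncurry K (y, x) := by
    intro y
    simp only [hK, Function.uncurry_apply_pair]
    rw [integral_mul_const, integral_const_mul]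
    have : ∫ x, (inner ℝ ((rvpRho F s x / ‖y - x‖ ^ 3) • (y - x)) (w y) : ℝ) =
        inner ℝ (∫ x, (rvpRho F s x / ‖y - x‖ ^ 3) • (y - x)) (w y) := by
      rw [real_inner_comm, ← integral_inner (S.integrable_kernel s y)]
      exact integral_congr_ae (Eventually.of_forall fun x => real_inner_comm _ _)
    rw [this]
    change rvpRho F s y * _ = _
    rw [rvpField, inner_smul_left]
    simp only [conj_trivial]
    ring
  simp only [e]
  rw [integral_const_mul, ← integral_prod _ hKi]
  positivity

/-- Integrated form of a differential inequality for an observable. -/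
lemma lintegral_le_of_transD (S : Sol F t z n) {ψ ψ' : ℝ → E3 × E3 → ℝ} {a b C C₀ : ℝ}
    (O : Obs F ψ ψ' a b C) (ha : 0 ≤ a) (hab : a ≤ b) (hb : b ≤ t)
    (h₀ : ∀ s p, |ψ s p| ≤ C₀ * (1 + ‖p.2‖)) {A B : ℝ → ℝ} (hB : Measurable B)
    (hA0 : ∀ s, 0 ≤ A s) (hB0 : ∀ s, 0 ≤ B s)
    (hAB : ∀ s ∈ Ioo a b, A s ≤ (∫ p : E3 × E3, F s p.1 p.2 * transD F ψ ψ' s p) + B s) :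
    ∫⁻ s in Ioo a b, ENNReal.ofReal (A s) ≤
      ENNReal.ofReal (2 * C₀ * z) + ∫⁻ s in Ioo a b, ENNReal.ofReal (B s) := by
  obtain ⟨hi, he⟩ := S.weak O ha hab hb
  by_cases hfin : ∫⁻ s in Ioo a b, ENNReal.ofReal (B s) = ⊤
  · rw [hfin]; simp
  have hBi : Integrable B (volume.restrict (Ioo a b)) := by
    refine ⟨hB.aestronglyMeasurable, ?_⟩
    rw [HasFiniteIntegral]
    refine lt_of_le_of_lt (lintegral_mono fun s => ?_) (lt_top_iff_ne_top.2 hfin)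
    rw [Real.enorm_of_nonneg (hB0 s)]
  have hbd := fun s => abs_le.1 (S.abs_integral_mul_le s (h₀ s))
  calc ∫⁻ s in Ioo a b, ENNReal.ofReal (A s)
      ≤ ∫⁻ s in Ioo a b, ENNReal.ofReal
          ((∫ p : E3 × E3, F s p.1 p.2 * transD F ψ ψ' s p) + B s) :=
        setLIntegral_mono' measurableSet_Ioo fun s hs => ENNReal.ofReal_le_ofReal (hAB s hs)
    _ = ENNReal.ofReal (∫ s in Ioo a b,
          ((∫ p : E3 × E3, F s p.1 p.2 * transD F ψ ψ' s p) + B s)) := by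
        have hsum : Integrable (fun s => (∫ p : E3 × E3, F s p.1 p.2 * transD F ψ ψ' s p) + B s)
            (volume.restrict (Ioo a b)) := hi.add hBi
        rw [ofReal_integral_eq_lintegral_ofReal hsum]
        filter_upwards [ae_restrict_mem measurableSet_Ioo] with s hs
        exact (hA0 s).trans (hAB s hs)
    _ ≤ _ := by
        rw [integral_add hi hBi, he]
        refine ENNReal.ofReal_add_le.trans (add_le_add (ENNReal.ofReal_le_ofReal ?_) (le_of_eq ?_))
        · linarith [(hbd b).2, (hbd a).1]
        · rw [ofReal_integral_eq_lintegral_ofReal hBi (Eventually.of_forall hB0)]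

end Sol

/-! ### Derivatives along the flow -/

/-- The horizontal inner product. -/
def hdot (x v : E3) : ℝ := x 0 * v 0 + x 1 * v 1

lemma abs_hdot_le (x v : E3) : |hdot x v| ≤ slashN x * slashN v := by
  rw [slashN, slashN, ← Real.sqrt_mul (by positivity)]
  refine Real.abs_le_sqrt ?_
  unfold hdot
  nlinarith [sq_nonneg (x 0 * v 1 - x 1 * v 0)]

lemma slashN_le_radR (η : ℝ) (x : E3) : slashN x ≤ radR η x :=
  Real.le_sqrt_of_sq_le (by nlinarith [sq_nonneg η])

lemma le_radR {η : ℝ} (x : E3) : η ≤ radR η x :=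
  Real.le_sqrt_of_sq_le (by nlinarith [sq_nonneg (slashN x)])

/-- The centrifugal acceleration. -/
def cent (η : ℝ) (x v : E3) : ℝ :=
  slashN v ^ 2 / (jap v * radR η x) - hdot x v ^ 2 / (jap v * radR η x ^ 3)

/-- The derivative of `hdot x v / radR η x` along the flow with acceleration `e`. -/
def morD (η : ℝ) (x v e : E3) : ℝ :=
  cent η x v + hdot x e / radR η x

/-- The derivative of `radV η (x, v)` along the flow with acceleration `e`. -/
def accV (η : ℝ) (x v e : E3) : ℝ :=
  morD η x v e / jap v - hdot x v / radR η x * inner ℝ v e / jap v ^ 3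

/-- The derivative of `omg q v` along the flow with acceleration `e`. -/
def omgD (q : ℝ) (v e : E3) : ℝ :=
  (2 * q + jap v) / (q + jap v) ^ 2 * inner ℝ v e

lemma hasDerivAt_coord {X : ℝ → E3} {X' : E3} {s : ℝ} (h : HasDerivAt X X' s) (i : Fin 3) :
    HasDerivAt (fun s => X s i) (X' i) s :=
  ((EuclideanSpace.proj i : E3 →L[ℝ] ℝ).hasFDerivAt.comp_hasDerivAt s h)

lemma hasDerivAt_hdot {X Y : ℝ → E3} {X' Y' : E3} {s : ℝ} (h : HasDerivAt X X' s)
    (h' : HasDerivAt Y Y' s) :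
    HasDerivAt (fun s => hdot (X s) (Y s)) (hdot X' (Y s) + hdot (X s) Y') s := by
  unfold hdot
  have := ((hasDerivAt_coord h 0).mul (hasDerivAt_coord h' 0)).add
    ((hasDerivAt_coord h 1).mul (hasDerivAt_coord h' 1))
  refine this.congr_deriv ?_
  ring

lemma radR_eq (η : ℝ) (x : E3) : radR η x = √(η ^ 2 + hdot x x) := by
  rw [radR, slashN_sq]; congr 2; unfold hdot; ring

lemma hdot_self (x : E3) : hdot x x = slashN x ^ 2 := by
  rw [slashN_sq]; unfold hdot; ring

lemma hdot_smul_left (c : ℝ) (x y : E3) : hdot (c • x) y = c * hdot x y := by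
  simp only [hdot, PiLp.smul_apply, smul_eq_mul]; ring

lemma hdot_smul_right (c : ℝ) (x y : E3) : hdot x (c • y) = c * hdot x y := by
  simp only [hdot, PiLp.smul_apply, smul_eq_mul]; ring

lemma radV_eq (η : ℝ) (p : E3 × E3) : radV η p = hdot p.1 p.2 / radR η p.1 / jap p.2 := by
  rw [radV, div_div, mul_comm (jap p.2)]; rfl

lemma hasDerivAt_jap {V : ℝ → E3} {e : E3} {s : ℝ} (h : HasDerivAt V e s) :
    HasDerivAt (fun s => jap (V s)) (inner ℝ (V s) e / jap (V s)) s := by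
  have h1 : HasDerivAt (fun s => 1 + ‖V s‖ ^ 2) (2 * inner ℝ (V s) e) s := (h.norm_sq).const_add 1
  have h2 := h1.sqrt (by positivity)
  refine h2.congr_deriv ?_
  rw [jap]
  field_simp

section curve
variable {X V : ℝ → E3} {e : E3} {s η q : ℝ}

lemma hasDerivAt_radR (hη : 0 < η) (hX : HasDerivAt X (vhat (V s)) s) :
    HasDerivAt (fun s => radR η (X s)) (radV η (X s, V s)) s := by
  have h := ((hasDerivAt_hdot hX hX).const_add (η ^ 2)).sqrt (by rw [hdot_self]; positivity)
  simp only [← radR_eq] at h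
  refine h.congr_deriv ?_
  have h1 := radR_pos hη (X s)
  have h2 := jap_pos (V s)
  rw [radV_eq, vhat_eq, hdot_smul_left, hdot_smul_right]
  have : hdot (V s) (X s) = hdot (X s) (V s) := by unfold hdot; ring
  rw [this]
  field_simp
  ring

lemma hasDerivAt_mor (hη : 0 < η) (hX : HasDerivAt X (vhat (V s)) s) (hV : HasDerivAt V e s) :
    HasDerivAt (fun s => hdot (X s) (V s) / radR η (X s)) (morD η (X s) (V s) e) s := by
  have h1 := radR_pos hη (X s)
  have h2 := jap_pos (V s)
  have h := (hasDerivAt_hdot hX hV).div (hasDerivAt_radR hη hX) h1.ne'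
  refine h.congr_deriv ?_
  rw [morD, cent, radV_eq, vhat_eq, hdot_smul_left, hdot_self]
  field_simp
  ring

lemma hasDerivAt_radV (hη : 0 < η) (hX : HasDerivAt X (vhat (V s)) s) (hV : HasDerivAt V e s) :
    HasDerivAt (fun s => radV η (X s, V s)) (accV η (X s) (V s) e) s := by
  have h1 := radR_pos hη (X s)
  have h2 := jap_pos (V s)
  simp only [radV_eq]
  refine ((hasDerivAt_mor hη hX hV).div (hasDerivAt_jap hV) h2.ne').congr_deriv ?_
  rw [accV]
  field_simp

lemma hasDerivAt_omg (hq : 0 ≤ q) (hV : HasDerivAt V e s) :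
    HasDerivAt (fun s => omg q (V s)) (omgD q (V s) e) s := by
  have h2 := jap_pos (V s)
  have h3 : 0 < q + jap (V s) := by linarith
  refine (((hasDerivAt_jap hV).pow 2).div ((hasDerivAt_jap hV).const_add q) h3.ne').congr_deriv ?_
  rw [omgD, Pi.pow_apply]
  field_simp
  ring

end curve

lemma contDiff_jap : ContDiff ℝ 1 jap := by
  unfold jap
  exact (contDiff_const.add (contDiff_norm_sq ℝ)).sqrt fun v => by positivity

lemma contDiff_hdot : ContDiff ℝ 1 fun p : E3 × E3 => hdot p.1 p.2 := by
  unfold hdot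
  fun_prop

lemma contDiff_radR {η : ℝ} (hη : 0 < η) : ContDiff ℝ 1 (radR η) := by
  have : ContDiff ℝ 1 fun x : E3 => √(η ^ 2 + hdot x x) := by
    refine ContDiff.sqrt (by unfold hdot; fun_prop) fun x => ?_
    rw [hdot_self]; positivity
  rwa [← funext fun x => radR_eq η x] at this

lemma contDiff_mor {η : ℝ} (hη : 0 < η) :
    ContDiff ℝ 1 fun p : E3 × E3 => hdot p.1 p.2 / radR η p.1 :=
  contDiff_hdot.div ((contDiff_radR hη).comp contDiff_fst) fun _ => (radR_pos hη _).ne'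

lemma contDiff_radV {η : ℝ} (hη : 0 < η) : ContDiff ℝ 1 (radV η) := by
  have : ContDiff ℝ 1 fun p : E3 × E3 => hdot p.1 p.2 / radR η p.1 / jap p.2 :=
    (contDiff_mor hη).div (contDiff_jap.comp contDiff_snd) fun _ => (jap_pos _).ne'
  rwa [← funext fun p => radV_eq η p] at this

lemma contDiff_omg {q : ℝ} (hq : 0 ≤ q) : ContDiff ℝ 1 (omg q) := by
  unfold omg
  exact (contDiff_jap.pow 2).div (contDiff_const.add contDiff_jap) fun v => by
    linarith [jap_pos v]

/-- Directional derivatives from derivatives along straight lines in the direction of the flow. -/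
lemma fderiv_eq_of_curve {ψ : E3 × E3 → ℝ} {p : E3 × E3} {e : E3} {d : ℝ}
    (hψ : DifferentiableAt ℝ ψ p)
    (h : ∀ X V : ℝ → E3, X 0 = p.1 → V 0 = p.2 → HasDerivAt X (vhat (V 0)) 0 → HasDerivAt V e 0 →
      HasDerivAt (fun s => ψ (X s, V s)) d 0) :
    fderiv ℝ ψ p (vhat p.2, e) = d := by
  have hl : ∀ a b : E3, HasDerivAt (fun s : ℝ => a + s • b) b 0 := fun a b => by
    simpa using ((hasDerivAt_id (0 : ℝ)).smul_const b).const_add a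
  have h1 := h (fun s => p.1 + s • vhat p.2) (fun s => p.2 + s • e) (by simp) (by simp)
    (by simpa using hl p.1 (vhat p.2)) (hl p.2 e)
  have h2 := (hl p.1 (vhat p.2)).prodMk (hl p.2 e)
  have h3 : HasFDerivAt ψ (fderiv ℝ ψ p)
      ((fun s : ℝ => (p.1 + s • vhat p.2, p.2 + s • e)) 0) := by
    simpa using hψ.hasFDerivAt
  exact (h3.comp_hasDerivAt (0 : ℝ) h2).unique h1

/-! ### Size estimates -/

lemma abs_inner_le_jap (v e : E3) : |(inner ℝ v e : ℝ)| ≤ jap v * ‖e‖ :=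
  (abs_real_inner_le_norm _ _).trans (by gcongr; exact norm_le_jap v)

lemma abs_hdot_div_le {η : ℝ} (hη : 0 < η) (x v : E3) : |hdot x v / radR η x| ≤ slashN v := by
  rw [abs_div, abs_of_pos (radR_pos hη x), div_le_iff₀ (radR_pos hη x), mul_comm]
  exact (abs_hdot_le x v).trans (by
    gcongr
    · exact slashN_nonneg v
    · exact slashN_le_radR η x)

lemma abs_radV_le {η : ℝ} (hη : 0 < η) (p : E3 × E3) : |radV η p| ≤ 1 := by
  rw [radV_eq, abs_div, abs_of_pos (jap_pos p.2), div_le_one (jap_pos _)]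
  exact (abs_hdot_div_le hη _ _).trans (slashN_le_jap _)

lemma le_cent {η : ℝ} (hη : 0 < η) (x v : E3) :
    slashN v ^ 2 / jap v * (η ^ 2 / radR η x ^ 3) ≤ cent η x v := by
  have h1 := radR_pos hη x
  have h2 := jap_pos v
  have h3 := radR_sq η x
  have h4 : hdot x v ^ 2 ≤ slashN x ^ 2 * slashN v ^ 2 := by
    rw [← mul_pow]; exact sq_le_sq' (by linarith [(abs_le.1 (abs_hdot_le x v)).1])
      (abs_le.1 (abs_hdot_le x v)).2
  have e : cent η x v = (slashN v ^ 2 * radR η x ^ 2 - hdot x v ^ 2) / (jap v * radR η x ^ 3) := by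
    rw [cent]; field_simp
  have e' : slashN v ^ 2 / jap v * (η ^ 2 / radR η x ^ 3) =
      (slashN v ^ 2 * η ^ 2) / (jap v * radR η x ^ 3) := by field_simp
  rw [e, e', h3]
  gcongr
  linarith

lemma cent_nonneg {η : ℝ} (hη : 0 < η) (x v : E3) : 0 ≤ cent η x v :=
  le_trans (by have := radR_pos hη x; have := jap_pos v; positivity) (le_cent hη x v)

lemma cent_le {η : ℝ} (hη : 0 < η) (x v : E3) :
    cent η x v ≤ slashN v ^ 2 / jap v * (1 / radR η x) := by
  have h1 := radR_pos hη x
  have h2 := jap_pos v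
  have : 0 ≤ hdot x v ^ 2 / (jap v * radR η x ^ 3) := by positivity
  have e : slashN v ^ 2 / jap v * (1 / radR η x) = slashN v ^ 2 / (jap v * radR η x) := by
    field_simp
  rw [cent, e]; linarith

lemma cent_le_jap {η : ℝ} (hη : 0 < η) (x v : E3) : cent η x v ≤ jap v / η := by
  refine (cent_le hη x v).trans ?_
  have h1 := radR_pos hη x
  have h2 := jap_pos v
  have h3 : slashN v ^ 2 / jap v ≤ jap v := by
    rw [div_le_iff₀ h2, ← sq]
    exact pow_le_pow_left₀ (slashN_nonneg v) (slashN_le_jap v) 2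
  calc _ ≤ jap v * (1 / η) := by
        gcongr
        exact le_radR x
    _ = _ := by ring

/-- The part of `accV` due to the force. -/
lemma abs_accV_sub_le {η : ℝ} (hη : 0 < η) (x v e : E3) :
    |accV η x v e - cent η x v / jap v| ≤ 2 * ‖e‖ / jap v := by
  have h2 := jap_pos v
  have e1 : accV η x v e - cent η x v / jap v =
      hdot x e / radR η x / jap v - hdot x v / radR η x * inner ℝ v e / jap v ^ 3 := by
    rw [accV, morD]; ring
  rw [e1]
  have h3 : |hdot x e / radR η x / jap v| ≤ ‖e‖ / jap v := by
    rw [abs_div, abs_of_pos h2]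
    gcongr
    exact (abs_hdot_div_le hη x e).trans (slashN_le_norm e)
  have h4 : |hdot x v / radR η x * inner ℝ v e / jap v ^ 3| ≤ ‖e‖ / jap v := by
    rw [abs_div, abs_mul, abs_of_pos (by positivity : 0 < jap v ^ 3)]
    calc _ ≤ jap v * (jap v * ‖e‖) / jap v ^ 3 := by
          gcongr
          · exact (abs_hdot_div_le hη x v).trans (slashN_le_jap v)
          · exact abs_inner_le_jap v e
      _ = _ := by field_simp
  calc _ ≤ ‖e‖ / jap v + ‖e‖ / jap v := (abs_sub _ _).trans (add_le_add h3 h4)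
    _ = _ := by ring

lemma abs_accV_le {η : ℝ} (hη : 0 < η) (x v e : E3) :
    |accV η x v e| ≤ 1 / η + 2 * ‖e‖ := by
  have h1 := abs_accV_sub_le hη x v e
  have h2 := jap_pos v
  have h3 := cent_nonneg hη x v
  have h4 : cent η x v / jap v ≤ 1 / η := by
    rw [div_le_iff₀ h2]
    exact (cent_le_jap hη x v).trans (le_of_eq (by ring))
  have h5 : 2 * ‖e‖ / jap v ≤ 2 * ‖e‖ := div_le_self (by positivity) (one_le_jap v)
  have h6 : 0 ≤ cent η x v / jap v := by positivity
  rw [abs_le] at h1 ⊢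
  constructor <;> linarith [h1.1, h1.2]

lemma omg_le_jap {q : ℝ} (hq : 0 < q) (v : E3) : omg q v ≤ jap v := by
  have h := jap_pos v
  rw [omg, div_le_iff₀ (by positivity)]
  nlinarith

lemma omg_le_div {q : ℝ} (hq : 0 < q) (v : E3) : omg q v ≤ jap v ^ 2 / q := by
  have h := jap_pos v
  rw [omg]
  gcongr
  linarith

lemma abs_omgD_le {q : ℝ} (hq : 0 < q) (v e : E3) : |omgD q v e| ≤ 2 * jap v * ‖e‖ / q := by
  have h := jap_pos v
  have h2 : (2 * q + jap v) / (q + jap v) ^ 2 ≤ 2 / q := by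
    rw [div_le_div_iff₀ (by positivity) hq]
    nlinarith
  rw [omgD, abs_mul, abs_of_nonneg (by positivity)]
  calc _ ≤ 2 / q * (jap v * ‖e‖) := by
        gcongr
        exact abs_inner_le_jap v e
    _ = _ := by ring

namespace Sol
variable {F : ℝ → E3 → E3 → ℝ} {t z : ℝ} {n : ℕ}

lemma lintegral_dens_mul_ofReal (S : Sol F t z n) (s : ℝ) {φ : E3 × E3 → ℝ} (hφ : Measurable φ)
    (hφ0 : ∀ p, 0 ≤ φ p) {C : ℝ} (hC : ∀ p, φ p ≤ C * (1 + ‖p.2‖)) :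
    ∫⁻ p, dens F s p * ENNReal.ofReal (φ p) =
      ENNReal.ofReal (∫ p : E3 × E3, F s p.1 p.2 * φ p) := by
  rw [ofReal_integral_eq_lintegral_ofReal
    (S.integrable_mul s hφ.aestronglyMeasurable (C := C) fun p => by
      rw [abs_of_nonneg (hφ0 p)]; exact hC p)
    (Eventually.of_forall fun p => mul_nonneg (S.nonneg _ _ _) (hφ0 p))]
  refine lintegral_congr fun p => ?_
  rw [dens, ENNReal.ofReal_mul (S.nonneg _ _ _)]

/-- A pointwise differential inequality along the flow yields an integrated inequality. -/
lemma lintegral_weak_le (S : Sol F t z n) {ψ ψ' : ℝ → E3 × E3 → ℝ} {a b C C₀ : ℝ}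
    (O : Obs F ψ ψ' a b C) (ha : 0 ≤ a) (hab : a ≤ b) (hb : b ≤ t)
    (h₀ : ∀ s p, |ψ s p| ≤ C₀ * (1 + ‖p.2‖)) {α β κ : ℝ → E3 × E3 → ℝ} {C' : ℝ}
    (hα : ∀ s, Measurable (α s)) (hβ : Measurable fun q : ℝ × E3 × E3 => β q.1 q.2)
    (hκ : ∀ s, Measurable (κ s))
    (hα0 : ∀ s p, 0 ≤ α s p) (hβ0 : ∀ s p, 0 ≤ β s p)
    (hα' : ∀ s p, α s p ≤ C' * (1 + ‖p.2‖)) (hβ' : ∀ s p, β s p ≤ C' * (1 + ‖p.2‖))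
    (hκ' : ∀ s p, |κ s p| ≤ C' * (1 + ‖p.2‖))
    (hκ0 : ∀ s, 0 ≤ ∫ p : E3 × E3, F s p.1 p.2 * κ s p)
    (hle : ∀ s ∈ Ioo a b, ∀ p, α s p + κ s p ≤ transD F ψ ψ' s p + β s p) :
    ∫⁻ s in Ioo a b, ∫⁻ p, dens F s p * ENNReal.ofReal (α s p) ≤
      ENNReal.ofReal (2 * C₀ * z) +
        ∫⁻ s in Ioo a b, ∫⁻ p, dens F s p * ENNReal.ofReal (β s p) := by
  have hβs : ∀ s, Measurable (β s) := fun s => hβ.comp measurable_prodMk_left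
  simp_rw [fun s => S.lintegral_dens_mul_ofReal s (hα s) (hα0 s) (hα' s),
    fun s => S.lintegral_dens_mul_ofReal s (hβs s) (hβ0 s) (hβ' s)]
  have iα : ∀ s, Integrable fun p : E3 × E3 => F s p.1 p.2 * α s p := fun s =>
    S.integrable_mul s (hα s).aestronglyMeasurable (C := C') fun p => by
      rw [abs_of_nonneg (hα0 s p)]; exact hα' s p
  have iβ : ∀ s, Integrable fun p : E3 × E3 => F s p.1 p.2 * β s p := fun s =>
    S.integrable_mul s (hβs s).aestronglyMeasurable (C := C') fun p => by
      rw [abs_of_nonneg (hβ0 s p)]; exact hβ' s p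
  have iκ : ∀ s, Integrable fun p : E3 × E3 => F s p.1 p.2 * κ s p := fun s =>
    S.integrable_mul s (hκ s).aestronglyMeasurable (hκ' s)
  have iD : ∀ s, Integrable fun p : E3 × E3 => F s p.1 p.2 * transD F ψ ψ' s p := fun s =>
    S.integrable_mul s (S.measurable_transD O s).aestronglyMeasurable (O.leD s)
  refine S.lintegral_le_of_transD O ha hab hb h₀ ?_
    (fun s => integral_nonneg fun p => mul_nonneg (S.nonneg _ _ _) (hα0 s p))
    (fun s => integral_nonneg fun p => mul_nonneg (S.nonneg _ _ _) (hβ0 s p)) fun s hs => ?_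
  · have : StronglyMeasurable (Function.uncurry fun (s : ℝ) (p : E3 × E3) =>
        F s p.1 p.2 * β s p) := (S.cont.measurable.mul hβ).stronglyMeasurable
    exact this.integral_prod_right.measurable
  · rw [← integral_add (iD s) (iβ s)]
    calc _ ≤ (∫ p : E3 × E3, F s p.1 p.2 * α s p) + ∫ p : E3 × E3, F s p.1 p.2 * κ s p := by
          linarith [hκ0 s]
      _ = ∫ p : E3 × E3, (F s p.1 p.2 * α s p + F s p.1 p.2 * κ s p) :=
          (integral_add (iα s) (iκ s)).symm
      _ ≤ _ := by
          refine integral_mono ((iα s).add (iκ s)) ((iD s).add (iβ s)) fun p => ?_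
          have := mul_le_mul_of_nonneg_left (hle s hs p) (S.nonneg s p.1 p.2)
          beta_reduce
          linarith

end Sol

/-! ### The cylindrical Morawetz estimate -/

/-- The regularised horizontal unit vector field. -/
def horW (r : ℝ) (x : E3) : E3 := !₂[x 0 / radR r x, x 1 / radR r x, 0]

lemma inner_horW (r : ℝ) (e x : E3) : inner ℝ e (horW r x) = hdot x e / radR r x := by
  rw [PiLp.inner_apply, Fin.sum_univ_three]
  simp [horW, hdot]
  ring

lemma norm_horW_le {r : ℝ} (hr : 0 < r) (x : E3) : ‖horW r x‖ ≤ 1 := by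
  have h := radR_pos hr x
  rw [← sq_le_one_iff₀ (norm_nonneg _), norm_sq_coord]
  have e : horW r x 0 ^ 2 + horW r x 1 ^ 2 + horW r x 2 ^ 2 = slashN x ^ 2 / radR r x ^ 2 := by
    simp [horW, slashN_sq]
    ring
  rw [e, div_le_one (by positivity)]
  exact pow_le_pow_left₀ (slashN_nonneg x) (slashN_le_radR r x) 2

lemma horW_monotone {r : ℝ} (hr : 0 < r) (x y : E3) :
    0 ≤ (inner ℝ (y - x) (horW r y - horW r x) : ℝ) := by
  have hx := radR_pos hr x
  have hy := radR_pos hr y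
  have hsx := radR_sq r x
  have hsy := radR_sq r y
  have e : (inner ℝ (y - x) (horW r y - horW r x) : ℝ) =
      (slashN y ^ 2 - hdot x y) / radR r y + (slashN x ^ 2 - hdot x y) / radR r x := by
    rw [inner_sub_right, inner_horW, inner_horW, ← hdot_self, ← hdot_self]
    simp only [hdot, PiLp.sub_apply]
    ring
  have h1 : hdot x y + r ^ 2 ≤ radR r x * radR r y := by
    refine le_of_abs_le (abs_le_of_sq_le_sq ?_ (by positivity))
    rw [mul_pow, hsx, hsy]
    have := abs_le.1 (abs_hdot_le x y)
    have h2 : hdot x y ^ 2 ≤ slashN x ^ 2 * slashN y ^ 2 := by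
      rw [← mul_pow]; exact sq_le_sq' (by linarith [this.1]) this.2
    have h3 : 2 * hdot x y ≤ slashN x ^ 2 + slashN y ^ 2 := by
      nlinarith [this.2, sq_nonneg (slashN x - slashN y)]
    nlinarith [sq_nonneg r]
  rw [e]
  have h2 : slashN y ^ 2 - hdot x y ≥ radR r y ^ 2 - radR r x * radR r y := by linarith
  have h3 : slashN x ^ 2 - hdot x y ≥ radR r x ^ 2 - radR r x * radR r y := by linarith
  calc (0 : ℝ) = (radR r y ^ 2 - radR r x * radR r y) / radR r y +
        (radR r x ^ 2 - radR r x * radR r y) / radR r x := by field_simp; ring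
    _ ≤ _ := by gcongr

lemma continuous_horW {r : ℝ} (hr : 0 < r) : Continuous (horW r) := by
  unfold horW
  have h := continuous_radR r
  have h0 := fun x => (radR_pos hr x).ne'
  refine (PiLp.continuous_toLp 2 _).comp (continuous_pi fun i => ?_)
  fin_cases i
  · exact Continuous.div (by fun_prop) h h0
  · exact Continuous.div (by fun_prop) h h0
  · exact continuous_const

lemma lintegral_sum_scales {g : ℝ × E3 × E3 → ℝ≥0∞} (hg : Measurable g) {J : ℕ}
    {c : ℕ → ℝ × E3 × E3 → ℝ} (hc : ∀ j, Measurable (c j)) (hc0 : ∀ j q, 0 ≤ c j q) {a b : ℝ}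
    {B : ℝ≥0∞} (h : ∀ j, ∫⁻ s in Ioo a b, ∫⁻ p, g (s, p) * ENNReal.ofReal (c j (s, p)) ≤ B) :
    ∫⁻ s in Ioo a b, ∫⁻ p, g (s, p) * ENNReal.ofReal (∑ j ∈ Finset.range (J + 1), c j (s, p)) ≤
      ENNReal.ofReal (J + 1) * B := by
  have hm : ∀ j, Measurable fun q => g q * ENNReal.ofReal (c j q) := fun j =>
    hg.mul (ENNReal.measurable_ofReal.comp (hc j))
  have hms : ∀ j s, Measurable fun p => g (s, p) * ENNReal.ofReal (c j (s, p)) := fun j s =>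
    (hm j).comp measurable_prodMk_left
  have hmi : ∀ j, Measurable fun s => ∫⁻ p, g (s, p) * ENNReal.ofReal (c j (s, p)) := fun j =>
    (hm j).lintegral_prod_right'
  have e : ∀ s, ∫⁻ p, g (s, p) * ENNReal.ofReal (∑ j ∈ Finset.range (J + 1), c j (s, p)) =
      ∑ j ∈ Finset.range (J + 1), ∫⁻ p, g (s, p) * ENNReal.ofReal (c j (s, p)) := by
    intro s
    rw [← lintegral_finsetSum _ fun j _ => hms j s]
    refine lintegral_congr fun p => ?_
    rw [ENNReal.ofReal_sum_of_nonneg fun j _ => hc0 j _, Finset.mul_sum]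
  simp_rw [e]
  rw [lintegral_finsetSum _ fun j _ => hmi j]
  refine (Finset.sum_le_card_nsmul _ _ B fun j _ => h j).trans (le_of_eq ?_)
  rw [Finset.card_range, nsmul_eq_mul, ← ENNReal.ofReal_natCast]
  push_cast
  rfl

namespace Sol
variable {F : ℝ → E3 → E3 → ℝ} {t z : ℝ} {n : ℕ}

lemma transD_mor {r : ℝ} (hr : 0 < r) (s : ℝ) (p : E3 × E3) :
    transD F (fun _ p => hdot p.1 p.2 / radR r p.1) (fun _ _ => 0) s p =
      morD r p.1 p.2 (rvpField F s p.1) := by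
  rw [transD, zero_add]
  refine fderiv_eq_of_curve ((contDiff_mor hr).differentiable one_ne_zero p) ?_
  intro X V hX hV hX' hV'
  have := hasDerivAt_mor hr hX' hV'
  rwa [hX, hV] at this

/-- The Morawetz estimate at a single scale. -/
lemma morawetz_scale (S : Sol F t z n) (ht : 0 ≤ t) {r : ℝ} (hr : 0 < r) :
    ∫⁻ s in Ioo 0 t, ∫⁻ p, dens F s p * ENNReal.ofReal
      (slashN p.2 ^ 2 / jap p.2 * (r ^ 2 / radR r p.1 ^ 3)) ≤ ENNReal.ofReal (2 * z) := by
  obtain ⟨CE, hCE, hE⟩ := S.exists_field_le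
  have hj : ∀ p : E3 × E3, jap p.2 ≤ 1 + ‖p.2‖ := fun p => jap_le p.2
  have hψ : ∀ p : E3 × E3, |hdot p.1 p.2 / radR r p.1| ≤ 1 + ‖p.2‖ := fun p =>
    ((abs_hdot_div_le hr _ _).trans (slashN_le_norm _)).trans (by linarith)
  have hEb : ∀ s (p : E3 × E3), |hdot p.1 (rvpField F s p.1) / radR r p.1| ≤ CE := fun s p =>
    ((abs_hdot_div_le hr _ _).trans (slashN_le_norm _)).trans (hE s p.1)
  obtain ⟨C, hC⟩ : ∃ C : ℝ, C = 1 + 1 / r + CE := ⟨_, rfl⟩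
  have hr' : 0 < 1 / r := by positivity
  have hle : ∀ (a : ℝ) (p : E3 × E3), a ≤ 1 / r * jap p.2 + CE → a ≤ C * (1 + ‖p.2‖) := by
    intro a p ha
    have := norm_nonneg p.2
    have := hj p
    rw [hC]
    nlinarith
  have O : Obs F (fun _ p => hdot p.1 p.2 / radR r p.1) (fun _ _ => 0) 0 t C := by
    refine ⟨fun _ => contDiff_mor hr, fun p => continuous_const, fun s _ p => hasDerivAt_const _ _,
      ((contDiff_mor hr).continuous.measurable).comp measurable_snd, measurable_const,
      fun s p => (hψ p).trans ?_, fun s p => ?_, fun s p => ?_⟩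
    · have := norm_nonneg p.2
      rw [hC]; nlinarith
    · have := norm_nonneg p.2
      rw [hC, abs_zero]; positivity
    · rw [transD_mor hr]
      refine hle _ p ?_
      rw [morD]
      have h1 := cent_nonneg hr p.1 p.2
      have h2 := cent_le_jap hr p.1 p.2
      refine (abs_add_le _ _).trans (add_le_add ?_ (hEb s p))
      rw [abs_of_nonneg h1]
      exact h2.trans (le_of_eq (by ring))
  have hm : Measurable fun p : E3 × E3 => slashN p.2 ^ 2 / jap p.2 * (r ^ 2 / radR r p.1 ^ 3) := by
    have h1 := continuous_slashN.measurable
    have h2 := continuous_jap.measurable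
    have h3 := (continuous_radR r).measurable
    fun_prop
  have hpos : ∀ p : E3 × E3, 0 ≤ slashN p.2 ^ 2 / jap p.2 * (r ^ 2 / radR r p.1 ^ 3) := fun p => by
    have := radR_pos hr p.1; have := jap_pos p.2; positivity
  have hκm : ∀ s, Measurable fun p : E3 × E3 =>
      (inner ℝ (rvpField F s p.1) (horW r p.1) : ℝ) := fun s =>
    ((S.measurable_field_slice s).comp measurable_fst).inner
      ((continuous_horW hr).measurable.comp measurable_fst)
  have key := S.lintegral_weak_le O le_rfl ht le_rfl (C₀ := 1) (C' := C)
    (fun s p => by rw [one_mul]; exact hψ p) (fun _ => hm) (β := fun _ _ => 0) measurable_const hκm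
    (fun _ => hpos) (fun _ _ => le_rfl) (fun s p => hle _ p ?_) (fun s p => hle _ p ?_)
    (fun s p => hle _ p ?_)
    (fun s => S.integral_field_monotone_nonneg s (continuous_horW hr).measurable
      (norm_horW_le hr) (horW_monotone hr)) fun s _ p => ?_
  · simpa using key
  · have h1 := cent_le_jap hr p.1 p.2
    have h2 := le_cent hr p.1 p.2
    have : jap p.2 / r = 1 / r * jap p.2 := by ring
    linarith
  · have := jap_pos p.2; positivity
  · rw [inner_horW]
    have := jap_pos p.2
    exact (hEb s p).trans (le_add_of_nonneg_left (by positivity))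
  · rw [transD_mor hr, inner_horW, add_zero, morD]
    exact add_le_add_left (le_cent hr _ _) _

/-- The Morawetz estimate. -/
lemma lintegral_morI_le (S : Sol F t z n) (ht : 0 ≤ t) {η : ℝ} (hη : 0 < η) (J : ℕ) :
    ∫⁻ s in Ioo 0 t, morI (dens F s) η J ≤ ENNReal.ofReal (2 * z * (J + 1)) := by
  have hz : 0 ≤ z := by linarith [S.hz]
  have h := lintegral_sum_scales (J := J) (a := 0) (b := t) S.measurable_dens_uncurry
    (c := fun j q => slashN q.2.2 ^ 2 / jap q.2.2 *
      ((2 ^ j * η) ^ 2 / radR (2 ^ j * η) q.2.1 ^ 3)) (fun j => ?_) (fun j q => ?_)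
    (fun j => S.morawetz_scale ht (by positivity : 0 < 2 ^ j * η))
  · refine le_trans (le_of_eq ?_) (h.trans (le_of_eq ?_))
    · refine lintegral_congr fun s => lintegral_congr fun p => ?_
      rw [← Finset.mul_sum]
      rfl
    · rw [← ENNReal.ofReal_mul (by positivity), mul_comm]
  · have h1 := continuous_slashN.measurable
    have h2 := continuous_jap.measurable
    have h3 := (continuous_radR (2 ^ j * η)).measurable
    fun_prop
  · have := radR_pos (by positivity : 0 < 2 ^ j * η) q.2.1
    have := jap_pos q.2.2
    positivity

end Sol

/-- A solution together with the choice of dyadic scales and the smallness of the low angular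
momentum part of the initial datum. -/
structure Setup (F : ℝ → E3 → E3 → ℝ) (t z : ℝ) (n : ℕ) (η : ℝ) (J : ℕ) : Prop
    extends Sol F t z n where
  initBound : ∫⁻ p, dens F 0 p * ENNReal.ofReal ((|angL p| ^ 13)⁻¹) ≤ ENNReal.ofReal z
  hη : 0 < η
  hJ : 2 ^ J * η = 1
  hηz : η ≤ (z ^ 20000)⁻¹
  log_le : Real.log (1 + z ^ 6003) ≤ z
  ht : 0 ≤ t
  htz : t ≤ z
  hJz : (J : ℝ) + 1 ≤ z

/-- A characteristic curve on `[0, t]`, extended continuously to all times. -/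
structure Charac (F : ℝ → E3 → E3 → ℝ) (t : ℝ) (X V : ℝ → E3) : Prop where
  contX : Continuous X
  contV : Continuous V
  derivX : ∀ s ∈ Ioo 0 t, HasDerivAt X (vhat (V s)) s
  derivV : ∀ s ∈ Ioo 0 t, HasDerivAt V (rvpField F s (X s)) s

/-- An upper bound for the field at a given time, uniform in space. -/
def fieldB (F : ℝ → E3 → E3 → ℝ) (z η : ℝ) (J : ℕ) (s : ℝ) : ℝ≥0∞ :=
  ENNReal.ofReal (z ^ 6010) * (1 + morI (dens F s) η J)

lemma continuous_hdot : Continuous fun p : E3 × E3 => hdot p.1 p.2 := contDiff_hdot.continuous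

lemma measurable_accV (η : ℝ) : Measurable fun q : E3 × E3 × E3 => accV η q.1 q.2.1 q.2.2 := by
  have h1 := continuous_slashN.measurable
  have h2 := continuous_jap.measurable
  have h3 := (continuous_radR η).measurable
  have h4 : Measurable fun q : E3 × E3 × E3 => hdot q.1 q.2.1 :=
    continuous_hdot.measurable.comp (measurable_fst.prodMk measurable_snd.fst)
  have h5 : Measurable fun q : E3 × E3 × E3 => hdot q.1 q.2.2 :=
    continuous_hdot.measurable.comp (measurable_fst.prodMk measurable_snd.snd)
  have h6 : Measurable fun q : E3 × E3 × E3 => (inner ℝ q.2.1 q.2.2 : ℝ) :=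
    measurable_snd.fst.inner measurable_snd.snd
  unfold accV morD cent
  fun_prop

namespace Setup
variable {F : ℝ → E3 → E3 → ℝ} {t z : ℝ} {n : ℕ} {η : ℝ} {J : ℕ}

lemma fieldData (S : Setup F t z n η J) {s : ℝ} (hs : s ∈ Icc 0 t) :
    FieldData (dens F s) z η J n where
  toStaticData := S.staticData s
  hz := S.hz
  hη := S.hη
  hJ := S.hJ
  hηz := S.hηz
  hn := S.hn
  decay := S.decay
  log_le := S.log_le
  lowL := by
    have hz : 0 < z := by linarith [S.hz]
    have := S.lowL_le S.initBound (by positivity : 0 < (z ^ 1560)⁻¹) hs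
    refine this.trans (le_of_eq ?_)
    rw [inv_pow, ← pow_mul]
  moment := S.moment s

lemma enorm_field_le_fieldB (S : Setup F t z n η J) {s : ℝ} (hs : s ∈ Icc 0 t) (x : E3) :
    ‖rvpField F s x‖ₑ ≤ fieldB F z η J s :=
  (S.enorm_field_le s x).trans ((S.fieldData hs).field_le x)

lemma lintegral_one_add_morI_le (S : Setup F t z n η J) {a b : ℝ} (ha : 0 ≤ a) (hb : b ≤ t) :
    ∫⁻ s in Ioo a b, (1 + morI (dens F s) η J) ≤ ENNReal.ofReal (z ^ 3) := by
  have hz := S.hz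
  have hz0 : 0 ≤ z := by linarith
  refine (lintegral_mono_set (Ioo_subset_Ioo ha hb)).trans ?_
  rw [lintegral_add_left measurable_const, setLIntegral_one, Real.volume_Ioo]
  refine (add_le_add_right (S.lintegral_morI_le S.ht S.hη J) _).trans ?_
  have := S.ht
  have := S.hJz
  rw [← ENNReal.ofReal_add (by linarith) (by positivity)]
  refine ENNReal.ofReal_le_ofReal ?_
  have h1 : 2 * z * (J + 1) ≤ 2 * z * z := by gcongr
  have h2 := S.htz
  have h3 : 10 ^ 6 * (z * z) ≤ z * (z * z) := by gcongr
  have h4 : 1 * z ≤ z * z := by gcongr; linarith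
  rw [show z ^ 3 = z * (z * z) by ring]
  linarith

lemma lintegral_fieldB_le (S : Setup F t z n η J) {a b : ℝ} (ha : 0 ≤ a) (hb : b ≤ t) :
    ∫⁻ s in Ioo a b, fieldB F z η J s ≤ ENNReal.ofReal (z ^ 6013) := by
  have hz := S.hz
  have hz0 : 0 ≤ z := by linarith
  unfold fieldB
  rw [lintegral_const_mul' _ _ ENNReal.ofReal_ne_top]
  refine (mul_le_mul_right (S.lintegral_one_add_morI_le ha hb) _).trans (le_of_eq ?_)
  rw [← ENNReal.ofReal_mul (by positivity), ← pow_add]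

variable {X V : ℝ → E3}

lemma measurable_field_charac (S : Setup F t z n η J) (K : Charac F t X V) :
    Measurable fun s => rvpField F s (X s) :=
  S.measurable_field.comp (measurable_id.prodMk K.contX.measurable)

lemma measurable_accV_charac (S : Setup F t z n η J) (K : Charac F t X V) :
    Measurable fun s => accV η (X s) (V s) (rvpField F s (X s)) := by
  have h : Measurable fun s => (X s, V s, rvpField F s (X s)) :=
    K.contX.measurable.prodMk (K.contV.measurable.prodMk (S.measurable_field_charac K))
  have h' := (measurable_accV η).comp h
  simpa only [Function.comp_def] using h'

/-- The total variation of the radial velocity of a fast particle is controlled. -/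
lemma lintegral_accV_le (S : Setup F t z n η J) (K : Charac F t X V) {a b : ℝ} (ha : 0 ≤ a)
    (hab : a ≤ b) (hb : b ≤ t) (hfast : ∀ s ∈ Ioo a b, z ^ 5999 / 2 ≤ ‖V s‖) :
    ∫⁻ s in Ioo a b, ENNReal.ofReal |accV η (X s) (V s) (rvpField F s (X s))| ≤
      ENNReal.ofReal (z ^ 15) := by
  have hz := S.hz
  have hz0 : 0 < z := by linarith
  have hη := S.hη
  obtain ⟨CE, hCE, hE⟩ := S.exists_field_le
  obtain ⟨N', hN'⟩ : ∃ N' : ℝ → ℝ, N' = fun s => accV η (X s) (V s) (rvpField F s (X s)) :=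
    ⟨_, rfl⟩
  have hm : Measurable N' := by rw [hN']; exact S.measurable_accV_charac K
  have hbd : ∀ s, ‖N' s‖ ≤ 1 / η + 2 * CE := fun s => by
    rw [hN', Real.norm_eq_abs]
    have := abs_accV_le hη (X s) (V s) (rvpField F s (X s))
    linarith [hE s (X s)]
  have hfin : volume (Ioo a b) ≠ ⊤ := by simp
  have hi : IntegrableOn N' (Ioo a b) := Measure.integrableOn_of_bounded hfin
    hm.aestronglyMeasurable (Eventually.of_forall hbd)
  have hint : ∫ s in Ioo a b, N' s ≤ 2 := by
    have h1 := intervalIntegral.integral_eq_sub_of_hasDerivAt_of_le hab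
      (f := fun s => radV η (X s, V s)) (f' := N')
      ((continuous_radV hη).comp (K.contX.prodMk K.contV)).continuousOn
      (fun s hs => by
        have hs' : s ∈ Ioo 0 t := ⟨ha.trans_lt hs.1, hs.2.trans_le hb⟩
        rw [hN']
        exact hasDerivAt_radV hη (K.derivX s hs') (K.derivV s hs'))
      ((intervalIntegrable_iff_integrableOn_Ioo_of_le hab).2 hi)
    rw [intervalIntegral.integral_of_le hab, integral_Ioc_eq_integral_Ioo] at h1
    rw [h1]
    linarith [(abs_le.1 (abs_radV_le hη (X b, V b))).2, (abs_le.1 (abs_radV_le hη (X a, V a))).1]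
  have hEm := (S.measurable_field_charac K).norm
  have hEi : IntegrableOn (fun s => 8 / z ^ 5999 * ‖rvpField F s (X s)‖) (Ioo a b) :=
    Measure.integrableOn_of_bounded (M := 8 / z ^ 5999 * CE) hfin
      (hEm.const_mul _).aestronglyMeasurable (Eventually.of_forall fun s => by
        rw [norm_mul, Real.norm_of_nonneg (by positivity), norm_norm]
        gcongr
        exact hE s _)
  have hpt : ∀ s ∈ Ioo a b, |N' s| ≤ N' s + 8 / z ^ 5999 * ‖rvpField F s (X s)‖ := by
    intro s hs
    have h1 := abs_accV_sub_le hη (X s) (V s) (rvpField F s (X s))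
    have h2 := cent_nonneg hη (X s) (V s)
    have h3 := jap_pos (V s)
    have h4 : z ^ 5999 / 2 ≤ jap (V s) := (hfast s hs).trans (norm_le_jap _)
    have h5 : 0 ≤ cent η (X s) (V s) / jap (V s) := by positivity
    have h6 : 2 * ‖rvpField F s (X s)‖ / jap (V s) ≤ 4 / z ^ 5999 * ‖rvpField F s (X s)‖ := by
      calc _ ≤ 2 * ‖rvpField F s (X s)‖ / (z ^ 5999 / 2) := by gcongr
        _ = _ := by field_simp; ring
    have h7 : 8 / z ^ 5999 * ‖rvpField F s (X s)‖ = 2 * (4 / z ^ 5999 * ‖rvpField F s (X s)‖) := by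
      ring
    have h8 : N' s = accV η (X s) (V s) (rvpField F s (X s)) := by rw [hN']
    rw [← h8, abs_le] at h1
    rw [h7, abs_le]
    constructor <;> linarith [h1.1, h1.2]
  have hsum : IntegrableOn (fun s => N' s + 8 / z ^ 5999 * ‖rvpField F s (X s)‖) (Ioo a b) :=
    hi.add hEi
  have h9 : ∫⁻ s in Ioo a b, ENNReal.ofReal (8 / z ^ 5999 * ‖rvpField F s (X s)‖) ≤
      ENNReal.ofReal (8 * z ^ 14) := by
    calc _ ≤ ∫⁻ s in Ioo a b, ENNReal.ofReal (8 / z ^ 5999) * fieldB F z η J s := by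
          refine setLIntegral_mono' measurableSet_Ioo fun s hs => ?_
          rw [ENNReal.ofReal_mul (by positivity), ofReal_norm]
          exact mul_le_mul_right (S.enorm_field_le_fieldB
            ⟨ha.trans hs.1.le, hs.2.le.trans hb⟩ _) _
      _ ≤ ENNReal.ofReal (8 / z ^ 5999) * ENNReal.ofReal (z ^ 6013) := by
          rw [lintegral_const_mul' _ _ ENNReal.ofReal_ne_top]
          exact mul_le_mul_right (S.lintegral_fieldB_le ha hb) _
      _ = _ := by
          rw [← ENNReal.ofReal_mul (by positivity)]
          congr 1
          rw [show z ^ 6013 = z ^ 5999 * z ^ 14 by rw [← pow_add]]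
          field_simp
  have h10 : ∫ s in Ioo a b, N' s + 8 / z ^ 5999 * ‖rvpField F s (X s)‖ ≤ 2 + 8 * z ^ 14 := by
    rw [integral_add hi hEi]
    refine add_le_add hint ?_
    rw [← ofReal_integral_eq_lintegral_ofReal hEi (Eventually.of_forall fun s => by
      beta_reduce; positivity)] at h9
    exact (ENNReal.ofReal_le_ofReal_iff (by positivity)).1 h9
  calc _ ≤ ∫⁻ s in Ioo a b, ENNReal.ofReal (N' s + 8 / z ^ 5999 * ‖rvpField F s (X s)‖) := by
        refine setLIntegral_mono' measurableSet_Ioo fun s hs => ENNReal.ofReal_le_ofReal ?_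
        have := hpt s hs
        rw [hN'] at this ⊢
        exact this
    _ = ENNReal.ofReal (∫ s in Ioo a b, N' s + 8 / z ^ 5999 * ‖rvpField F s (X s)‖) := by
        rw [ofReal_integral_eq_lintegral_ofReal hsum]
        filter_upwards [ae_restrict_mem measurableSet_Ioo] with s hs
        exact (abs_nonneg _).trans (hpt s hs)
    _ ≤ _ := by
        refine ENNReal.ofReal_le_ofReal (h10.trans ?_)
        have : 1 ≤ z ^ 14 := one_le_pow₀ (by linarith)
        rw [pow_succ]
        nlinarith

end Setup

/-! ### The radial virial estimate -/

/-- A smooth bounded increasing function at scale `r`. -/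
def satU (r u : ℝ) : ℝ := u / √(r ^ 2 + u ^ 2)

/-- The derivative of `satU r`. -/
def satD (r u : ℝ) : ℝ := r ^ 2 / √(r ^ 2 + u ^ 2) ^ 3

lemma hasDerivAt_satU {r : ℝ} (hr : 0 < r) (u : ℝ) : HasDerivAt (satU r) (satD r u) u := by
  have h0 : 0 < r ^ 2 + u ^ 2 := by positivity
  have h1 : HasDerivAt (fun u : ℝ => √(r ^ 2 + u ^ 2)) (2 * u / (2 * √(r ^ 2 + u ^ 2))) u := by
    have := ((hasDerivAt_pow 2 u).const_add (r ^ 2)).sqrt h0.ne'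
    simpa using this
  have hs := Real.sq_sqrt h0.le
  have hp := Real.sqrt_pos.2 h0
  refine ((hasDerivAt_id u).div h1 hp.ne').congr_deriv ?_
  rw [satD]
  simp only [id]
  field_simp
  linarith

lemma contDiff_satU {r : ℝ} (hr : 0 < r) : ContDiff ℝ 1 (satU r) := by
  unfold satU
  exact contDiff_id.div (ContDiff.sqrt (by fun_prop) fun u => by positivity) fun u =>
    (Real.sqrt_pos.2 (by positivity)).ne'

lemma abs_satU_le {r : ℝ} (hr : 0 < r) (u : ℝ) : |satU r u| ≤ 1 := by
  have hp : 0 < √(r ^ 2 + u ^ 2) := Real.sqrt_pos.2 (by positivity)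
  rw [satU, abs_div, abs_of_pos hp, div_le_one hp]
  exact Real.abs_le_sqrt (by nlinarith)

lemma satD_nonneg (r u : ℝ) : 0 ≤ satD r u := by unfold satD; positivity

lemma satD_le {r : ℝ} (hr : 0 < r) (u : ℝ) : satD r u ≤ 1 / r := by
  have hp : r ≤ √(r ^ 2 + u ^ 2) := Real.le_sqrt_of_sq_le (by nlinarith [sq_nonneg u])
  rw [satD]
  calc _ ≤ r ^ 2 / r ^ 3 := by gcongr
    _ = _ := by field_simp

lemma measurable_satD (r : ℝ) : Measurable (satD r) := by unfold satD; fun_prop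

/-- The radial virial observable relative to a moving particle. -/
def virObs (η q r : ℝ) (X V : ℝ → E3) (s : ℝ) (p : E3 × E3) : ℝ :=
  omg q p.2 * (radV η p - radV η (X s, V s)) * satU r (radR η p.1 - radR η (X s))

/-- The time derivative of the virial observable. -/
def virObs' (F : ℝ → E3 → E3 → ℝ) (η q r : ℝ) (X V : ℝ → E3) (s : ℝ) (p : E3 × E3) : ℝ :=
  omg q p.2 * (-accV η (X s) (V s) (rvpField F s (X s))) * satU r (radR η p.1 - radR η (X s)) +
    omg q p.2 * (radV η p - radV η (X s, V s)) *
      (satD r (radR η p.1 - radR η (X s)) * (-radV η (X s, V s)))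

/-- The error terms in the virial identity. -/
def virErr (F : ℝ → E3 → E3 → ℝ) (η q : ℝ) (X V : ℝ → E3) (s : ℝ) (p : E3 × E3) : ℝ :=
  6 * jap p.2 * ‖rvpField F s p.1‖ / q + slashN p.2 ^ 2 / jap p.2 * (1 / radR η p.1) +
    jap p.2 * |accV η (X s) (V s) (rvpField F s (X s))|

section
variable {F : ℝ → E3 → E3 → ℝ} {η q r : ℝ} {X V : ℝ → E3}

lemma contDiff_virObs (hη : 0 < η) (hq : 0 ≤ q) (hr : 0 < r) (s : ℝ) :
    ContDiff ℝ 1 (virObs η q r X V s) := by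
  unfold virObs
  exact (((contDiff_omg hq).comp contDiff_snd).mul ((contDiff_radV hη).sub contDiff_const)).mul
    ((contDiff_satU hr).comp (((contDiff_radR hη).comp contDiff_fst).sub contDiff_const))

lemma abs_virObs_le (hη : 0 < η) (hq : 0 < q) (hr : 0 < r) (s : ℝ) (p : E3 × E3) :
    |virObs η q r X V s p| ≤ 2 * jap p.2 := by
  have h1 := abs_le.1 (abs_radV_le hη p)
  have h2 := abs_le.1 (abs_radV_le hη (X s, V s))
  have h3 : |radV η p - radV η (X s, V s)| ≤ 2 := abs_le.2 ⟨by linarith [h1.1, h2.2],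
    by linarith [h1.2, h2.1]⟩
  have h4 := jap_pos p.2
  rw [virObs, abs_mul, abs_mul, abs_of_nonneg (omg_nonneg hq.le _)]
  calc _ ≤ jap p.2 * 2 * 1 := by
        gcongr
        · exact omg_le_jap hq _
        · exact abs_satU_le hr _
    _ = _ := by ring

lemma transD_virObs (hη : 0 < η) (hq : 0 < q) (hr : 0 < r) (s : ℝ) (p : E3 × E3) :
    transD F (virObs η q r X V) (virObs' F η q r X V) s p =
      (omgD q p.2 (rvpField F s p.1) * (radV η p - radV η (X s, V s)) +
        omg q p.2 * (accV η p.1 p.2 (rvpField F s p.1) -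
          accV η (X s) (V s) (rvpField F s (X s)))) * satU r (radR η p.1 - radR η (X s)) +
      omg q p.2 * (radV η p - radV η (X s, V s)) ^ 2 * satD r (radR η p.1 - radR η (X s)) := by
  have hd : fderiv ℝ (virObs η q r X V s) p (vhat p.2, rvpField F s p.1) =
      (omgD q p.2 (rvpField F s p.1) * (radV η p - radV η (X s, V s)) +
        omg q p.2 * accV η p.1 p.2 (rvpField F s p.1)) * satU r (radR η p.1 - radR η (X s)) +
      omg q p.2 * (radV η p - radV η (X s, V s)) *
        (satD r (radR η p.1 - radR η (X s)) * radV η p) := by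
    refine fderiv_eq_of_curve ((contDiff_virObs hη hq.le hr s).differentiable one_ne_zero p) ?_
    intro Y W hY hW hY' hW'
    have h1 := hasDerivAt_omg (q := q) hq.le hW'
    have h2 := (hasDerivAt_radV hη hY' hW').sub_const (radV η (X s, V s))
    have h3 := (hasDerivAt_radR hη hY').sub_const (radR η (X s))
    have h4 := (hasDerivAt_satU hr _).comp (0 : ℝ) h3
    have h5 := (h1.mul h2).mul h4
    refine h5.congr_deriv ?_
    simp only [Pi.mul_apply, Function.comp_apply, hY, hW]
  rw [transD, hd, virObs']
  ring

lemma le_transD_virObs (hη : 0 < η) (hq : 0 < q) (hr : 0 < r) (s : ℝ) (p : E3 × E3) :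
    |transD F (virObs η q r X V) (virObs' F η q r X V) s p -
      omg q p.2 * (radV η p - radV η (X s, V s)) ^ 2 * satD r (radR η p.1 - radR η (X s))| ≤
        virErr F η q X V s p := by
  have h1 := abs_le.1 (abs_radV_le hη p)
  have h2 := abs_le.1 (abs_radV_le hη (X s, V s))
  have h3 : |radV η p - radV η (X s, V s)| ≤ 2 := abs_le.2 ⟨by linarith [h1.1, h2.2],
    by linarith [h1.2, h2.1]⟩
  have h4 := jap_pos p.2
  have h5 := omg_nonneg hq.le p.2
  have hc := cent_nonneg hη p.1 p.2
  rw [transD_virObs hη hq hr, add_sub_cancel_right, abs_mul]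
  refine (mul_le_of_le_one_right (abs_nonneg _) (abs_satU_le hr _)).trans ?_
  refine (abs_add_le _ _).trans ?_
  rw [abs_mul, abs_mul, abs_of_nonneg h5]
  have h6 : |omgD q p.2 (rvpField F s p.1)| * |radV η p - radV η (X s, V s)| ≤
      2 * jap p.2 * ‖rvpField F s p.1‖ / q * 2 := by
    gcongr
    exact abs_omgD_le hq _ _
  have h7 : omg q p.2 * |accV η (X s) (V s) (rvpField F s (X s))| ≤
      jap p.2 * |accV η (X s) (V s) (rvpField F s (X s))| := by
    gcongr
    exact omg_le_jap hq _
  have h8 : omg q p.2 * |accV η p.1 p.2 (rvpField F s p.1)| ≤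
      slashN p.2 ^ 2 / jap p.2 * (1 / radR η p.1) + 2 * jap p.2 * ‖rvpField F s p.1‖ / q := by
    have g1 : |accV η p.1 p.2 (rvpField F s p.1)| ≤
        cent η p.1 p.2 / jap p.2 + 2 * ‖rvpField F s p.1‖ / jap p.2 := by
      have := abs_le.1 (abs_accV_sub_le hη p.1 p.2 (rvpField F s p.1))
      have h0 : 0 ≤ cent η p.1 p.2 / jap p.2 := by positivity
      rw [abs_le]
      constructor <;> linarith [this.1, this.2]
    have g2 : omg q p.2 * (cent η p.1 p.2 / jap p.2) ≤
        slashN p.2 ^ 2 / jap p.2 * (1 / radR η p.1) := by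
      calc _ ≤ jap p.2 * (cent η p.1 p.2 / jap p.2) := by
            gcongr
            exact omg_le_jap hq _
        _ = cent η p.1 p.2 := by field_simp
        _ ≤ _ := cent_le hη _ _
    have g3 : omg q p.2 * (2 * ‖rvpField F s p.1‖ / jap p.2) ≤
        2 * jap p.2 * ‖rvpField F s p.1‖ / q := by
      calc _ ≤ jap p.2 ^ 2 / q * (2 * ‖rvpField F s p.1‖ / jap p.2) := by
            gcongr
            exact omg_le_div hq _
        _ = _ := by field_simp
    calc _ ≤ omg q p.2 *
          (cent η p.1 p.2 / jap p.2 + 2 * ‖rvpField F s p.1‖ / jap p.2) := by gcongr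
      _ ≤ _ := by rw [mul_add]; exact add_le_add g2 g3
  have h9 : omg q p.2 * |accV η p.1 p.2 (rvpField F s p.1) -
      accV η (X s) (V s) (rvpField F s (X s))| ≤
      omg q p.2 * |accV η p.1 p.2 (rvpField F s p.1)| +
        omg q p.2 * |accV η (X s) (V s) (rvpField F s (X s))| := by
    rw [← mul_add]
    gcongr
    exact abs_sub _ _
  have e : 6 * jap p.2 * ‖rvpField F s p.1‖ / q = 2 * jap p.2 * ‖rvpField F s p.1‖ / q * 2 +
      2 * jap p.2 * ‖rvpField F s p.1‖ / q := by ring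
  rw [virErr, e]
  linarith

lemma virErr_nonneg (hη : 0 < η) (hq : 0 < q) (s : ℝ) (p : E3 × E3) :
    0 ≤ virErr F η q X V s p := by
  have := jap_pos p.2
  have := radR_pos hη p.1
  unfold virErr
  positivity

lemma virErr_le (hη : 0 < η) (hq : 0 < q) {CE : ℝ} (hE : ∀ s x, ‖rvpField F s x‖ ≤ CE) (s : ℝ)
    (p : E3 × E3) : virErr F η q X V s p ≤ (6 * CE / q + 2 / η + 2 * CE) * jap p.2 := by
  have h4 := jap_pos p.2
  have h1 : 6 * jap p.2 * ‖rvpField F s p.1‖ / q ≤ 6 * jap p.2 * CE / q := by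
    gcongr
    exact hE _ _
  have h2 : slashN p.2 ^ 2 / jap p.2 * (1 / radR η p.1) ≤ jap p.2 * (1 / η) := by
    have hR := radR_pos hη p.1
    gcongr
    · rw [div_le_iff₀ h4, ← sq]
      exact pow_le_pow_left₀ (slashN_nonneg _) (slashN_le_jap _) 2
    · exact le_radR _
  have h3 : |accV η (X s) (V s) (rvpField F s (X s))| ≤ 1 / η + 2 * CE :=
    (abs_accV_le hη _ _ _).trans (by linarith [hE s (X s)])
  calc virErr F η q X V s p ≤ 6 * jap p.2 * CE / q + jap p.2 * (1 / η) +
        jap p.2 * (1 / η + 2 * CE) := by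
        unfold virErr
        gcongr
    _ = _ := by ring

end

namespace Setup
variable {F : ℝ → E3 → E3 → ℝ} {t z : ℝ} {n : ℕ} {η : ℝ} {J : ℕ} {X V : ℝ → E3}

lemma measurable_virErr (S : Setup F t z n η J) (K : Charac F t X V) (q : ℝ) :
    Measurable fun w : ℝ × E3 × E3 => virErr F η q X V w.1 w.2 := by
  have h1 := continuous_slashN.measurable
  have h2 := continuous_jap.measurable
  have h3 := (continuous_radR η).measurable
  have h4 : Measurable fun w : ℝ × E3 × E3 => ‖rvpField F w.1 w.2.1‖ :=
    (S.measurable_field.comp (measurable_fst.prodMk measurable_snd.fst)).norm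
  have h5 : Measurable fun w : ℝ × E3 × E3 =>
      |accV η (X w.1) (V w.1) (rvpField F w.1 (X w.1))| := by
    have := (S.measurable_accV_charac K).comp (measurable_fst : Measurable fun w : ℝ × E3 × E3 => w.1)
    exact this.norm
  unfold virErr
  fun_prop

lemma obs_virObs (S : Setup F t z n η J) (K : Charac F t X V) {q r : ℝ} (hq : 0 < q) (hr : 0 < r)
    {a b : ℝ} (ha : 0 ≤ a) (hb : b ≤ t) :
    ∃ C, Obs F (virObs η q r X V) (virObs' F η q r X V) a b C := by
  obtain ⟨CE, hCE, hE⟩ := S.exists_field_le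
  have hη := S.hη
  have hN : Continuous fun s => radV η (X s, V s) :=
    (continuous_radV hη).comp (K.contX.prodMk K.contV)
  have hR : Continuous fun s => radR η (X s) := (continuous_radR η).comp K.contX
  obtain ⟨A, hA⟩ : ∃ A : ℝ, A = 1 / η + 2 * CE := ⟨_, rfl⟩
  have hA0 : 0 < A := by rw [hA]; positivity
  have hacc : ∀ s, |accV η (X s) (V s) (rvpField F s (X s))| ≤ A := fun s =>
    (abs_accV_le hη _ _ _).trans (by rw [hA]; linarith [hE s (X s)])
  have hrr : 0 < 1 / r := by positivity
  obtain ⟨C, hC⟩ : ∃ C : ℝ, C = 2 + A + 4 * (1 / r) + (6 * CE / q + 2 / η + 2 * CE) := ⟨_, rfl⟩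
  have hC1 : 0 < 6 * CE / q + 2 / η + 2 * CE := by positivity
  have up : ∀ (c y : ℝ) (p : E3 × E3), y ≤ c * jap p.2 → c ≤ C → y ≤ C * (1 + ‖p.2‖) := by
    intro c y p h1 h2
    have h3 := jap_pos p.2
    have hC0 : 0 < C := by rw [hC]; positivity
    exact h1.trans ((mul_le_mul_of_nonneg_right h2 h3.le).trans
      (mul_le_mul_of_nonneg_left (jap_le p.2) hC0.le))
  have hdiff : ∀ s (p : E3 × E3), |radV η p - radV η (X s, V s)| ≤ 2 := fun s p => by
    have h1 := abs_le.1 (abs_radV_le hη p)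
    have h2 := abs_le.1 (abs_radV_le hη (X s, V s))
    exact abs_le.2 ⟨by linarith [h1.1, h2.2], by linarith [h1.2, h2.1]⟩
  have hsq : ∀ s (p : E3 × E3), (radV η p - radV η (X s, V s)) ^ 2 ≤ 2 ^ 2 := fun s p => by
    rw [← sq_abs]
    exact pow_le_pow_left₀ (abs_nonneg _) (hdiff s p) 2
  refine ⟨C, fun s => contDiff_virObs hη hq.le hr s, fun p => ?_, fun s hs p => ?_, ?_, ?_,
    fun s p => up 2 _ p (abs_virObs_le hη hq hr s p) (by rw [hC]; linarith),
    fun s p => up (A + 2 * (1 / r)) _ p ?_ (by rw [hC]; linarith),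
    fun s p => up (4 * (1 / r) + (6 * CE / q + 2 / η + 2 * CE)) _ p ?_ (by rw [hC]; linarith)⟩
  · unfold virObs
    exact (continuous_const.mul (continuous_const.sub hN)).mul
      ((contDiff_satU hr).continuous.comp (continuous_const.sub hR))
  · have hs' : s ∈ Ioo 0 t := ⟨ha.trans_lt hs.1, hs.2.trans_le hb⟩
    have h1 := ((hasDerivAt_radV hη (K.derivX s hs') (K.derivV s hs')).const_sub
      (radV η p)).const_mul (omg q p.2)
    have h2 := (hasDerivAt_radR hη (K.derivX s hs')).const_sub (radR η p.1)
    have h3 := (hasDerivAt_satU hr _).comp s h2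
    exact h1.mul h3
  · unfold virObs
    have h1 := (continuous_omg hq.le).measurable
    have h2 := (continuous_radV hη).measurable
    have h3 := (contDiff_satU hr).continuous.measurable
    have h4 := (continuous_radR η).measurable
    have hXm := K.contX.measurable
    have hVm := K.contV.measurable
    fun_prop
  · unfold virObs'
    have h1 := (continuous_omg hq.le).measurable
    have h2 := (continuous_radV hη).measurable
    have h3 := (contDiff_satU hr).continuous.measurable
    have h4 := (continuous_radR η).measurable
    have hXm := K.contX.measurable
    have hVm := K.contV.measurable
    have h7 : Measurable fun w : ℝ × E3 × E3 =>
        accV η (X w.1) (V w.1) (rvpField F w.1 (X w.1)) :=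
      (S.measurable_accV_charac K).comp measurable_fst
    have h8 := measurable_satD r
    have h9 : Measurable fun w : ℝ × E3 × E3 => omg q w.2.2 *
        -accV η (X w.1) (V w.1) (rvpField F w.1 (X w.1)) :=
      (by fun_prop : Measurable fun w : ℝ × E3 × E3 => omg q w.2.2).mul h7.neg
    have h10 : Measurable fun w : ℝ × E3 × E3 => satU r (radR η w.2.1 - radR η (X w.1)) := by
      fun_prop
    refine (h9.mul h10).add ?_
    fun_prop
  · have h3 := jap_pos p.2
    have h5 := omg_nonneg hq.le p.2
    have h6 := satD_nonneg r (radR η p.1 - radR η (X s))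
    rw [virObs']
    refine (abs_add_le _ _).trans ?_
    rw [abs_mul, abs_mul, abs_mul, abs_mul, abs_mul, abs_neg, abs_neg, abs_of_nonneg h5,
      abs_of_nonneg h6]
    calc _ ≤ jap p.2 * A * 1 + jap p.2 * 2 * (1 / r * 1) := by
          gcongr
          · exact omg_le_jap hq _
          · exact hacc s
          · exact abs_satU_le hr _
          · exact omg_le_jap hq _
          · exact hdiff s p
          · exact satD_le hr _
          · exact abs_radV_le hη _
      _ = _ := by ring
  · have h3 := jap_pos p.2
    have h5 := omg_nonneg hq.le p.2
    have h6 := satD_nonneg r (radR η p.1 - radR η (X s))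
    have h1 := (le_transD_virObs (F := F) (X := X) (V := V) hη hq hr s p).trans
      (virErr_le hη hq hE s p)
    have h2 : omg q p.2 * (radV η p - radV η (X s, V s)) ^ 2 *
        satD r (radR η p.1 - radR η (X s)) ≤ jap p.2 * 2 ^ 2 * (1 / r) := by
      exact mul_le_mul (mul_le_mul (omg_le_jap hq _) (hsq s p) (sq_nonneg _) h3.le)
        (satD_le hr _) h6 (by positivity)
    have h7 : 0 ≤ omg q p.2 * (radV η p - radV η (X s, V s)) ^ 2 *
        satD r (radR η p.1 - radR η (X s)) := by positivity
    have h8 := abs_le.1 h1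
    have h9 : (4 * (1 / r) + (6 * CE / q + 2 / η + 2 * CE)) * jap p.2 =
      jap p.2 * 2 ^ 2 * (1 / r) + (6 * CE / q + 2 / η + 2 * CE) * jap p.2 := by ring
    rw [h9, abs_le]
    constructor <;> linarith [h8.1, h8.2]

lemma lintegral_virErr_slice_le (S : Setup F t z n η J) (X V : ℝ → E3) {s : ℝ}
    (hs : s ∈ Icc 0 t) :
    ∫⁻ p, dens F s p * ENNReal.ofReal (virErr F η (z ^ 6003) X V s p) ≤
      ENNReal.ofReal z * (ENNReal.ofReal (6 / z ^ 6003) * fieldB F z η J s +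
        ENNReal.ofReal |accV η (X s) (V s) (rvpField F s (X s))|) +
      ENNReal.ofReal (8 * z) * (1 + morI (dens F s) η J) := by
  have hz := S.hz
  have hz0 : 0 < z := by linarith
  have hη := S.hη
  obtain ⟨A, hA⟩ : ∃ A : ℝ, A = |accV η (X s) (V s) (rvpField F s (X s))| := ⟨_, rfl⟩
  have hA0 : 0 ≤ A := by rw [hA]; positivity
  obtain ⟨K, hK⟩ : ∃ K : ℝ≥0∞, K = ENNReal.ofReal (6 / z ^ 6003) * fieldB F z η J s +
    ENNReal.ofReal A + 1 := ⟨_, rfl⟩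
  have hpt : ∀ p, dens F s p * ENNReal.ofReal (virErr F η (z ^ 6003) X V s p) ≤
      dens F s p * ENNReal.ofReal (1 + ‖p.2‖) * K + 8 * (dens F s p *
        ENNReal.ofReal (slashN p.2 ^ 2 / jap p.2 * scaleSum η J (slashN p.1))) := by
    intro p
    have h4 := jap_pos p.2
    have hsc := scaleSum_nonneg η J (slashN p.1)
    have h1 : virErr F η (z ^ 6003) X V s p ≤
        (1 + ‖p.2‖) * (6 / z ^ 6003 * ‖rvpField F s p.1‖ + A + 1) +
          8 * (slashN p.2 ^ 2 / jap p.2 * scaleSum η J (slashN p.1)) := by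
      have g1 : 1 / radR η p.1 ≤ 1 + 8 * scaleSum η J (slashN p.1) :=
        inv_sqrt_le_scaleSum hη S.hJ _
      have g2 : slashN p.2 ^ 2 / jap p.2 ≤ jap p.2 := by
        rw [div_le_iff₀ h4, ← sq]
        exact pow_le_pow_left₀ (slashN_nonneg _) (slashN_le_jap _) 2
      have g3 : slashN p.2 ^ 2 / jap p.2 * (1 / radR η p.1) ≤
          slashN p.2 ^ 2 / jap p.2 * (1 + 8 * scaleSum η J (slashN p.1)) := by gcongr
      have g4 : jap p.2 * (6 / z ^ 6003 * ‖rvpField F s p.1‖ + A + 1) ≤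
          (1 + ‖p.2‖) * (6 / z ^ 6003 * ‖rvpField F s p.1‖ + A + 1) := by
        gcongr
        exact jap_le _
      have e : 6 * jap p.2 * ‖rvpField F s p.1‖ / z ^ 6003 =
        jap p.2 * (6 / z ^ 6003 * ‖rvpField F s p.1‖) := by ring
      rw [virErr, ← hA, e]
      linarith
    have h2 : ENNReal.ofReal (virErr F η (z ^ 6003) X V s p) ≤
        ENNReal.ofReal (1 + ‖p.2‖) * K +
          8 * ENNReal.ofReal (slashN p.2 ^ 2 / jap p.2 * scaleSum η J (slashN p.1)) := by
      refine (ENNReal.ofReal_le_ofReal h1).trans ?_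
      rw [ENNReal.ofReal_add (by positivity) (by positivity),
        ENNReal.ofReal_mul (p := 1 + ‖p.2‖) (by positivity), ENNReal.ofReal_mul (p := 8) (by positivity),
        ENNReal.ofReal_add (by positivity) zero_le_one, ENNReal.ofReal_add (by positivity) hA0,
        ENNReal.ofReal_mul (by positivity), ENNReal.ofReal_one, hK, ofReal_norm,
        ENNReal.ofReal_ofNat]
      have := S.enorm_field_le_fieldB hs p.1
      gcongr
    calc _ ≤ dens F s p * (ENNReal.ofReal (1 + ‖p.2‖) * K +
          8 * ENNReal.ofReal (slashN p.2 ^ 2 / jap p.2 * scaleSum η J (slashN p.1))) :=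
          mul_le_mul_right h2 _
      _ = _ := by ring
  have hm : Measurable fun p : E3 × E3 => dens F s p * ENNReal.ofReal (1 + ‖p.2‖) :=
    (S.measurable_dens s).mul (by fun_prop)
  calc _ ≤ _ := lintegral_mono hpt
    _ = (∫⁻ p, dens F s p * ENNReal.ofReal (1 + ‖p.2‖)) * K + 8 * morI (dens F s) η J := by
        rw [lintegral_add_left (hm.mul_const _), lintegral_mul_const _ hm,
          lintegral_const_mul' _ _ (by simp), morI]
    _ ≤ ENNReal.ofReal z * K + 8 * morI (dens F s) η J := by
        gcongr
        exact S.energy s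
    _ ≤ _ := by
        have h8 : (8 : ℝ≥0∞) ≤ ENNReal.ofReal (8 * z) := by
          rw [← ENNReal.ofReal_ofNat]
          exact ENNReal.ofReal_le_ofReal (by linarith)
        have h1 : ENNReal.ofReal z ≤ ENNReal.ofReal (8 * z) :=
          ENNReal.ofReal_le_ofReal (by linarith)
        rw [hK, ← hA, mul_add _ _ 1, mul_one, mul_add (ENNReal.ofReal (8 * z)), mul_one, add_assoc]
        gcongr

lemma lintegral_virErr_le (S : Setup F t z n η J) (K : Charac F t X V) {a b : ℝ} (ha : 0 ≤ a)
    (hab : a ≤ b) (hb : b ≤ t) (hfast : ∀ s ∈ Ioo a b, z ^ 5999 / 2 ≤ ‖V s‖) :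
    ∫⁻ s in Ioo a b, ∫⁻ p, dens F s p * ENNReal.ofReal (virErr F η (z ^ 6003) X V s p) ≤
      ENNReal.ofReal (z ^ 17) := by
  have hz := S.hz
  have hz0 : 0 < z := by linarith
  have hη := S.hη
  have hm : Measurable fun s => ENNReal.ofReal |accV η (X s) (V s) (rvpField F s (X s))| :=
    ENNReal.measurable_ofReal.comp (S.measurable_accV_charac K).norm
  calc _ ≤ ∫⁻ s in Ioo a b, (ENNReal.ofReal z * (ENNReal.ofReal (6 / z ^ 6003) * fieldB F z η J s +
        ENNReal.ofReal |accV η (X s) (V s) (rvpField F s (X s))|) +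
      ENNReal.ofReal (8 * z) * (1 + morI (dens F s) η J)) :=
        setLIntegral_mono' measurableSet_Ioo fun s hs =>
          S.lintegral_virErr_slice_le X V ⟨ha.trans hs.1.le, hs.2.le.trans hb⟩
    _ = ∫⁻ s in Ioo a b, (ENNReal.ofReal z * ENNReal.ofReal
          |accV η (X s) (V s) (rvpField F s (X s))| +
        (ENNReal.ofReal (z * (6 / z ^ 6003)) * fieldB F z η J s +
          ENNReal.ofReal (8 * z) * (1 + morI (dens F s) η J))) := by
        refine lintegral_congr fun s => ?_
        rw [ENNReal.ofReal_mul hz0.le]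
        ring
    _ = ENNReal.ofReal z * (∫⁻ s in Ioo a b, ENNReal.ofReal
          |accV η (X s) (V s) (rvpField F s (X s))|) +
        ((ENNReal.ofReal (z * (6 / z ^ 6003)) * ENNReal.ofReal (z ^ 6010) +
          ENNReal.ofReal (8 * z)) * ∫⁻ s in Ioo a b, (1 + morI (dens F s) η J)) := by
        rw [lintegral_add_left (hm.const_mul _), lintegral_const_mul' _ _ ENNReal.ofReal_ne_top]
        congr 1
        rw [← lintegral_const_mul' _ _ (by finiteness)]
        refine lintegral_congr fun s => ?_
        rw [fieldB]
        ring
    _ ≤ ENNReal.ofReal z * ENNReal.ofReal (z ^ 15) +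
        ((ENNReal.ofReal (z * (6 / z ^ 6003)) * ENNReal.ofReal (z ^ 6010) +
          ENNReal.ofReal (8 * z)) * ENNReal.ofReal (z ^ 3)) := by
        have h1 := S.lintegral_accV_le K ha hab hb hfast
        have h2 := S.lintegral_one_add_morI_le ha hb
        gcongr
    _ ≤ _ := by
        rw [← ENNReal.ofReal_mul (by positivity), ← ENNReal.ofReal_mul (by positivity),
          ← ENNReal.ofReal_add (by positivity) (by positivity), ← ENNReal.ofReal_mul (by positivity),
          ← ENNReal.ofReal_add (by positivity) (by positivity)]
        refine ENNReal.ofReal_le_ofReal ?_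
        have e : z * (6 / z ^ 6003) * z ^ 6010 = 6 * z ^ 8 := by
          rw [show z ^ 6010 = z ^ 6003 * z ^ 7 by rw [← pow_add]]
          field_simp
        rw [e]
        have h1 : z ^ 11 ≤ z ^ 16 := pow_le_pow_right₀ (by linarith) (by norm_num)
        have h2 : z ^ 4 ≤ z ^ 16 := pow_le_pow_right₀ (by linarith) (by norm_num)
        have h3 : 10 ^ 6 * z ^ 16 ≤ z * z ^ 16 := by gcongr
        have e1 : z * z ^ 15 + (6 * z ^ 8 + 8 * z) * z ^ 3 = z ^ 16 + 6 * z ^ 11 + 8 * z ^ 4 := by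
          ring
        have e2 : z ^ 17 = z * z ^ 16 := by ring
        have h4 : 0 ≤ z ^ 16 := by positivity
        rw [e1, e2]
        linarith

/-- The radial virial estimate at a single scale. -/
lemma virial_scale (S : Setup F t z n η J) (K : Charac F t X V) {a b r : ℝ} (hr : 0 < r)
    (ha : 0 ≤ a) (hab : a ≤ b) (hb : b ≤ t) (hfast : ∀ s ∈ Ioo a b, z ^ 5999 / 2 ≤ ‖V s‖) :
    ∫⁻ s in Ioo a b, ∫⁻ p, dens F s p * ENNReal.ofReal (omg (z ^ 6003) p.2 *
      (radV η p - radV η (X s, V s)) ^ 2 * satD r (radR η p.1 - radR η (X s))) ≤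
      ENNReal.ofReal (z ^ 18) := by
  have hz := S.hz
  have hz0 : 0 < z := by linarith
  have hη := S.hη
  have hq : 0 < z ^ 6003 := by positivity
  obtain ⟨CE, hCE, hE⟩ := S.exists_field_le
  obtain ⟨C, O⟩ := S.obs_virObs K hq hr ha hb
  obtain ⟨B, hB⟩ : ∃ B : ℝ, B = 6 * CE / z ^ 6003 + 2 / η + 2 * CE := ⟨_, rfl⟩
  have hB0 : 0 < B := by rw [hB]; positivity
  have hr' : 0 < 1 / r := by positivity
  have hpos : ∀ s (p : E3 × E3), 0 ≤ omg (z ^ 6003) p.2 * (radV η p - radV η (X s, V s)) ^ 2 *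
      satD r (radR η p.1 - radR η (X s)) := fun s p =>
    mul_nonneg (mul_nonneg (omg_nonneg hq.le _) (sq_nonneg _)) (satD_nonneg _ _)
  have hdiff : ∀ s (p : E3 × E3), |radV η p - radV η (X s, V s)| ≤ 2 := fun s p => by
    have h1 := abs_le.1 (abs_radV_le hη p)
    have h2 := abs_le.1 (abs_radV_le hη (X s, V s))
    exact abs_le.2 ⟨by linarith [h1.1, h2.2], by linarith [h1.2, h2.1]⟩
  have hsq : ∀ s (p : E3 × E3), (radV η p - radV η (X s, V s)) ^ 2 ≤ 2 ^ 2 := fun s p => by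
    rw [← sq_abs]
    exact pow_le_pow_left₀ (abs_nonneg _) (hdiff s p) 2
  have key := S.lintegral_weak_le O ha hab hb (C₀ := 2) (C' := B + 4 * (1 / r))
    (fun s p => (abs_virObs_le hη hq hr s p).trans (by gcongr; exact jap_le _))
    (α := fun s p => omg (z ^ 6003) p.2 * (radV η p - radV η (X s, V s)) ^ 2 *
      satD r (radR η p.1 - radR η (X s))) (fun s => ?_)
    (S.measurable_virErr K (z ^ 6003)) (κ := fun _ _ => 0) (fun s => measurable_const) hpos
    (fun s p => virErr_nonneg hη hq s p) (fun s p => ?_) (fun s p => ?_) (fun s p => ?_)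
    (fun s => by simp) (fun s hs p => ?_)
  · refine key.trans ((add_le_add_right (S.lintegral_virErr_le K ha hab hb hfast) _).trans ?_)
    rw [← ENNReal.ofReal_add (by positivity) (by positivity)]
    refine ENNReal.ofReal_le_ofReal ?_
    have h1 : z ^ 1 ≤ z ^ 17 := pow_le_pow_right₀ (by linarith) (by norm_num)
    have h2 : 10 ^ 6 * z ^ 17 ≤ z * z ^ 17 := by gcongr
    rw [show z ^ 18 = z * z ^ 17 by ring]
    rw [pow_one] at h1
    linarith
  · have h1 := (continuous_omg hq.le).measurable
    have h2 := (continuous_radV hη).measurable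
    have h4 := (continuous_radR η).measurable
    have h8 := measurable_satD r
    fun_prop
  · have h3 := jap_pos p.2
    calc _ ≤ jap p.2 * 2 ^ 2 * (1 / r) := by
          exact mul_le_mul (mul_le_mul (omg_le_jap hq _) (hsq s p) (sq_nonneg _) h3.le)
            (satD_le hr _) (satD_nonneg _ _) (by positivity)
      _ = 4 * (1 / r) * jap p.2 := by ring
      _ ≤ _ := by
          gcongr
          · linarith
          · exact jap_le _
  · refine (virErr_le hη hq hE s p).trans ?_
    rw [← hB]
    have h3 := jap_pos p.2
    exact mul_le_mul (by linarith) (jap_le _) h3.le (by positivity)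
  · rw [abs_zero]; positivity
  · have := (abs_le.1 (le_transD_virObs (F := F) (X := X) (V := V) hη hq hr s p)).1
    rw [add_zero]
    linarith

/-- The radial virial estimate. -/
lemma lintegral_rvI_le (S : Setup F t z n η J) (K : Charac F t X V) {a b : ℝ}
    (ha : 0 ≤ a) (hab : a ≤ b) (hb : b ≤ t) (hfast : ∀ s ∈ Ioo a b, z ^ 5999 / 2 ≤ ‖V s‖) :
    ∫⁻ s in Ioo a b, rvI (dens F s) η J (z ^ 6003) (radV η (X s, V s)) (radR η (X s)) ≤
      ENNReal.ofReal (z ^ 19) := by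
  have hz := S.hz
  have hz0 : 0 < z := by linarith
  have hη := S.hη
  have hq : 0 < z ^ 6003 := by positivity
  have h := lintegral_sum_scales (J := J) (a := a) (b := b) S.measurable_dens_uncurry
    (c := fun j w => omg (z ^ 6003) w.2.2 * (radV η w.2 - radV η (X w.1, V w.1)) ^ 2 *
      satD (2 ^ j * η) (radR η w.2.1 - radR η (X w.1))) (fun j => ?_)
    (fun j w => mul_nonneg (mul_nonneg (omg_nonneg hq.le _) (sq_nonneg _)) (satD_nonneg _ _))
    (fun j => S.virial_scale K (by positivity : 0 < 2 ^ j * η) ha hab hb hfast)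
  · refine le_trans (le_of_eq ?_) (h.trans ?_)
    · refine lintegral_congr fun s => lintegral_congr fun p => ?_
      rw [← Finset.mul_sum]
      rfl
    · rw [← ENNReal.ofReal_mul (by positivity)]
      refine ENNReal.ofReal_le_ofReal ?_
      rw [show z ^ 19 = z * z ^ 18 by ring]
      gcongr
      exact S.hJz
  · have hXm := K.contX.measurable
    have hVm := K.contV.measurable
    have h1 := (continuous_omg hq.le).measurable
    have h2 := (continuous_radV hη).measurable
    have h4 := (continuous_radR η).measurable
    have h8 := measurable_satD (2 ^ j * η)
    fun_prop

end Setup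

namespace Setup
variable {F : ℝ → E3 → E3 → ℝ} {t z : ℝ} {n : ℕ} {η : ℝ} {J : ℕ} {X V : ℝ → E3}

lemma measurable_morI (S : Setup F t z n η J) : Measurable fun s => morI (dens F s) η J := by
  have h1 := continuous_slashN.measurable
  have h2 := continuous_jap.measurable
  have h : Measurable fun w : ℝ × E3 × E3 => dens F w.1 w.2 *
      ENNReal.ofReal (slashN w.2.2 ^ 2 / jap w.2.2 * scaleSum η J (slashN w.2.1)) := by
    have h3 : Measurable fun w : ℝ × E3 × E3 =>
        ENNReal.ofReal (slashN w.2.2 ^ 2 / jap w.2.2 * scaleSum η J (slashN w.2.1)) := by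
      unfold scaleSum
      fun_prop
    exact S.measurable_dens_uncurry.mul h3
  exact h.lintegral_prod_right'

/-- Over a time interval on which a particle is fast, its momentum changes little. -/
lemma norm_sub_le_of_fast (S : Setup F t z n η J) (K : Charac F t X V) {a b : ℝ} (ha : 0 ≤ a)
    (hab : a ≤ b) (hb : b ≤ t) (hfast : ∀ s ∈ Ioo a b, z ^ 5999 / 2 ≤ ‖V s‖) :
    ‖V b - V a‖ ≤ z ^ 5932 := by
  have hz := S.hz
  have hz0 : 0 < z := by linarith
  obtain ⟨CE, hCE, hE⟩ := S.exists_field_le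
  have hm := S.measurable_field_charac K
  have hmor : Measurable fun s => 1 + morI (dens F s) η J := measurable_const.add S.measurable_morI
  have hint : IntegrableOn (fun s => rvpField F s (X s)) (Ioo a b) :=
    Measure.integrableOn_of_bounded (M := CE) (by simp) hm.aestronglyMeasurable
      (Eventually.of_forall fun s => hE s (X s))
  have hftc : ∫ s in a..b, rvpField F s (X s) = V b - V a :=
    intervalIntegral.integral_eq_sub_of_hasDerivAt_of_le hab K.contV.continuousOn
      (fun s hs => K.derivV s ⟨ha.trans_lt hs.1, hs.2.trans_le hb⟩)
      ((intervalIntegrable_iff_integrableOn_Ioo_of_le hab).2 hint)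
  rw [← hftc, intervalIntegral.integral_of_le hab, integral_Ioc_eq_integral_Ioo,
    ← ENNReal.ofReal_le_ofReal_iff (by positivity), ofReal_norm]
  calc _ ≤ ∫⁻ s in Ioo a b, ‖rvpField F s (X s)‖ₑ := enorm_integral_le_lintegral_enorm _
    _ ≤ ∫⁻ s in Ioo a b, ENNReal.ofReal (z ^ 5912) * (1 + morI (dens F s) η J +
          rvI (dens F s) η J (z ^ 6003) (radV η (X s, V s)) (radR η (X s))) :=
        setLIntegral_mono' measurableSet_Ioo fun s hs => (S.enorm_field_le s (X s)).trans
          ((S.fieldData ⟨ha.trans hs.1.le, hs.2.le.trans hb⟩).field_target_le (X s) _)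
    _ = ENNReal.ofReal (z ^ 5912) * ((∫⁻ s in Ioo a b, (1 + morI (dens F s) η J)) +
          ∫⁻ s in Ioo a b,
            rvI (dens F s) η J (z ^ 6003) (radV η (X s, V s)) (radR η (X s))) := by
        rw [lintegral_const_mul' _ _ ENNReal.ofReal_ne_top,
          lintegral_add_left hmor]
    _ ≤ ENNReal.ofReal (z ^ 5912) * (ENNReal.ofReal (z ^ 3) + ENNReal.ofReal (z ^ 19)) :=
        mul_le_mul_right (add_le_add (S.lintegral_one_add_morI_le ha hb)
          (S.lintegral_rvI_le K ha hab hb hfast)) _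
    _ ≤ _ := by
        rw [← ENNReal.ofReal_add (by positivity) (by positivity),
          ← ENNReal.ofReal_mul (by positivity)]
        refine ENNReal.ofReal_le_ofReal ?_
        rw [show z ^ 5932 = z ^ 5912 * (z * z ^ 19) by rw [← pow_succ', ← pow_add]]
        have h1 : z ^ 3 ≤ z ^ 19 := pow_le_pow_right₀ (by linarith) (by norm_num)
        have h2 : 10 ^ 6 * z ^ 19 ≤ z * z ^ 19 := by gcongr
        have h3 : 0 ≤ z ^ 19 := by positivity
        gcongr
        linarith

/-- A particle that starts slow stays below the threshold momentum. -/
lemma norm_le_of_slow_start (S : Setup F t z n η J) (K : Charac F t X V) {H : ℝ}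
    (hH : z ^ 5999 ≤ H) (h0 : ‖V 0‖ ≤ H / 2) {s : ℝ} (hs : s ∈ Icc 0 t) : ‖V s‖ ≤ H := by
  have hz := S.hz
  have hz0 : 0 < z := by linarith
  by_contra! hc
  have hcomp : IsCompact {u | u ∈ Icc 0 s ∧ ‖V u‖ ≤ H / 2} :=
    isCompact_Icc.inter_right (isClosed_le K.contV.norm continuous_const)
  obtain ⟨a, ⟨ha, haV⟩, hmax⟩ := hcomp.exists_isGreatest ⟨0, ⟨le_rfl, hs.1⟩, h0⟩
  have hfast : ∀ u ∈ Ioo a s, z ^ 5999 / 2 ≤ ‖V u‖ := by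
    intro u hu
    by_contra! hlt
    exact absurd (hmax ⟨⟨ha.1.trans hu.1.le, hu.2.le⟩, by linarith⟩) (not_le.2 hu.1)
  have h1 := S.norm_sub_le_of_fast K ha.1 ha.2 hs.2 hfast
  have h2 := norm_sub_norm_le (V s) (V a)
  have h3 : 10 ^ 6 * z ^ 5932 ≤ z ^ 5999 := by
    rw [show z ^ 5999 = z * (z ^ 66 * z ^ 5932) by rw [← pow_add, ← pow_succ']]
    have h4 : 1 ≤ z ^ 66 := one_le_pow₀ (by linarith)
    have h5 : 0 ≤ z ^ 5932 := by positivity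
    have h6 : z ^ 5932 ≤ z ^ 66 * z ^ 5932 := le_mul_of_one_le_left h5 h4
    exact mul_le_mul hz h6 h5 hz0.le
  have h5 : 0 < z ^ 5932 := by positivity
  linarith

end Setup

/-- The projection of the time line onto `[0, t]`. -/
def clampT (t s : ℝ) : ℝ := max 0 (min t s)

lemma continuous_clampT (t : ℝ) : Continuous (clampT t) :=
  continuous_const.max (continuous_const.min continuous_id)

lemma clampT_mem {t : ℝ} (ht : 0 ≤ t) (s : ℝ) : clampT t s ∈ Icc 0 t :=
  ⟨le_max_left _ _, max_le ht (min_le_left _ _)⟩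

lemma clampT_of_mem {t s : ℝ} (hs : s ∈ Icc 0 t) : clampT t s = s := by
  rw [clampT, min_eq_right hs.2, max_eq_right hs.1]

lemma rvpField_clampT (f : ℝ → E3 → E3 → ℝ) {t s : ℝ} (hs : s ∈ Icc 0 t) (x : E3) :
    rvpField (fun s => f (clampT t s)) s x = rvpField f s x := by
  change rvpField f (clampT t s) x = _
  rw [clampT_of_mem hs]

lemma lintegral_dens_mul_le {F : ℝ → E3 → E3 → ℝ} {s c : ℝ} {w : E3 × E3 → ℝ}
    (hF : ∀ x v, 0 ≤ F s x v) (hw : ∀ p, 0 ≤ w p)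
    (hi : Integrable fun p : E3 × E3 => w p * F s p.1 p.2)
    (hc : ∫ p : E3 × E3, w p * F s p.1 p.2 ≤ c) :
    ∫⁻ p, dens F s p * ENNReal.ofReal (w p) ≤ ENNReal.ofReal c := by
  refine le_trans (le_of_eq ?_) (ENNReal.ofReal_le_ofReal hc)
  rw [ofReal_integral_eq_lintegral_ofReal hi
    (Eventually.of_forall fun p => mul_nonneg (hw p) (hF p.1 p.2))]
  refine lintegral_congr fun p => ?_
  rw [ENNReal.ofReal_mul (hw p), mul_comm, dens]

/-- The derivative data of a classical solution frozen outside `[0, t]`. -/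
lemma exists_deriv_clampT {T t : ℝ} {f : ℝ → E3 → E3 → ℝ} (hf : IsRVPSolution (Ico 0 T) f)
    (ht : t ∈ Ico 0 T) :
    ∃ G : ℝ × E3 × E3 → (ℝ × E3 × E3 →L[ℝ] ℝ), Continuous G ∧ ∀ s ∈ Ioo 0 t, ∀ p,
      HasFDerivAt (fun q : ℝ × E3 × E3 => f (clampT t q.1) q.2.1 q.2.2) (G (s, p)) (s, p) ∧
      G (s, p) (1, vhat p.2, rvpField (fun s => f (clampT t s)) s p.1) = 0 := by
  obtain ⟨-, hC, htr⟩ := hf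
  have hT : 0 < T := ht.1.trans_lt ht.2
  have hU : UniqueDiffOn ℝ (Ico 0 T ×ˢ (univ : Set (E3 × E3))) :=
    (uniqueDiffOn_Ico 0 T).prod uniqueDiffOn_univ
  have hmem : ∀ q : ℝ × E3 × E3, (clampT t q.1, q.2) ∈ Ico 0 T ×ˢ (univ : Set (E3 × E3)) :=
    fun q => ⟨⟨(clampT_mem ht.1 q.1).1, (clampT_mem ht.1 q.1).2.trans_lt ht.2⟩, mem_univ _⟩
  refine ⟨fun q => fderivWithin ℝ (fun p : ℝ × E3 × E3 => f p.1 p.2.1 p.2.2)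
    (Ico 0 T ×ˢ (univ : Set (E3 × E3))) (clampT t q.1, q.2), ?_, fun s hs p => ?_⟩
  · exact (hC.continuousOn_fderivWithin hU le_rfl).comp_continuous
      (((continuous_clampT t).comp continuous_fst).prodMk continuous_snd) hmem
  · have hs' : clampT t s = s := clampT_of_mem ⟨hs.1.le, hs.2.le⟩
    have hsT : s ∈ Ico 0 T := ⟨hs.1.le, hs.2.trans ht.2⟩
    have hnhds : Ico 0 T ×ˢ (univ : Set (E3 × E3)) ∈ 𝓝 (s, p) :=
      prod_mem_nhds (Ico_mem_nhds hs.1 (hs.2.trans ht.2)) univ_mem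
    beta_reduce
    rw [rvpField_clampT f ⟨hs.1.le, hs.2.le⟩]
    simp only [hs']
    refine ⟨?_, htr s hsT p.1 p.2⟩
    have h1 := ((hC.differentiableOn one_ne_zero) (s, p) ⟨hsT, mem_univ _⟩).hasFDerivWithinAt
    refine (h1.hasFDerivAt hnhds).congr_of_eventuallyEq ?_
    have h2 : Ioo 0 t ×ˢ (univ : Set (E3 × E3)) ∈ 𝓝 (s, p) :=
      prod_mem_nhds (Ioo_mem_nhds hs.1 hs.2) univ_mem
    filter_upwards [h2] with q hq
    rw [clampT_of_mem ⟨hq.1.1.le, hq.1.2.le⟩]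

lemma continuous_clampT_solution {T t : ℝ} {f : ℝ → E3 → E3 → ℝ}
    (hf : IsRVPSolution (Ico 0 T) f) (ht : t ∈ Ico 0 T) :
    Continuous fun q : ℝ × E3 × E3 => f (clampT t q.1) q.2.1 q.2.2 :=
  hf.2.1.continuousOn.comp_continuous
    (((continuous_clampT t).comp continuous_fst).prodMk continuous_snd)
    fun q => ⟨⟨(clampT_mem ht.1 q.1).1, (clampT_mem ht.1 q.1).2.trans_lt ht.2⟩, mem_univ _⟩

lemma charac_clampT {t : ℝ} {f : ℝ → E3 → E3 → ℝ} {X V : ℝ → E3} (ht : 0 ≤ t)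
    (h : ∀ s ∈ Icc 0 t, HasDerivAt X (vhat (V s)) s ∧ HasDerivAt V (rvpField f s (X s)) s) :
    Charac (fun s => f (clampT t s)) t (fun s => X (clampT t s)) (fun s => V (clampT t s)) := by
  have hev : ∀ s ∈ Ioo 0 t, ∀ Y : ℝ → E3, (fun s => Y (clampT t s)) =ᶠ[𝓝 s] Y := by
    intro s hs Y
    filter_upwards [Ioo_mem_nhds hs.1 hs.2] with u hu
    rw [clampT_of_mem ⟨hu.1.le, hu.2.le⟩]
  have hcX : ContinuousOn X (Icc 0 t) := fun s hs => (h s hs).1.continuousAt.continuousWithinAt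
  have hcV : ContinuousOn V (Icc 0 t) := fun s hs => (h s hs).2.continuousAt.continuousWithinAt
  refine ⟨hcX.comp_continuous (continuous_clampT t) (clampT_mem ht),
    hcV.comp_continuous (continuous_clampT t) (clampT_mem ht), fun s hs => ?_, fun s hs => ?_⟩
  · rw [clampT_of_mem ⟨hs.1.le, hs.2.le⟩]
    exact (h s ⟨hs.1.le, hs.2.le⟩).1.congr_of_eventuallyEq (hev s hs X)
  · rw [rvpField_clampT f ⟨hs.1.le, hs.2.le⟩, clampT_of_mem ⟨hs.1.le, hs.2.le⟩]
    exact (h s ⟨hs.1.le, hs.2.le⟩).2.congr_of_eventuallyEq (hev s hs V)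

lemma exists_linear_le_rpow : ∃ K : ℝ, ∀ x : ℝ, K ≤ x → 0 ≤ x →
    4 * x + 1 ≤ (2 : ℝ) ^ (x / 6000) := by
  obtain ⟨c, hc⟩ : ∃ c : ℝ, c = Real.log 2 / 6000 := ⟨_, rfl⟩
  have hc0 : 0 < c := by rw [hc]; have := Real.log_pos one_lt_two; positivity
  refine ⟨8 / c ^ 2, fun x hx h0 => ?_⟩
  have e : (2 : ℝ) ^ (x / 6000) = Real.exp (c * x) := by
    rw [Real.rpow_def_of_pos two_pos, hc]
    ring_nf
  rw [e]
  refine le_trans ?_ (Real.quadratic_le_exp_of_nonneg (by positivity))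
  rw [div_le_iff₀ (by positivity)] at hx
  have h1 : 8 * x ≤ x * c ^ 2 * x := mul_le_mul_of_nonneg_right hx h0
  have h2 : 0 ≤ c * x := by positivity
  nlinarith

lemma log_one_add_pow_le {z m : ℝ} (hz : 2 ≤ z) (hm : Real.log z ≤ m / 6000)
    (hmz : 4 * m + 1 ≤ z) : Real.log (1 + z ^ 6003) ≤ z := by
  have hz0 : 0 < z := by linarith
  have h1 : 1 ≤ z ^ 6003 := one_le_pow₀ (by linarith)
  have h2 : 1 + z ^ 6003 ≤ z ^ 6004 := by
    rw [show z ^ 6004 = z * z ^ 6003 by rw [← pow_succ']]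
    nlinarith
  refine (Real.log_le_log (by positivity) h2).trans ?_
  rw [Real.log_pow]
  push_cast
  linarith

lemma exists_decay_le : ∃ C : ℝ, ∀ z, C ≤ z →
    ∫⁻ v : E3, ENNReal.ofReal (((1 + ‖v‖) ^ 4)⁻¹) ≤ ENNReal.ofReal z := by
  have h := finite_integral_one_add_norm (E := E3) (μ := volume) (r := 4)
    (by rw [finrank_euclideanSpace_fin]; norm_num)
  refine ⟨(∫⁻ v : E3, ENNReal.ofReal ((1 + ‖v‖) ^ (-4 : ℝ))).toReal, fun z hz => ?_⟩
  refine le_trans (le_of_eq ?_) ((ENNReal.ofReal_toReal h.ne).symm.le.trans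
    (ENNReal.ofReal_le_ofReal hz))
  refine lintegral_congr fun v => ?_
  rw [Real.rpow_neg (by positivity)]
  norm_cast

lemma le_pow_of_rpow_le {y P : ℝ} {k : ℕ} (hy : 0 ≤ y) (hk : k ≠ 0)
    (h : y ^ ((1 : ℝ) / k) ≤ P) : y ≤ P ^ k := by
  rw [one_div] at h
  calc y = (y ^ ((k : ℝ)⁻¹)) ^ k := (Real.rpow_inv_natCast_pow hy hk).symm
    _ ≤ P ^ k := pow_le_pow_left₀ (Real.rpow_nonneg hy _) h k

lemma le_of_pow_le_pow_of_le {a z : ℝ} {k l : ℕ} (hz : 1 ≤ z) (hkl : k ≤ l) (hl : l ≠ 0)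
    (h : a ^ l ≤ z ^ k) : a ≤ z :=
  le_of_pow_le_pow_left₀ hl (by linarith) (h.trans (pow_le_pow_right₀ hz hkl))

/-- The momentum bound along characteristics in terms of the dyadic size `2 ^ M`. -/
lemma exists_norm_le (D : ℝ) :
    ∃ K₀ : ℝ, ∀ (T : ℝ) (f : ℝ → E3 → E3 → ℝ) (n N : ℕ),
      20000 ≤ n → 6000 * (n - 1) ≤ N → N ≠ 0 →
      IsRVPSolution (Ico 0 T) f →
      (∀ t ∈ Ico (0 : ℝ) T, ∀ (θ : ℝ) (x v : E3), f t (rotZ θ x) (rotZ θ v) = f t x v) →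
      (∀ t ∈ Ico (0 : ℝ) T, ∀ x v, f t x v ≤ D) →
      (∀ t ∈ Ico (0 : ℝ) T, Integrable (fun p : E3 × E3 => (1 + ‖p.2‖) * f t p.1 p.2)) →
      (∀ t ∈ Ico (0 : ℝ) T, (∫ p : E3 × E3, (1 + ‖p.2‖) * f t p.1 p.2) ≤ D) →
      Integrable (fun p : E3 × E3 => (|angL p| ^ 13)⁻¹ * f 0 p.1 p.2) →
      (∫ p : E3 × E3, (|angL p| ^ 13)⁻¹ * f 0 p.1 p.2) ≤ D →
      ∀ t ∈ Ico (0 : ℝ) T, ∀ M : ℕ,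
        (∀ s ∈ Icc (0 : ℝ) t, Integrable fun p : E3 × E3 => (1 + ‖p.2‖) ^ n * f s p.1 p.2) →
        (∀ s ∈ Icc (0 : ℝ) t,
          (∫ p : E3 × E3, (1 + ‖p.2‖) ^ n * f s p.1 p.2) ≤ (2 ^ M) ^ (n - 1)) →
        (1 + t) ^ N ≤ (2 ^ M) ^ (n - 1) → K₀ ≤ (M : ℝ) →
        ∀ X V : ℝ → E3, (∀ s ∈ Icc (0 : ℝ) t,
            HasDerivAt X (vhat (V s)) s ∧ HasDerivAt V (rvpField f s (X s)) s) →
          ‖V 0‖ ≤ (2 : ℝ) ^ ((M : ℝ) / 2) → ∀ s ∈ Icc (0 : ℝ) t,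
            ‖V s‖ ≤ (2 : ℝ) ^ ((1 - epsC / 2) * (M : ℝ)) := by
  obtain ⟨K, hK⟩ := exists_linear_le_rpow
  obtain ⟨C, hC⟩ := exists_decay_le
  refine ⟨max (max K C) (max D (10 ^ 6)), ?_⟩
  intro T f n N hn hN hN0 hf hsym hle hei he hai ha t ht M hmi hm htM hM X V hXV hV0 s hs
  have hM0 : (0 : ℝ) ≤ M := Nat.cast_nonneg M
  obtain ⟨⟨hMK, hMC⟩, hMD, hM6⟩ : (K ≤ M ∧ C ≤ M) ∧ D ≤ M ∧ (10 : ℝ) ^ 6 ≤ M := by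
    simpa only [max_le_iff] using hM
  obtain ⟨z, hz⟩ : ∃ z : ℝ, z = (2 : ℝ) ^ ((M : ℝ) / 6000) := ⟨_, rfl⟩
  have hMz : 4 * (M : ℝ) + 1 ≤ z := by rw [hz]; exact hK M hMK hM0
  have hDz : D ≤ z := by linarith
  have hz6 : (10 : ℝ) ^ 6 ≤ z := by linarith
  have hz2 : 2 ≤ z := by linarith
  have hz0 : 0 < z := by linarith
  have hzM : z ^ 6000 = 2 ^ M := by
    rw [hz, ← Real.rpow_mul_natCast two_pos.le, ← Real.rpow_natCast]
    congr 1
    push_cast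
    ring
  have hlog : Real.log z ≤ M / 6000 := by
    rw [hz, Real.log_rpow two_pos]
    have := Real.log_two_lt_d9
    exact mul_le_of_le_one_right (by positivity) (by linarith)
  have hH : z ^ 5999 ≤ (2 : ℝ) ^ ((1 - epsC / 2) * (M : ℝ)) := by
    rw [hz, ← Real.rpow_mul_natCast two_pos.le]
    refine Real.rpow_le_rpow_of_exponent_le one_le_two ?_
    rw [epsC]
    push_cast
    linarith
  have hV0' : ‖V 0‖ ≤ (2 : ℝ) ^ ((1 - epsC / 2) * (M : ℝ)) / 2 := by
    refine hV0.trans ?_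
    rw [le_div_iff₀ two_pos, ← Real.rpow_add_one two_ne_zero]
    refine Real.rpow_le_rpow_of_exponent_le one_le_two ?_
    rw [epsC]
    linarith
  have hcl : ∀ u, clampT t u ∈ Ico 0 T := fun u =>
    ⟨(clampT_mem ht.1 u).1, (clampT_mem ht.1 u).2.trans_lt ht.2⟩
  have htz : 1 + t ≤ z := by
    refine le_of_pow_le_pow_of_le (by linarith) hN hN0 ?_
    rw [pow_mul, hzM]
    exact htM
  have S : Setup (fun u => f (clampT t u)) t z n ((2 ^ (4 * M))⁻¹) (4 * M) :=
    { cont := continuous_clampT_solution hf ht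
      nonneg := fun u => hf.1 _ (hcl u)
      le := fun u x v => (hle _ (hcl u) x v).trans hDz
      inv := fun u => hsym _ (hcl u)
      energy := fun u => lintegral_dens_mul_le (F := f) (hf.1 _ (hcl u))
        (fun p => by positivity) (hei _ (hcl u)) ((he _ (hcl u)).trans hDz)
      moment := fun u => by
        rw [hzM]
        exact lintegral_dens_mul_le (F := f) (hf.1 _ (hcl u)) (fun p => by positivity)
          (hmi _ (clampT_mem ht.1 u)) (hm _ (clampT_mem ht.1 u))
      hn := hn
      hz := hz6
      decay := hC z (by linarith)
      deriv := exists_deriv_clampT hf ht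
      initBound := by
        have h0 : clampT t 0 = 0 := clampT_of_mem ⟨le_rfl, ht.1⟩
        have h1 : 0 ∈ Ico 0 T := ⟨le_rfl, ht.1.trans_lt ht.2⟩
        change ∫⁻ p, dens f (clampT t 0) p * ENNReal.ofReal ((|angL p| ^ 13)⁻¹) ≤ _
        rw [h0]
        exact lintegral_dens_mul_le (hf.1 0 h1) (fun p => by positivity) hai (ha.trans hDz)
      hη := by positivity
      hJ := mul_inv_cancel₀ (by positivity)
      hηz := by
        refine inv_anti₀ (by positivity) ?_
        rw [mul_comm 4 M, pow_mul, ← hzM, ← pow_mul]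
        exact pow_le_pow_right₀ (by linarith) (by norm_num)
      log_le := log_one_add_pow_le hz2 hlog hMz
      ht := ht.1
      htz := by linarith
      hJz := by push_cast; exact hMz }
  have h := S.norm_le_of_slow_start (charac_clampT ht.1 hXV) hH
    (by rw [clampT_of_mem ⟨le_rfl, ht.1⟩]; exact hV0') hs
  rwa [clampT_of_mem hs] at h

/-- Control of the majority set in the cylindrical symmetry case: along characteristics
starting (at time `0`) in the ball of radius `2^{M_t/2}` of phase space, the exponent
`β_t` measuring the maximal speed `2^{β_t M_t}` attained on `[0,t]` satisfies
`β_t ≤ 1 - ε/2`. -/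
theorem cylindrical_majority_control (D : ℝ) (hD : 0 < D) :
    ∃ K₀ : ℝ, ∀ (T : ℝ) (f : ℝ → E3 → E3 → ℝ),
      IsRVPSolution (Set.Ico 0 T) f →
      (∀ t ∈ Set.Ico (0 : ℝ) T, ∀ (θ : ℝ) (x v : E3),
        f t (rotZ θ x) (rotZ θ v) = f t x v) →
      (∀ t ∈ Set.Ico (0 : ℝ) T, ∀ x v, f t x v ≤ D) →
      (∀ t ∈ Set.Ico (0 : ℝ) T,
        Integrable (fun p : E3 × E3 => (1 + ‖p.2‖) * f t p.1 p.2) volume) →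
      (∀ t ∈ Set.Ico (0 : ℝ) T, (∫ p : E3 × E3, (1 + ‖p.2‖) * f t p.1 p.2) ≤ D) →
      Integrable (fun p : E3 × E3 =>
        (1 + ‖p.1‖ + ‖p.2‖) ^ (10 ^ 8 : ℕ) * f 0 p.1 p.2) volume →
      (∫ p : E3 × E3, (1 + ‖p.1‖ + ‖p.2‖) ^ (10 ^ 8 : ℕ) * f 0 p.1 p.2) ≤ D →
      Integrable (fun p : E3 × E3 =>
        (|p.1 0 * p.2 1 - p.1 1 * p.2 0| ^ (13 : ℕ))⁻¹ * f 0 p.1 p.2) volume →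
      (∫ p : E3 × E3, (|p.1 0 * p.2 1 - p.1 1 * p.2 0| ^ (13 : ℕ))⁻¹ * f 0 p.1 p.2) ≤ D →
      ∀ t ∈ Set.Ico (0 : ℝ) T,
        (∀ s ∈ Set.Icc (0 : ℝ) t,
          Integrable (fun p : E3 × E3 =>
            (1 + ‖p.2‖) ^ (10 ^ 7 : ℕ) * f s p.1 p.2) volume) →
        BddAbove (momentNc f '' Set.Icc 0 t) →
        ∀ M : ℕ, IsLeast {k : ℕ | tildeMc f t ^ ((1 : ℝ) / (ncR - 1)) ≤ (2 : ℝ) ^ k} M →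
        ∀ X V : E3 → E3 → ℝ → E3,
          (∀ (x v : E3), ∀ s ∈ Set.Icc (0 : ℝ) t,
            HasDerivAt (X x v) (vhat (V x v s)) s ∧
            HasDerivAt (V x v) (rvpField f s (X x v s)) s) →
          (∀ x v : E3, X x v t = x ∧ V x v t = v) →
          K₀ ≤ (M : ℝ) →
          sSup {β : ℝ | ∃ x v : E3,
              ‖X x v 0‖ + ‖V x v 0‖ ≤ (2 : ℝ) ^ ((M : ℝ) / 2) ∧
              β = sSup ((fun s => sInf {k : ℝ | 0 ≤ k ∧
                    ‖V x v s‖ ≤ (2 : ℝ) ^ (k * (M : ℝ))}) '' Set.Icc 0 t)} ≤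
            1 - epsC / 2 := by
  obtain ⟨K₀, hK₀⟩ := exists_norm_le D
  refine ⟨K₀, ?_⟩
  intro T f hf hsym hle hei he _ _ hai ha t ht hmi hbdd M hM X V hXV _ hKM
  have hε : 0 ≤ 1 - epsC / 2 := by rw [epsC]; norm_num
  obtain ⟨n, hn⟩ : ∃ n : ℕ, n = 10 ^ 7 := ⟨_, rfl⟩
  obtain ⟨N, hN⟩ : ∃ N : ℕ, N = 10 ^ 14 := ⟨_, rfl⟩
  have hn2 : 20000 ≤ n := by rw [hn]; norm_num
  have hNn : 6000 * (n - 1) ≤ N := by rw [hn, hN]; norm_num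
  have hN0 : N ≠ 0 := by rw [hN]; norm_num
  have hmom : ∀ s, momentNc f s = ∫ p : E3 × E3, (1 + ‖p.2‖) ^ n * f s p.1 p.2 := fun s => by
    rw [hn, momentNc]
  have htil : tildeMc f t = (1 + t) ^ N + sSup (momentNc f '' Icc 0 t) := by rw [hN, tildeMc]
  have hnc : ncR - 1 = ((n - 1 : ℕ) : ℝ) := by
    rw [Nat.cast_sub (by omega), hn, ncR]
    norm_num
  have hmom0 : ∀ s ∈ Icc 0 t, 0 ≤ momentNc f s := fun s hs => by
    rw [hmom]
    exact integral_nonneg fun p =>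
      mul_nonneg (by positivity) (hf.1 s ⟨hs.1, hs.2.trans_lt ht.2⟩ p.1 p.2)
  have hsup : 0 ≤ sSup (momentNc f '' Icc 0 t) :=
    Real.sSup_nonneg (by rintro _ ⟨s, hs, rfl⟩; exact hmom0 s hs)
  have htN : 0 ≤ (1 + t) ^ N := by have := ht.1; positivity
  have hY : tildeMc f t ≤ (2 ^ M) ^ (n - 1) := by
    have h1 : tildeMc f t ^ ((1 : ℝ) / (ncR - 1)) ≤ 2 ^ M := hM.1
    rw [hnc] at h1
    exact le_pow_of_rpow_le (by rw [htil]; positivity) (by omega) h1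
  rw [htil] at hY
  have hbound := hK₀ T f n N hn2 hNn hN0 hf hsym hle hei he hai ha t ht M
    (by rw [hn]; exact hmi)
    (fun s hs => by
      rw [← hmom]
      have := le_csSup hbdd (mem_image_of_mem _ hs)
      linarith)
    (by linarith) hKM
  refine Real.sSup_le ?_ hε
  rintro β ⟨x, v, hxv, rfl⟩
  refine Real.sSup_le ?_ hε
  rintro _ ⟨s, hs, rfl⟩
  exact csInf_le ⟨0, fun k hk => hk.1⟩ ⟨hε, hbound (X x v) (V x v) (hXV x v)
    ((le_add_of_nonneg_left (norm_nonneg _)).trans hxv) s hs⟩
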